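/- arXiv:math/0306333 — 2 statements merged into one kernel-verified Lean document; each statement's English description precedes it below -/
import Mathlib

section
/- Let k be an algebraically closed field of characteristic zero and h ∈ GL_N(k(t)) a matrix of rational functions satisfying h(x^{-1}) = h(x)^{-1} in GL_N(k(x)) and h(x)·h(y) = h(xy−x+1)·h(xy·(xy−x+1)^{-1}) in GL_N(k(x,y)). Suppose moreover that f ∈ GL_N(k) is a unipotent matrix which normalizes the subgroup of GL_N(k) generated by the values {h(t) : t ∈ k∖{0,1}}, and that h(x)·h(2 − x^{-1}) = f·h(2x−1)·f^{-1} in GL_N(k(x)). Then h(x)·h(y) = h(xy) in GL_N(k(x,y)), i.e. h is multiplicative. -/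
namespace FEM
open Filter

/-- Relations in an abstract group. -/
structure GRel {k G : Type} [Field k] [Group G] (η : k → G) (f : G) : Prop where
  r1 : ∀ x : k, x ≠ 0 → x ≠ 1 → η x * η x⁻¹ = 1
  r2 : ∀ x y : k, x ≠ 0 → x ≠ 1 → y ≠ 0 → y ≠ 1 → x * y - x + 1 ≠ 0 →
    η x * η y = η (x * y - x + 1) * η (x * y / (x * y - x + 1))
  r3 : ∀ x : k, x ≠ 0 → x ≠ 1 → 2 * x - 1 ≠ 0 → η x * η (2 - x⁻¹) * f = f * η (2 * x - 1)
  r4 : ∀ u ∈ Subgroup.closure {g : G | ∃ x : k, x ≠ 0 ∧ x ≠ 1 ∧ g = η x},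
    f⁻¹ * u * f ∈ Subgroup.closure {g : G | ∃ x : k, x ≠ 0 ∧ x ≠ 1 ∧ g = η x}
  r5 : Subgroup.closure ({g : G | ∃ x : k, x ≠ 0 ∧ x ≠ 1 ∧ g = η x} ∪ {f}) = ⊤

/-- Representations that we consider. -/
structure GRep {k G V : Type} [Field k] [Group G] [AddCommGroup V] [Module k V]
    (η : k → G) (f : G) (ρ : G →* Module.End k V) : Prop where
  nil : IsNilpotent (ρ f - 1)
  rat : ∃ d0 : ℤ, ∀ d ≤ d0, ∃ a b : ℤ, ∀ w : V, ∃ c : ℤ → V, ∀ x : k, x ≠ 0 → x ≠ 1 →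
    ρ (η x) w = x ^ d • ∑ l ∈ Finset.Icc a b, (x - 1) ^ l • c l

section
variable {k G V : Type} [Field k] [Group G] [AddCommGroup V] [Module k V]

theorem weights [Infinite k] (A : ℕ) (Z : Set k) (hZ : Z.Infinite) (h0 : (0 : k) ∉ Z) (j0 : ℤ)
    (hj0 : |j0| ≤ A) :
    ∃ (s : Finset k) (ω : k → k), (∀ z ∈ s, z ∈ Z) ∧ ∀ i : ℤ, |i| ≤ A →
      ∑ z ∈ s, ω z * z ^ i = if i = j0 then 1 else 0 := by
  classical
  obtain ⟨s, hsZ, hcard⟩ := hZ.exists_subset_card_eq (2 * A + 1)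
  let e : Fin (2 * A + 1) ≃ s := (Fintype.equivFinOfCardEq (by simpa using hcard)).symm
  let z : Fin (2 * A + 1) → k := fun i => (e i : k)
  have hz0 : ∀ i, z i ≠ 0 := fun i h => h0 (h ▸ hsZ (e i).2)
  have hinj : Function.Injective z := fun i j h => e.injective (Subtype.ext h)
  have hdet : IsUnit (Matrix.vandermonde z).det :=
    isUnit_iff_ne_zero.2 (Matrix.det_vandermonde_ne_zero_iff.2 hinj)
  set M := Matrix.vandermonde z with hM
  have hMM : M⁻¹ * M = 1 := Matrix.nonsing_inv_mul _ hdet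
  have hj := abs_le.1 hj0
  let j1 : Fin (2 * A + 1) := ⟨(j0 + A).toNat, by omega⟩
  let ω : k → k := fun y => if hy : y ∈ s then M⁻¹ j1 (e.symm ⟨y, hy⟩) * y ^ (A : ℤ) else 0
  refine ⟨s, ω, fun y hy => hsZ hy, fun i hi => ?_⟩
  have hi' := abs_le.1 hi
  let i1 : Fin (2 * A + 1) := ⟨(i + A).toNat, by omega⟩
  have h1 : ∑ y ∈ s, ω y * y ^ i = ∑ j, ω (z j) * (z j) ^ i := by
    rw [← Finset.sum_coe_sort s]
    exact (Equiv.sum_comp e (fun y : s => ω y * (y : k) ^ i)).symm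
  rw [h1]
  have h2 : ∀ j, ω (z j) * (z j) ^ i = M⁻¹ j1 j * M j i1 := by
    intro j
    have : z j ∈ s := (e j).2
    simp only [ω, dif_pos this]
    have h3 : e.symm ⟨z j, this⟩ = j := by simp [z]
    rw [h3, hM, Matrix.vandermonde_apply, mul_assoc, ← zpow_add₀ (hz0 j)]
    congr 1
    rw [← zpow_natCast]
    congr 1
    simp only [i1]
    omega
  have h4 := congrFun (congrFun hMM j1) i1
  rw [Matrix.mul_apply] at h4
  rw [Finset.sum_congr rfl (fun j _ => h2 j), h4, Matrix.one_apply]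
  have : j1 = i1 ↔ i = j0 := by
    simp only [j1, i1, Fin.mk.injEq]
    omega
  simp only [this]

/-- extraction of a coefficient -/
theorem extract (A : ℕ) (s : Finset k) (ω : k → k) (j0 : ℤ)
    (hω : ∀ i : ℤ, |i| ≤ A → ∑ z ∈ s, ω z * z ^ i = if i = j0 then 1 else 0)
    (I : Finset ℤ) (hI : ∀ i ∈ I, |i| ≤ A) (c : ℤ → V) :
    ∑ z ∈ s, ω z • ∑ l ∈ I, z ^ l • c l = if j0 ∈ I then c j0 else 0 := by
  simp only [Finset.smul_sum, smul_smul]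
  rw [Finset.sum_comm]
  simp only [← Finset.sum_smul]
  rw [Finset.sum_congr rfl (fun l hl => by rw [hω l (hI l hl)])]
  simp [Finset.sum_ite_eq', ite_smul]

end
end FEM

namespace FEM
open Filter

set_option linter.unusedSectionVars false

section
variable {k V : Type} [Field k] [AddCommGroup V] [Module k V]

structure HRel (h : k → Module.End k V) : Prop where
  r1 : ∀ x : k, x ≠ 0 → x ≠ 1 → ∀ w, h x (h x⁻¹ w) = w
  r2 : ∀ x y : k, x ≠ 0 → x ≠ 1 → y ≠ 0 → y ≠ 1 → x * y - x + 1 ≠ 0 → ∀ w,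
    h x (h y w) = h (x * y - x + 1) (h (x * y / (x * y - x + 1)) w)

/-- symmetric form of the swap relation -/
theorem HRel.sym {h : k → Module.End k V} (H : HRel h) {x u : k} (hx0 : x ≠ 0) (hx1 : x ≠ 1)
    (hu0 : u ≠ 0) (hu1 : u ≠ 1) (hxu : x + u - 1 ≠ 0) (w : V) :
    h x (h ((x + u - 1) / x) w) = h u (h ((x + u - 1) / u) w) := by
  have h1 : x * ((x + u - 1) / x) - x + 1 = u := by field_simp; ring
  have h2 : x * ((x + u - 1) / x) = x + u - 1 := by field_simp
  have := H.r2 x ((x + u - 1) / x) hx0 hx1 (div_ne_zero hxu hx0)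
    (by
      intro h3
      rw [div_eq_one_iff_eq hx0] at h3
      exact hu1 (by linear_combination h3)) (by rw [h1]; exact hu0) w
  rw [h1, h2] at this
  exact this

def Good (h : k → Module.End k V) (w : V) (d a b : ℤ) (c : ℤ → V) : Prop :=
  ∀ᶠ x in cofinite, h x w = x ^ d • ∑ l ∈ Finset.Icc a b, (x - 1) ^ l • c l

theorem ev_ne (a : k) : ∀ᶠ x in cofinite, x ≠ a := by
  simp [Filter.eventually_cofinite]

theorem ev_comp {P : k → Prop} (hP : ∀ᶠ x in cofinite, P x) {g : k → k}
    (hg : Function.Injective g) : ∀ᶠ x in cofinite, P (g x) :=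
  hg.tendsto_cofinite.eventually hP

theorem ev_inf [Infinite k] {P : k → Prop} (hP : ∀ᶠ x in cofinite, P x) : {x | P x}.Infinite := by
  rw [Filter.eventually_cofinite] at hP
  have := hP.infinite_compl
  convert this using 1
  ext x; simp

theorem bd (a b : ℤ) : ∀ l ∈ Finset.Icc a b, |l| ≤ ((a.natAbs + b.natAbs : ℕ) : ℤ) := by
  intro l hl
  rw [Finset.mem_Icc] at hl
  rw [abs_le]
  push_cast
  rw [Int.abs_eq_natAbs, Int.abs_eq_natAbs]
  omega

theorem lemX [Infinite k] {h : k → Module.End k V} (H : HRel h) {w : V} {d a b : ℤ} {c : ℤ → V}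
    (hg : Good h w d a b c) :
    ∃ F : ℤ → ℤ → V, ∀ l ∈ Finset.Icc a b, Good h (c l) (d + l) a b (F l) := by
  have key : ∀ l ∈ Finset.Icc a b, ∃ F : ℤ → V, Good h (c l) (d + l) a b F := by
    intro l0 hl0
    obtain ⟨s, ω, hs, hω⟩ := weights (k := k) (a.natAbs + b.natAbs) {z | z ≠ 0 ∧ z ≠ -1}
      (ev_inf ((ev_ne 0).and (ev_ne (-1)))) (by simp) l0 (bd a b l0 hl0)
    refine ⟨fun e => ∑ z ∈ s, ω z • (1 + z) ^ (-d - e) • h (1 + z) (c e), ?_⟩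
    have E1 : ∀ᶠ x in cofinite, ∀ z ∈ s, x + z ≠ 0 ∧
        (h ((x + (1 + z) - 1) / x) w = ((x + (1 + z) - 1) / x) ^ d •
          ∑ l ∈ Finset.Icc a b, ((x + (1 + z) - 1) / x - 1) ^ l • c l) ∧
        (h ((x + (1 + z) - 1) / (1 + z)) w = ((x + (1 + z) - 1) / (1 + z)) ^ d •
          ∑ l ∈ Finset.Icc a b, ((x + (1 + z) - 1) / (1 + z) - 1) ^ l • c l) := by
      rw [Filter.eventually_all_finset]
      intro z hz
      obtain ⟨hz0, hz1⟩ := hs z hz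
      have hz1' : 1 + z ≠ 0 := fun h => hz1 (by linear_combination h)
      refine ((ev_ne (-z)).mono ?_).and (Eventually.and ?_ ?_)
      · intro x hx h; exact hx (by linear_combination h)
      · have inj : Function.Injective (fun x : k => 1 + z * x⁻¹) := by
          intro x y hxy
          simpa [hz0] using hxy
        have := ev_comp hg inj
        filter_upwards [this, ev_ne 0] with x hx hx0
        have e1 : (x + (1 + z) - 1) / x = 1 + z * x⁻¹ := by field_simp; ring
        rw [e1]; exact hx
      · have inj : Function.Injective (fun x : k => (x + (1 + z) - 1) / (1 + z)) := by
          intro x y hxy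
          have := (div_left_inj' hz1').1 hxy
          linear_combination this
        exact ev_comp hg inj
    filter_upwards [E1, ev_ne 0, ev_ne 1] with x hx hx0 hx1
    have step : ∀ z ∈ s, ∑ l ∈ Finset.Icc a b, z ^ l • (x ^ (-d - l) • h x (c l)) =
        ∑ e ∈ Finset.Icc a b, (x - 1) ^ e • ((1 + z) ^ (-d - e) • h (1 + z) (c e)) := by
      intro z hz
      obtain ⟨hz0, hz1⟩ := hs z hz
      have hz1' : 1 + z ≠ 0 := fun h => hz1 (by linear_combination h)
      obtain ⟨hxz, ha, hb⟩ := hx z hz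
      have hxz' : x + (1 + z) - 1 ≠ 0 := by convert hxz using 1; ring
      have := H.sym hx0 hx1 hz1' (by simpa using hz0) hxz' w
      rw [ha, hb] at this
      simp only [map_smul, map_sum] at this
      have e1 : (x + (1 + z) - 1) / x - 1 = z / x := by field_simp; ring
      have e2 : (x + (1 + z) - 1) / (1 + z) - 1 = (x - 1) / (1 + z) := by field_simp; ring
      rw [e1, e2] at this
      have t2 := congrArg (fun v => (x + (1 + z) - 1) ^ (-d) • v) this
      simp only [Finset.smul_sum, smul_smul] at t2 ⊢
      convert t2 using 3 with l hl l hl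
      · rw [div_zpow, div_zpow, zpow_sub₀ hx0, zpow_neg, zpow_neg]
        have := zpow_ne_zero d hxz'
        have := zpow_ne_zero d hx0
        have := zpow_ne_zero l hx0
        field_simp
      · rw [div_zpow, div_zpow, zpow_sub₀ hz1', zpow_neg, zpow_neg]
        have := zpow_ne_zero d hxz'
        have := zpow_ne_zero d hz1'
        have := zpow_ne_zero l hz1'
        field_simp
    have t := extract _ s ω l0 hω (Finset.Icc a b) (bd a b) (fun l => x ^ (-d - l) • h x (c l))
    rw [if_pos hl0, Finset.sum_congr rfl (fun z hz => by rw [step z hz])] at t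
    have t2 := congrArg (fun v => x ^ (d + l0) • v) t
    simp only [smul_smul] at t2
    rw [← zpow_add₀ hx0] at t2
    have : d + l0 + (-d - l0) = 0 := by ring
    rw [this, zpow_zero, one_smul] at t2
    rw [← t2]
    congr 1
    simp only [Finset.smul_sum, smul_smul]
    rw [Finset.sum_comm]
    refine Finset.sum_congr rfl fun e _ => Finset.sum_congr rfl fun z _ => ?_
    congr 1; ring
  classical
  choose! F hF using key
  exact ⟨F, hF⟩

theorem lemY0 [Infinite k] {h : k → Module.End k V} (H : HRel h) {w : V} {d a b : ℤ} {c : ℤ → V}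
    (hg : Good h w d a b c) {F : ℤ → ℤ → V}
    (hF : ∀ l ∈ Finset.Icc a b, Good h (c l) (d + l) a b (F l)) :
    ∀ᶠ x : k in cofinite, w = ∑ l ∈ Finset.Icc a b, ∑ e ∈ Finset.Icc a b,
      ((x - 1) / x) ^ (l + e) • (-1 : k) ^ e • F l e := by
  have hF' : ∀ᶠ x in cofinite, ∀ l ∈ Finset.Icc a b, h x⁻¹ (c l) = x⁻¹ ^ (d + l) •
      ∑ e ∈ Finset.Icc a b, (x⁻¹ - 1) ^ e • F l e := by
    rw [Filter.eventually_all_finset]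
    intro l hl
    exact ev_comp (hF l hl) inv_injective
  filter_upwards [hF', hg, ev_ne 0, ev_ne 1] with x hx hw hx0 hx1
  have h1 := H.r1 x⁻¹ (inv_ne_zero hx0) (by simpa using hx1) w
  rw [inv_inv, hw] at h1
  rw [← h1]
  simp only [map_smul, map_sum]
  rw [Finset.smul_sum]
  refine Finset.sum_congr rfl fun l hl => ?_
  rw [hx l hl]
  simp only [Finset.smul_sum, smul_smul]
  refine Finset.sum_congr rfl fun e he => ?_
  congr 1
  have e1 : x⁻¹ - 1 = (-1) * (x - 1) / x := by field_simp; ring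
  have hx1' : x - 1 ≠ 0 := sub_ne_zero.2 hx1
  rw [e1, div_zpow, mul_zpow, div_zpow, zpow_add₀ hx0, zpow_add₀ hx1', inv_zpow, zpow_add₀ hx0]
  have := zpow_ne_zero d hx0
  have := zpow_ne_zero l hx0
  have := zpow_ne_zero e hx0
  field_simp

theorem lemY [Infinite k] {h : k → Module.End k V} (H : HRel h) {w : V} {d a b : ℤ} {c : ℤ → V}
    (hg : Good h w d a b c) {F : ℤ → ℤ → V}
    (hF : ∀ l ∈ Finset.Icc a b, Good h (c l) (d + l) a b (F l)) (t : ℤ) (ht : t ∈ Finset.Icc a b)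
    (ht0 : t ≠ 0) (hext : t = a ∨ t = b) : F t t = 0 := by
  have h0 := lemY0 H hg hF
  have inj : Function.Injective (fun z : k => (1 - z)⁻¹) := by
    intro x y hxy
    simpa using hxy
  have h1 := ev_comp h0 inj
  set A := 2 * (a.natAbs + b.natAbs) with hA
  have hbd := bd a b
  obtain ⟨s, ω, hs, hω⟩ := weights (k := k) A _
      (ev_inf ((h1.and (ev_ne 0)).and (ev_ne 1))) (by simp) (t + t)
      (by have := abs_add_le t t; have := hbd t ht; push_cast at *; linarith)
  have h2 : ∀ z ∈ s, w = ∑ l ∈ Finset.Icc a b, ∑ e ∈ Finset.Icc a b,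
      z ^ (l + e) • (-1 : k) ^ e • F l e := by
    intro z hz
    obtain ⟨⟨hz, hz0⟩, hz1⟩ := hs z hz
    have : 1 - z ≠ 0 := sub_ne_zero.2 (Ne.symm hz1)
    have e1 : ((1 - z)⁻¹ - 1) / (1 - z)⁻¹ = z := by field_simp; ring
    rw [e1] at hz
    exact hz
  have h3 : ∑ z ∈ s, ω z • w = ∑ l ∈ Finset.Icc a b, ∑ e ∈ Finset.Icc a b,
      (if l + e = t + t then (1 : k) else 0) • (-1 : k) ^ e • F l e := by
    rw [Finset.sum_congr rfl (fun z hz => by rw [h2 z hz])]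
    simp only [Finset.smul_sum]
    rw [Finset.sum_comm]
    refine Finset.sum_congr rfl fun l hl => ?_
    rw [Finset.sum_comm]
    refine Finset.sum_congr rfl fun e he => ?_
    rw [← hω (l + e) (by
      have := abs_add_le l e; have := hbd l hl; have := hbd e he; push_cast at *; linarith)]
    rw [Finset.sum_smul]
    simp only [smul_smul, mul_assoc]
  have h4 : ∑ z ∈ s, ω z • w = 0 := by
    have := hω 0 (by simp)
    rw [if_neg (by omega)] at this
    simp only [zpow_zero, mul_one] at this
    rw [← Finset.sum_smul, this, zero_smul]
  rw [h4, Finset.sum_eq_single t, Finset.sum_eq_single t] at h3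
  · simp only [if_true, one_smul] at h3
    have := (smul_eq_zero.1 h3.symm).resolve_left (zpow_ne_zero _ (by simp))
    exact this
  · intro e he hne
    rw [if_neg (by omega), zero_smul]
  · intro h; exact absurd ht h
  · intro l hl hne
    refine Finset.sum_eq_zero fun e he => ?_
    rw [Finset.mem_Icc] at hl he ht
    rw [if_neg (by omega), zero_smul]
  · intro h; exact absurd ht h

theorem Good.shrink_top {h : k → Module.End k V} {w : V} {d a b : ℤ} {c : ℤ → V}
    (hg : Good h w d a b c) (h0 : c b = 0) : Good h w d a (b - 1) c := by
  refine hg.mono fun x hx => ?_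
  rw [hx]
  congr 1
  symm
  refine Finset.sum_subset (Finset.Icc_subset_Icc_right (by omega)) fun l hl hl' => ?_
  rw [Finset.mem_Icc] at hl hl'
  have : l = b := by omega
  rw [this, h0, smul_zero]

theorem Good.shrink_bot {h : k → Module.End k V} {w : V} {d a b : ℤ} {c : ℤ → V}
    (hg : Good h w d a b c) (h0 : c a = 0) : Good h w d (a + 1) b c := by
  refine hg.mono fun x hx => ?_
  rw [hx]
  congr 1
  symm
  refine Finset.sum_subset (Finset.Icc_subset_Icc_left (by omega)) fun l hl hl' => ?_
  rw [Finset.mem_Icc] at hl hl'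
  have : l = a := by omega
  rw [this, h0, smul_zero]

theorem eig_ev [Infinite k] {h : k → Module.End k V} (H : HRel h) (n : ℕ) :
    ∀ (w : V) (d a b : ℤ) (c : ℤ → V), w ≠ 0 → (b - a + 1).toNat ≤ n → Good h w d a b c →
    ∃ (v : V) (d : ℤ) (ε : k), v ≠ 0 ∧ ε * ε = 1 ∧ ∀ᶠ x in cofinite, h x v = (ε * x ^ d) • v := by
  induction n with
  | zero =>
    intro w d a b c hw hn hg
    exfalso
    obtain ⟨x, ⟨hx, hx0⟩, hx1⟩ :=
      (ev_inf ((ev_comp hg inv_injective).and (ev_ne 0) |>.and (ev_ne 1))).nonempty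
    have h1 := H.r1 x hx0 hx1 w
    rw [hx, Finset.Icc_eq_empty (by omega)] at h1
    simp at h1
    exact hw h1.symm
  | succ n ih =>
    intro w d a b c hw hn hg
    by_cases hab : b < a
    · exact ih w d a b c hw (by omega) hg
    obtain ⟨F, hF⟩ := lemX H hg
    have hamem : a ∈ Finset.Icc a b := by rw [Finset.mem_Icc]; omega
    have hbmem : b ∈ Finset.Icc a b := by rw [Finset.mem_Icc]; omega
    by_cases hb : b = 0
    · by_cases ha : a = 0
      · subst ha hb
        have h0 := lemY0 H hg hF
        have h1 := hF 0 (by simp)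
        simp only [Good, Finset.Icc_self, Finset.sum_singleton, zpow_zero, one_smul, add_zero]
          at h0 h1 hg
        obtain ⟨x, hx⟩ := (ev_inf h0).nonempty
        by_cases hc : w + c 0 = 0
        · refine ⟨w, d, -1, hw, by ring, hg.mono fun x hx => ?_⟩
          rw [hx, show c 0 = -w from (neg_eq_of_add_eq_zero_right hc).symm]
          simp
        · refine ⟨w + c 0, d, 1, hc, by ring, ?_⟩
          filter_upwards [hg, h1] with y hy hy1
          rw [map_add, hy, hy1, ← hx, one_mul, smul_add, add_comm]
      · by_cases hca : c a = 0
        · exact ih w d (a + 1) b c hw (by omega) (hg.shrink_bot hca)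
        · exact ih (c a) (d + a) (a + 1) b (F a) hca (by omega)
            ((hF a hamem).shrink_bot (lemY H hg hF a hamem ha (Or.inl rfl)))
    · by_cases hcb : c b = 0
      · exact ih w d a (b - 1) c hw (by omega) (hg.shrink_top hcb)
      · exact ih (c b) (d + b) a (b - 1) (F b) hcb (by omega)
          ((hF b hbmem).shrink_top (lemY H hg hF b hbmem hb (Or.inr rfl)))

/-- common eigenvector -/
theorem eig [Infinite k] {h : k → Module.End k V} (H : HRel h) {w : V} {d a b : ℤ} {c : ℤ → V}
    (hw : w ≠ 0) (hg : Good h w d a b c) :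
    ∃ (v : V) (d : ℤ) (ε : k), v ≠ 0 ∧ ε * ε = 1 ∧
      ∀ x : k, x ≠ 0 → x ≠ 1 → h x v = (ε * x ^ d) • v := by
  obtain ⟨v, d, ε, hv, hε, hE⟩ := eig_ev H _ w d a b c hw le_rfl hg
  refine ⟨v, d, ε, hv, hε, fun x hx0 hx1 => ?_⟩
  have hx1' : x - 1 ≠ 0 := sub_ne_zero.2 hx1
  have i1 : Function.Injective (fun y : k => x * y - x + 1) := by
    intro y z hyz
    have : x * y = x * z := by linear_combination hyz
    exact mul_left_cancel₀ hx0 this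
  have i2 : Function.Injective (fun y : k => 1 + (x - 1) * (x * y - x + 1)⁻¹) := by
    intro y z hyz
    have := mul_left_cancel₀ hx1' (add_left_cancel hyz)
    exact i1 (inv_injective this)
  obtain ⟨y, hy⟩ := (ev_inf (hE.and ((ev_comp hE i1).and ((ev_comp hE i2).and
    ((ev_ne 0).and ((ev_ne 1).and (ev_comp (ev_ne 0) i1))))))).nonempty
  obtain ⟨h1, h2, h3, hy0, hy1, hu⟩ := hy
  have e : 1 + (x - 1) * (x * y - x + 1)⁻¹ = x * y / (x * y - x + 1) := by
    rw [eq_div_iff hu, add_mul, mul_assoc, inv_mul_cancel₀ hu]; ring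
  rw [e] at h3
  have := H.r2 x y hx0 hx1 hy0 hy1 hu v
  rw [h3, map_smul, h2, h1, map_smul, smul_smul] at this
  have hy' := zpow_ne_zero d hy0
  have hu' := zpow_ne_zero d hu
  have t := congrArg (fun v => (ε * (y ^ d)⁻¹) • v) this
  simp only [smul_smul] at t
  have e2 : ε * (y ^ d)⁻¹ * (ε * y ^ d) = 1 := by
    field_simp; linear_combination hε
  rw [e2, one_smul] at t
  rw [t]
  congr 1
  rw [div_zpow, mul_zpow]
  generalize (x * y - x + 1) ^ d = U at *
  field_simp
  linear_combination ε * hε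
end
end FEM

namespace FEM
open Filter

section
variable {k G V : Type} [Field k] [Group G] [AddCommGroup V] [Module k V]

def subRep (ρ : G →* Module.End k V) (W : Submodule k V) (hW : ∀ g, ∀ w ∈ W, ρ g w ∈ W) :
    G →* Module.End k W where
  toFun g := (ρ g).restrict (hW g)
  map_one' := by ext w; simp
  map_mul' a b := by ext w; simp [LinearMap.restrict_apply]

theorem subRep_coe (ρ : G →* Module.End k V) (W : Submodule k V) (hW : ∀ g, ∀ w ∈ W, ρ g w ∈ W)
    (g : G) (w : W) : (subRep ρ W hW g w : V) = ρ g w := rfl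

def quotRep (ρ : G →* Module.End k V) (W : Submodule k V) (hW : ∀ g, ∀ w ∈ W, ρ g w ∈ W) :
    G →* Module.End k (V ⧸ W) where
  toFun g := W.mapQ W (ρ g) (hW g)
  map_one' := by ext w; simp
  map_mul' a b := by ext w; simp

theorem quotRep_mk (ρ : G →* Module.End k V) (W : Submodule k V) (hW : ∀ g, ∀ w ∈ W, ρ g w ∈ W)
    (g : G) (w : V) : quotRep ρ W hW g (W.mkQ w) = W.mkQ (ρ g w) := rfl

theorem pow_comm_map {V' : Type} [AddCommGroup V'] [Module k V'] (A : Module.End k V)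
    (B : Module.End k V') (φ : V →ₗ[k] V') (h : ∀ w, φ (A w) = B (φ w)) (n : ℕ) (w : V) :
    φ ((A ^ n) w) = (B ^ n) (φ w) := by
  induction n generalizing w with
  | zero => simp
  | succ n ih => rw [pow_succ, pow_succ, Module.End.mul_apply, Module.End.mul_apply, ih, h]

theorem GRep.sub {η : k → G} {f : G} {ρ : G →* Module.End k V} (P : GRep η f ρ)
    (W : Submodule k V) (hW : ∀ g, ∀ w ∈ W, ρ g w ∈ W) : GRep η f (subRep ρ W hW) := by
  constructor
  · obtain ⟨n, hn⟩ := P.nil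
    refine ⟨n, LinearMap.ext fun w => Subtype.ext ?_⟩
    have := pow_comm_map (subRep ρ W hW f - 1) (ρ f - 1) W.subtype (by intro w; rfl) n w
    rw [hn] at this
    exact this
  · obtain ⟨d0, h⟩ := P.rat
    refine ⟨d0, fun d hd => ?_⟩
    obtain ⟨a, b, h⟩ := h d hd
    refine ⟨a, b, fun w => ?_⟩
    obtain ⟨c, hc⟩ := h w
    obtain ⟨π, hπ⟩ := W.subtype.exists_leftInverse_of_injective (by simp)
    refine ⟨fun l => π (c l), fun x hx0 hx1 => ?_⟩
    have h1 : π ((subRep ρ W hW (η x) w : W) : V) = subRep ρ W hW (η x) w :=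
      LinearMap.congr_fun hπ (subRep ρ W hW (η x) w)
    rw [← h1, subRep_coe, hc x hx0 hx1]
    simp

theorem GRep.quot {η : k → G} {f : G} {ρ : G →* Module.End k V} (P : GRep η f ρ)
    (W : Submodule k V) (hW : ∀ g, ∀ w ∈ W, ρ g w ∈ W) : GRep η f (quotRep ρ W hW) := by
  constructor
  · obtain ⟨n, hn⟩ := P.nil
    refine ⟨n, LinearMap.ext fun w => ?_⟩
    obtain ⟨w, rfl⟩ := W.mkQ_surjective w
    rw [← pow_comm_map (ρ f - 1) (quotRep ρ W hW f - 1) W.mkQ (by intro w; rfl) n w, hn]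
    simp
  · obtain ⟨d0, h⟩ := P.rat
    refine ⟨d0, fun d hd => ?_⟩
    obtain ⟨a, b, h⟩ := h d hd
    refine ⟨a, b, fun w => ?_⟩
    obtain ⟨w, rfl⟩ := W.mkQ_surjective w
    obtain ⟨c, hc⟩ := h w
    refine ⟨fun l => W.mkQ (c l), fun x hx0 hx1 => ?_⟩
    rw [quotRep_mk, hc x hx0 hx1]
    simp

theorem GRel.hrel {η : k → G} {f : G} (R : GRel η f) (ρ : G →* Module.End k V) :
    HRel (fun x => ρ (η x)) where
  r1 x h0 h1 w := by
    rw [← Module.End.mul_apply, ← map_mul, R.r1 x h0 h1, map_one, Module.End.one_apply]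
  r2 x y h0 h1 h2 h3 h4 w := by
    simp only [← Module.End.mul_apply, ← map_mul, R.r2 x y h0 h1 h2 h3 h4]

theorem A0 [Infinite k] {η : k → G} {f : G} (R : GRel η f) {ρ : G →* Module.End k V}
    (P : GRep η f ρ) [Nontrivial V] :
    ∃ (v : V) (d : ℤ) (ε : k), v ≠ 0 ∧ ε * ε = 1 ∧
      ∀ x : k, x ≠ 0 → x ≠ 1 → ρ (η x) v = (ε * x ^ d) • v := by
  obtain ⟨w, hw⟩ := exists_ne (0 : V)
  obtain ⟨d, h⟩ := P.rat
  obtain ⟨a, b, h⟩ := h d le_rfl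
  obtain ⟨c, hc⟩ := h w
  refine eig (R.hrel ρ) (d := d) (a := a) (b := b) (c := c) hw ?_
  filter_upwards [ev_ne 0, ev_ne 1] with x h0 h1 using hc x h0 h1

open Polynomial in
theorem poly0 (F : Module.End k V) (v : V) (r : ℕ) (h1 : ((F - 1) ^ (r + 1)) v = 0)
    (h2 : ((F - 1) ^ r) v ≠ 0) (q : k[X]) (hq : q.natDegree ≤ r) (h : aeval F q v = 0) : q = 0 := by
  by_contra hne
  obtain ⟨q1, hq1, hnd⟩ := exists_eq_pow_rootMultiplicity_mul_and_not_dvd q hne 1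
  set s := rootMultiplicity 1 q
  have hs : s ≤ r := by
    refine le_trans ?_ hq
    have := natDegree_le_of_dvd (pow_rootMultiplicity_dvd q 1) hne
    rwa [natDegree_pow, natDegree_X_sub_C, mul_one] at this
  have hco : IsCoprime ((X - C (1 : k)) ^ (r + 1)) q1 := by
    refine IsCoprime.pow_left ?_
    exact ((irreducible_X_sub_C (1 : k)).coprime_iff_not_dvd).2 hnd
  obtain ⟨a, b, hab⟩ := hco
  have hF : ∀ n, aeval F ((X - C (1 : k)) ^ n) = (F - 1) ^ n := by
    intro n; simp
  have e : (X - C (1 : k)) ^ s = (X - C 1) ^ s * a * (X - C (1 : k)) ^ (r + 1) + b * q := by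
    rw [hq1]
    linear_combination (-(X - C (1 : k)) ^ s) * hab
  have h3 : ((F - 1) ^ s) v = 0 := by
    rw [← hF, e, map_add, map_mul, map_mul _ b, hF, LinearMap.add_apply, Module.End.mul_apply,
      Module.End.mul_apply, h, h1, map_zero, map_zero, add_zero]
  apply h2
  obtain ⟨t, rfl⟩ := Nat.exists_eq_add_of_le hs
  rw [add_comm, pow_add, Module.End.mul_apply, h3, map_zero]

open Polynomial in
theorem eig_lead [CharZero k] (F A : Module.End k V) (v : V) (r : ℕ)
    (h1 : ((F - 1) ^ (r + 1)) v = 0)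
    (h2 : ((F - 1) ^ r) v ≠ 0) (lam : ℕ → k) (hA : ∀ j, A ((F ^ j) v) = lam j • (F ^ j) v) :
    ∃ μ : k, A (((F - 1) ^ r) v) = μ • ((F - 1) ^ r) v := by
  have hF : ∀ n, aeval F ((X - C (1 : k)) ^ n) = (F - 1) ^ n := by
    intro n; simp
  have hae : ∀ (q : k[X]) (n : ℕ), q.natDegree < n →
      aeval F q v = ∑ j ∈ Finset.range n, q.coeff j • (F ^ j) v := by
    intro q n hn
    rw [aeval_eq_sum_range' hn, LinearMap.sum_apply]
    rfl
  have hdeg : ∀ n, ((X - C (1 : k)) ^ n).natDegree < n + 1 := by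
    intro n; rw [natDegree_pow, natDegree_X_sub_C]; omega
  set p := (X - C (1 : k)) ^ (r + 1) with hp
  let q : k[X] := ∑ j ∈ Finset.range (r + 1), monomial j (p.coeff j * (lam j - lam (r + 1)))
  have hqc : ∀ j ≤ r, q.coeff j = p.coeff j * (lam j - lam (r + 1)) := by
    intro j hj
    simp only [q, finsetSum_coeff, coeff_monomial]
    rw [Finset.sum_ite_eq' , if_pos (Finset.mem_range.2 (by omega))]
  have hqd : q.natDegree ≤ r := by
    refine natDegree_sum_le_of_forall_le _ _ fun j hj => ?_
    refine le_trans (natDegree_monomial_le _) ?_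
    rw [Finset.mem_range] at hj; omega
  have hpv : ∑ j ∈ Finset.range (r + 2), p.coeff j • (F ^ j) v = 0 := by
    rw [← hae p (r + 2) (hdeg (r + 1)), hp, hF, h1]
  have hq0 : aeval F q v = 0 := by
    rw [hae q (r + 1) (by omega)]
    have t1 := congrArg A hpv
    rw [map_sum, map_zero, Finset.sum_range_succ] at t1
    have t2 := congrArg (fun w => lam (r + 1) • w) hpv
    simp only [smul_zero] at t2
    rw [Finset.sum_range_succ, smul_add, Finset.smul_sum] at t2
    rw [← sub_zero (0 : V)]
    nth_rewrite 1 [← t1]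
    rw [← t2, map_smul, hA, smul_comm (lam (r + 1)) (p.coeff (r + 1)), add_sub_add_right_eq_sub,
      ← Finset.sum_sub_distrib]
    refine Finset.sum_congr rfl fun j hj => ?_
    rw [Finset.mem_range] at hj
    rw [hqc j (by omega), map_smul, hA]
    simp only [smul_smul, ← sub_smul]
    congr 1; ring
  have hq := poly0 F v r h1 h2 q hqd hq0
  have hlam : ∀ j ≤ r, lam j = lam (r + 1) := by
    intro j hj
    have := hqc j hj
    rw [hq, coeff_zero] at this
    have h3 : p.coeff j ≠ 0 := by
      rw [hp, sub_eq_add_neg, ← C_neg, coeff_X_add_C_pow]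
      refine mul_ne_zero (pow_ne_zero _ (by simp)) ?_
      exact_mod_cast (Nat.choose_pos (by omega)).ne'
    exact sub_eq_zero.1 ((mul_eq_zero.1 this.symm).resolve_left h3)
  refine ⟨lam (r + 1), ?_⟩
  rw [← hF, hae _ (r + 1) (hdeg r), map_sum, Finset.smul_sum]
  refine Finset.sum_congr rfl fun j hj => ?_
  rw [Finset.mem_range] at hj
  rw [map_smul, hA, hlam j (by omega), smul_comm]

theorem rep_inj (ρ : G →* Module.End k V) (u : G) (w : V) (h : ρ u w = 0) : w = 0 := by
  have : ρ u⁻¹ (ρ u w) = w := by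
    rw [← Module.End.mul_apply, ← map_mul, inv_mul_cancel, map_one, Module.End.one_apply]
  rw [← this, h, map_zero]

theorem line_closure (ρ : G →* Module.End k V) (S : Set G) (v : V) (hv : v ≠ 0)
    (h : ∀ g ∈ S, ∃ μ : k, ρ g v = μ • v) : ∀ u ∈ Subgroup.closure S, ∃ μ : k, ρ u v = μ • v := by
  intro u hu
  induction hu using Subgroup.closure_induction with
  | mem x hx => exact h x hx
  | one => exact ⟨1, by simp⟩
  | mul x y _ _ hx hy =>
    obtain ⟨a, ha⟩ := hx
    obtain ⟨b, hb⟩ := hy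
    refine ⟨b * a, ?_⟩
    rw [map_mul, Module.End.mul_apply, hb, map_smul, ha, smul_smul]
  | inv x _ hx =>
    obtain ⟨a, ha⟩ := hx
    have ha0 : a ≠ 0 := by
      rintro rfl
      rw [zero_smul] at ha
      exact hv (rep_inj ρ x v ha)
    refine ⟨a⁻¹, ?_⟩
    have : ρ x⁻¹ (ρ x v) = v := by
      rw [← Module.End.mul_apply, ← map_mul, inv_mul_cancel, map_one, Module.End.one_apply]
    rw [ha, map_smul] at this
    nth_rewrite 2 [← this]
    rw [smul_smul, inv_mul_cancel₀ ha0, one_smul]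

theorem A1 [CharZero k] {η : k → G} {f : G} (R : GRel η f) {ρ : G →* Module.End k V}
    (P : GRep η f ρ) [Nontrivial V] :
    ∃ (v : V) (d : ℤ), v ≠ 0 ∧ (∀ x : k, x ≠ 0 → x ≠ 1 → ρ (η x) v = x ^ d • v) ∧ ρ f v = v := by
  haveI : Infinite k := CharZero.infinite k
  obtain ⟨v0, d0, ε0, hv0, -, hE⟩ := A0 R P
  set S : Set G := {g : G | ∃ x : k, x ≠ 0 ∧ x ≠ 1 ∧ g = η x} with hS
  have h1 : ∀ u ∈ Subgroup.closure S, ∃ μ : k, ρ u v0 = μ • v0 := by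
    refine line_closure ρ S v0 hv0 ?_
    rintro g ⟨x, hx0, hx1, rfl⟩
    exact ⟨_, hE x hx0 hx1⟩
  have h2 : ∀ (j : ℕ), ∀ u ∈ Subgroup.closure S, ∃ μ : k,
      ρ u ((ρ f ^ j) v0) = μ • (ρ f ^ j) v0 := by
    intro j
    induction j with
    | zero => simpa using h1
    | succ j ih =>
      intro u hu
      obtain ⟨μ, hμ⟩ := ih _ (R.r4 u hu)
      refine ⟨μ, ?_⟩
      rw [pow_succ', Module.End.mul_apply, ← map_smul, ← hμ]
      simp only [← Module.End.mul_apply, ← map_mul, ← mul_assoc]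
      simp
  obtain ⟨n, hn⟩ := P.nil
  classical
  have hex : ∃ n : ℕ, ((ρ f - 1) ^ n) v0 = 0 := ⟨n, by rw [hn]; rfl⟩
  obtain ⟨r, hr⟩ : ∃ r, Nat.find hex = r + 1 := by
    refine Nat.exists_eq_succ_of_ne_zero fun h => ?_
    have := Nat.find_spec hex
    rw [h] at this
    exact hv0 (by simpa using this)
  have hr1 : ((ρ f - 1) ^ (r + 1)) v0 = 0 := hr ▸ Nat.find_spec hex
  have hr2 : ((ρ f - 1) ^ r) v0 ≠ 0 := Nat.find_min hex (by omega)
  set w := ((ρ f - 1) ^ r) v0 with hw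
  have hfw : ρ f w = w := by
    rw [pow_succ', Module.End.mul_apply, ← hw, LinearMap.sub_apply, Module.End.one_apply] at hr1
    exact sub_eq_zero.1 hr1
  have h3 : ∀ u ∈ Subgroup.closure S, ∃ μ : k, ρ u w = μ • w := by
    intro u hu
    choose lam hlam using fun j => h2 j u hu
    exact eig_lead (ρ f) (ρ u) v0 r hr1 hr2 lam hlam
  have h4 : ∀ u : G, ∃ μ : k, ρ u w = μ • w := by
    intro u
    refine line_closure ρ (S ∪ {f}) w hr2 ?_ u (by rw [R.r5]; trivial)
    rintro g (hg | hg)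
    · exact h3 g (Subgroup.subset_closure hg)
    · rw [Set.mem_singleton_iff] at hg
      exact ⟨1, by rw [hg, hfw, one_smul]⟩
  have hW : ∀ g, ∀ z ∈ Submodule.span k {w}, ρ g z ∈ Submodule.span k {w} := by
    intro g z hz
    obtain ⟨a, rfl⟩ := Submodule.mem_span_singleton.1 hz
    obtain ⟨μ, hμ⟩ := h4 g
    rw [map_smul, hμ]
    exact Submodule.smul_mem _ _ (Submodule.smul_mem _ _ (Submodule.mem_span_singleton_self w))
  haveI : Nontrivial (Submodule.span k {w}) :=
    ⟨⟨w, Submodule.mem_span_singleton_self w⟩, 0, fun h => hr2 (congrArg Subtype.val h)⟩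
  obtain ⟨v, d, ε, hv, hε, hvE⟩ := A0 R (P.sub _ hW)
  have hvE' : ∀ x : k, x ≠ 0 → x ≠ 1 → ρ (η x) v = (ε * x ^ d) • (v : V) :=
    fun x hx0 hx1 => congrArg Subtype.val (hvE x hx0 hx1)
  have hvf : ρ f v = v := by
    obtain ⟨a, ha⟩ := Submodule.mem_span_singleton.1 v.2
    rw [← ha, map_smul, hfw]
  have hv' : (v : V) ≠ 0 := fun h => hv (Subtype.ext h)
  have hε1 : ε = 1 := by
    have := congrArg (fun g => ρ g (v : V)) (R.r3 2 (by norm_num) (by norm_num) (by norm_num))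
    simp only [map_mul, Module.End.mul_apply, hvf] at this
    rw [hvE' _ (by norm_num) (by norm_num), hvE' _ (by norm_num) (by norm_num), map_smul,
      map_smul, hvf, hvE' _ (by norm_num) (by norm_num), smul_smul] at this
    have := smul_left_injective k hv' this
    beta_reduce at this
    have e3 : (2 : k) * 2 - 1 = 2 * (2 - 2⁻¹) := by norm_num
    rw [e3, mul_zpow] at this
    have n1 : (2 : k) ^ d ≠ 0 := zpow_ne_zero _ (by norm_num)
    have n2 : (2 - 2⁻¹ : k) ^ d ≠ 0 := zpow_ne_zero _ (by norm_num)
    have n3 : ε ≠ 0 := by rintro rfl; simp at hε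
    have n4 := mul_ne_zero (mul_ne_zero n1 n2) n3
    apply mul_left_cancel₀ n4
    linear_combination this
  exact ⟨v, d, hv', fun x hx0 hx1 => by rw [hvE' x hx0 hx1, hε1, one_mul], hvf⟩

theorem line_stable {η : k → G} {f : G} (R : GRel η f) {ρ : G →* Module.End k V} {v : V} {d : ℤ}
    (hv : v ≠ 0) (hE : ∀ x : k, x ≠ 0 → x ≠ 1 → ρ (η x) v = x ^ d • v) (hf : ρ f v = v) :
    ∀ g, ∀ z ∈ Submodule.span k {v}, ρ g z ∈ Submodule.span k {v} := by
  have h4 : ∀ u : G, ∃ μ : k, ρ u v = μ • v := by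
    intro u
    refine line_closure ρ _ v hv ?_ u (by rw [R.r5]; trivial)
    rintro g (⟨x, hx0, hx1, rfl⟩ | hg)
    · exact ⟨_, hE x hx0 hx1⟩
    · rw [Set.mem_singleton_iff] at hg
      exact ⟨1, by rw [hg, hf, one_smul]⟩
  intro g z hz
  obtain ⟨a, rfl⟩ := Submodule.mem_span_singleton.1 hz
  obtain ⟨μ, hμ⟩ := h4 g
  rw [map_smul, hμ]
  exact Submodule.smul_mem _ _ (Submodule.smul_mem _ _ (Submodule.mem_span_singleton_self v))

theorem ker_stable {η : k → G} {f : G} (R : GRel η f) {ρ : G →* Module.End k V}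
    {ξ : V →ₗ[k] k} {d : ℤ}
    (hE : ∀ x : k, x ≠ 0 → x ≠ 1 → ∀ w, ξ (ρ (η x) w) = x ^ d * ξ w) (hf : ∀ w, ξ (ρ f w) = ξ w) :
    ∀ g, ∀ z ∈ LinearMap.ker ξ, ρ g z ∈ LinearMap.ker ξ := by
  have h4 : ∀ u : G, ∃ μ : k, μ ≠ 0 ∧ ∀ w, ξ (ρ u w) = μ * ξ w := by
    intro u
    have hu : u ∈ Subgroup.closure ({g : G | ∃ x : k, x ≠ 0 ∧ x ≠ 1 ∧ g = η x} ∪ {f}) := by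
      rw [R.r5]; trivial
    induction hu using Subgroup.closure_induction with
    | mem x hx =>
      rcases hx with ⟨x, hx0, hx1, rfl⟩ | hg
      · exact ⟨_, zpow_ne_zero d hx0, hE x hx0 hx1⟩
      · rw [Set.mem_singleton_iff] at hg
        exact ⟨1, one_ne_zero, fun w => by rw [hg, hf, one_mul]⟩
    | one => exact ⟨1, one_ne_zero, by simp⟩
    | mul x y _ _ hx hy =>
      obtain ⟨a, ha0, ha⟩ := hx
      obtain ⟨b, hb0, hb⟩ := hy
      refine ⟨a * b, mul_ne_zero ha0 hb0, fun w => ?_⟩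
      rw [map_mul, Module.End.mul_apply, ha, hb, mul_assoc]
    | inv x _ hx =>
      obtain ⟨a, ha0, ha⟩ := hx
      refine ⟨a⁻¹, inv_ne_zero ha0, fun w => ?_⟩
      have : ρ x (ρ x⁻¹ w) = w := by
        rw [← Module.End.mul_apply, ← map_mul, mul_inv_cancel, map_one, Module.End.one_apply]
      nth_rewrite 2 [← this]
      rw [ha, inv_mul_cancel_left₀ ha0]
  intro g z hz
  obtain ⟨μ, -, hμ⟩ := h4 g
  rw [LinearMap.mem_ker] at hz ⊢
  rw [hμ, hz, mul_zero]

theorem A2 [CharZero k] {η : k → G} {f : G} (R : GRel η f) (n : ℕ) :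
    ∀ (V : Type) [AddCommGroup V] [Module k V] [FiniteDimensional k V] [Nontrivial V]
    (ρ : G →* Module.End k V) (_ : GRep η f ρ) (_ : Module.finrank k V = n),
    ∃ (ξ : V →ₗ[k] k) (d : ℤ), ξ ≠ 0 ∧ (∀ x : k, x ≠ 0 → x ≠ 1 → ∀ w, ξ (ρ (η x) w) = x ^ d * ξ w)
      ∧ ∀ w, ξ (ρ f w) = ξ w := by
  induction n using Nat.strong_induction_on with
  | _ n ih =>
    intro V _ _ _ _ ρ P hn
    obtain ⟨v, d, hv, hE, hf⟩ := A1 R P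
    have hW := line_stable R hv hE hf
    rcases subsingleton_or_nontrivial (V ⧸ Submodule.span k {v}) with hs | hs
    · have htop : Submodule.span k {v} = ⊤ := Submodule.Quotient.subsingleton_iff.1 hs
      obtain ⟨φ, hφ⟩ : ∃ φ : V →ₗ[k] k, φ v ≠ 0 := by
        by_contra hcon
        push Not at hcon
        exact hv ((Module.forall_dual_apply_eq_zero_iff k v).1 hcon)
      have hmem : ∀ w, ∃ a : k, a • v = w := fun w =>
        Submodule.mem_span_singleton.1 (by rw [htop]; trivial)
      refine ⟨φ, d, fun h => hφ (by rw [h]; rfl), fun x hx0 hx1 w => ?_, fun w => ?_⟩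
      · obtain ⟨a, rfl⟩ := hmem w
        rw [map_smul, hE x hx0 hx1]
        simp only [map_smul, smul_eq_mul]; ring
      · obtain ⟨a, rfl⟩ := hmem w
        rw [map_smul, hf]
    · have hlt : Module.finrank k (V ⧸ Submodule.span k {v}) < n := by
        have h1 := Submodule.finrank_quotient_add_finrank (Submodule.span k {v})
        rw [finrank_span_singleton hv] at h1
        omega
      obtain ⟨ξ, d', hξ, h1, h2⟩ := ih _ hlt (V ⧸ Submodule.span k {v}) _ (P.quot _ hW) rfl
      refine ⟨ξ.comp (Submodule.mkQ _), d', fun h => hξ ?_, fun x hx0 hx1 w => ?_, fun w => ?_⟩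
      · ext w; exact LinearMap.congr_fun h w
      · exact h1 x hx0 hx1 (Submodule.mkQ _ w)
      · exact h2 (Submodule.mkQ _ w)
end
end FEM

namespace FEM
open Filter

section
variable {k : Type} [Field k]

open Polynomial in
theorem laurent_zero [CharZero k] (g : k → k) (K : ℕ) (p : k[X])
    (hp : ∀ s : k, s ≠ 0 → s ≠ -1 → p.eval s = s ^ K * g s)
    (h1 : ∀ s : k, s ≠ 0 → s ≠ -1 → g s = s * g s⁻¹)
    (h2 : ∀ s : k, s ≠ 0 → s ≠ -1 → g s = g (-1 - s)) :
    ∀ s : k, s ≠ 0 → s ≠ -1 → g s = 0 := by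
  have hinf : Set.Infinite {s : k | s ≠ 0 ∧ s ≠ -1} := by
    have : Infinite k := CharZero.infinite k
    have : {s : k | s ≠ 0 ∧ s ≠ -1} = ({0, -1} : Set k)ᶜ := by
      ext s; simp
    rw [this]
    exact (Set.toFinite _).infinite_compl
  induction K generalizing p with
  | succ K ih =>
    have e : (-1 - X) ^ (K + 1) * p = X ^ (K + 1) * p.comp (-1 - X) := by
      refine eq_of_infinite_eval_eq _ _ (hinf.mono ?_)
      rintro s ⟨hs0, hs1⟩
      have a0 : -1 - s ≠ 0 := fun h => hs1 (by linear_combination -h)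
      have a1 : -1 - s ≠ -1 := fun h => hs0 (by linear_combination -h)
      simp only [Set.mem_ofPred_eq, eval_mul, eval_pow, eval_sub, eval_neg, eval_one, eval_X,
        eval_comp]
      rw [hp s hs0 hs1, hp _ a0 a1, ← h2 s hs0 hs1]
      ring
    have e0 := congrArg (eval 0) e
    simp only [eval_mul, eval_pow, eval_sub, eval_neg, eval_one, eval_X, ne_eq, Nat.succ_ne_zero,
      not_false_eq_true, zero_pow, zero_mul, sub_zero, mul_eq_zero] at e0
    have hroot : p.eval 0 = 0 := e0.resolve_left (pow_ne_zero _ (by simp))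
    have : X ∣ p := by rw [X_dvd_iff, coeff_zero_eq_eval_zero, hroot]
    obtain ⟨p', rfl⟩ := this
    refine ih p' fun s hs0 hs1 => ?_
    have := hp s hs0 hs1
    rw [eval_mul, eval_X] at this
    apply mul_left_cancel₀ hs0
    rw [this]; ring
  | zero =>
    simp only [pow_zero, one_mul] at hp
    set r := p.divX with hr
    have hpr : ∀ s, p.eval s = s * r.eval s + p.coeff 0 := by
      intro s
      have := congrArg (eval s) (X_mul_divX_add p)
      rw [eval_add, eval_mul, eval_X, eval_C] at this
      exact this.symm
    set q0 := p.coeff 0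
    set t := p - C q0 * X with ht
    have hrt : ∀ s : k, s ≠ 0 → s ≠ -1 → t.eval s = r.eval s⁻¹ := by
      intro s hs0 hs1
      have a1 : s⁻¹ ≠ -1 := fun h => hs1 (by rw [← inv_inv s, h]; norm_num)
      simp only [ht, eval_sub, eval_mul, eval_C, eval_X]
      rw [hp s hs0 hs1, h1 s hs0 hs1, ← hp _ (inv_ne_zero hs0) a1, hpr]
      field_simp
      ring
    have e : X ^ r.natDegree * t = r.reverse := by
      refine eq_of_infinite_eval_eq _ _ (hinf.mono ?_)
      rintro s ⟨hs0, hs1⟩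
      letI : Invertible s⁻¹ := invertibleOfNonzero (inv_ne_zero hs0)
      have := eval₂_reverse_mul_pow (RingHom.id k) (s⁻¹) r
      rw [invOf_eq_inv, inv_inv] at this
      change eval s r.reverse * s⁻¹ ^ r.natDegree = eval s⁻¹ r at this
      change eval s (X ^ r.natDegree * t) = eval s r.reverse
      rw [eval_mul, eval_pow, eval_X, hrt s hs0 hs1, ← this, inv_pow]
      field_simp
    have htc : t = C (t.coeff 0) := by
      ext i
      rcases Nat.eq_zero_or_pos i with rfl | hi
      · simp
      · rw [coeff_C_of_ne_zero hi.ne']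
        have := congrArg (fun z => z.coeff (i + r.natDegree)) e
        simp only [coeff_X_pow_mul] at this
        rw [this]
        apply coeff_eq_zero_of_natDegree_lt
        have := reverse_natDegree_le r
        omega
    set t0 := t.coeff 0
    have hg : ∀ s : k, s ≠ 0 → s ≠ -1 → g s = t0 + s * q0 := by
      intro s hs0 hs1
      have : t.eval s = t0 := by rw [htc, eval_C]
      rw [← hp s hs0 hs1, ← this, ht]
      simp
      ring
    have g1 := h2 1 (by norm_num) (by norm_num)
    rw [hg 1 (by norm_num) (by norm_num), hg _ (by norm_num) (by norm_num)] at g1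
    have q00 : q0 = 0 := by
      have : (3 : k) * q0 = 0 := by linear_combination g1
      simpa using this
    have g2 := h1 2 (by norm_num) (by norm_num)
    rw [hg 2 (by norm_num) (by norm_num), hg _ (by norm_num) (by norm_num)] at g2
    have t00 : t0 = 0 := by
      rw [q00] at g2
      linear_combination -g2
    intro s hs0 hs1
    rw [hg s hs0 hs1, q00, t00]; ring

open Polynomial in
theorem laurent_zero' [CharZero k] (g : k → k) (a b : ℤ) (u : ℤ → k) (ψ : k)
    (hg : ∀ s : k, s ≠ 0 → s ≠ -1 → g s = ∑ l ∈ Finset.Icc a b, s ^ l * u l - (1 + s) * ψ)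
    (h1 : ∀ s : k, s ≠ 0 → s ≠ -1 → g s = s * g s⁻¹)
    (h2 : ∀ s : k, s ≠ 0 → s ≠ -1 → g s = g (-1 - s)) :
    ∀ s : k, s ≠ 0 → s ≠ -1 → g s = 0 := by
  refine laurent_zero g a.natAbs
    (∑ l ∈ Finset.Icc a b, X ^ (l + a.natAbs).toNat * C (u l) - X ^ a.natAbs * ((1 + X) * C ψ))
    (fun s hs0 hs1 => ?_) h1 h2
  rw [hg s hs0 hs1, mul_sub, Finset.mul_sum]
  simp only [eval_sub, eval_finsetSum, eval_mul, eval_pow, eval_X, eval_C, eval_add, eval_one]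
  congr 1
  refine Finset.sum_congr rfl fun l hl => ?_
  rw [Finset.mem_Icc] at hl
  rw [← mul_assoc, ← zpow_natCast, ← zpow_natCast, ← zpow_add₀ hs0]
  congr 2
  omega

theorem two_zpow [CharZero k] (n : ℤ) (h : (2 : k) ^ n = 2) : n = 1 := by
  have : ((2 : ℚ) ^ n : ℚ) = 2 := by
    have : (((2 : ℚ) ^ n : ℚ) : k) = ((2 : ℚ) : k) := by push_cast; exact h
    exact_mod_cast this
  have h3 : (2 : ℚ) ^ n = 2 ^ (1 : ℤ) := by rw [this]; norm_num
  exact zpow_right_injective₀ (by norm_num) (by norm_num) h3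
end
end FEM

namespace FEM
open Filter

section
variable {k V : Type} [Field k] [AddCommGroup V] [Module k V]

structure Core (h : k → Module.End k V) (F : Module.End k V) (v : V) (ξ : V →ₗ[k] k)
    (m m' : ℤ) : Prop where
  hr : HRel h
  r3 : ∀ x : k, x ≠ 0 → x ≠ 1 → 2 * x - 1 ≠ 0 → ∀ w, h x (h (2 - x⁻¹) (F w)) = F (h (2 * x - 1) w)
  hv : ∀ x : k, x ≠ 0 → x ≠ 1 → h x v = x ^ m • v
  fv : F v = v
  hξ : ∀ x : k, x ≠ 0 → x ≠ 1 → ∀ w, ξ (h x w) = x ^ m' * ξ w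
  fξ : ∀ w, ξ (F w) = ξ w
  hC : ∀ x y : k, x ≠ 0 → x ≠ 1 → y ≠ 0 → y ≠ 1 → x * y ≠ 1 → ∃ C : k, ∀ w,
    h x (h y w) = h (x * y) w + (C * ξ w) • v
  v0 : v ≠ 0
  ξ0 : ∃ w, ξ w = 1

/-- path form -/
def Gp (h : k → Module.End k V) (P Q : k) : Module.End k V := h (Q / P)

theorem div_ne1 {P Q : k} (hP : P ≠ 0) (h : P ≠ Q) : Q / P ≠ 1 := by
  rw [Ne, div_eq_one_iff_eq hP]; exact h.symm

variable {h : k → Module.End k V} {F : Module.End k V} {v : V} {ξ : V →ₗ[k] k} {m m' : ℤ}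

theorem Gp_swap (H : HRel h) {P Q Q' R : k} (hP : P ≠ 0) (hQ : Q ≠ 0) (hQ' : Q' ≠ 0) (hR : R ≠ 0)
    (hPQ : P ≠ Q) (hQR : Q ≠ R) (e : Q + Q' = P + R) (w : V) :
    Gp h P Q (Gp h Q R w) = Gp h P Q' (Gp h Q' R w) := by
  have e1 : Q / P * (R / Q) - Q / P + 1 = Q' / P := by
    field_simp
    linear_combination -e
  have e2 : Q / P * (R / Q) / (Q' / P) = R / Q' := by
    field_simp
  have := H.r2 (Q / P) (R / Q) (div_ne_zero hQ hP) (div_ne1 hP hPQ) (div_ne_zero hR hQ)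
    (div_ne1 hQ hQR) (by rw [e1]; exact div_ne_zero hQ' hP) w
  rw [e1, e2] at this
  exact this

theorem Gp_inv (H : HRel h) {P Q : k} (hP : P ≠ 0) (hQ : Q ≠ 0) (hPQ : P ≠ Q) (w : V) :
    Gp h P Q (Gp h Q P w) = w := by
  have := H.r1 (Q / P) (div_ne_zero hQ hP) (div_ne1 hP hPQ) w
  rw [inv_div] at this
  exact this

namespace Core

theorem gv (K : Core h F v ξ m m') {P Q : k} (hP : P ≠ 0) (hQ : Q ≠ 0) (hPQ : P ≠ Q) :
    Gp h P Q v = (Q ^ m * P ^ (-m)) • v := by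
  rw [Gp, K.hv _ (div_ne_zero hQ hP) (div_ne1 hP hPQ), div_zpow, zpow_neg, div_eq_mul_inv]

theorem gξ (K : Core h F v ξ m m') {P Q : k} (hP : P ≠ 0) (hQ : Q ≠ 0) (hPQ : P ≠ Q) (w : V) :
    ξ (Gp h P Q w) = (Q ^ m' * P ^ (-m')) * ξ w := by
  rw [Gp, K.hξ _ (div_ne_zero hQ hP) (div_ne1 hP hPQ), div_zpow, zpow_neg, div_eq_mul_inv]

theorem cancel (K : Core h F v ξ m m') {A B : k} (e : ∀ w, ∃ z : V, z + (A * ξ w) • v = z + (B * ξ w) • v) : A = B := by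
  obtain ⟨w0, hw0⟩ := K.ξ0
  obtain ⟨z, hz⟩ := e w0
  have := smul_left_injective k K.v0 (add_left_cancel hz)
  simpa [hw0] using this

/-- `c` at a point -/
def _root_.FEM.Cval (h : k → Module.End k V) (v : V) (ξ : V →ₗ[k] k) (m m' : ℤ)
    (P Q R : k) (c : k) : Prop :=
  ∀ w, Gp h P Q (Gp h Q R w) = Gp h P R w + (c * (P ^ (-m) * R ^ m') * ξ w) • v

theorem exC (K : Core h F v ξ m m') {P Q R : k} (hP : P ≠ 0) (hQ : Q ≠ 0) (hR : R ≠ 0)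
    (hPQ : P ≠ Q) (hQR : Q ≠ R) (hPR : P ≠ R) : ∃ c, Cval h v ξ m m' P Q R c := by
  have e0 : Q / P * (R / Q) = R / P := by field_simp
  obtain ⟨C, hC⟩ := K.hC (Q / P) (R / Q) (div_ne_zero hQ hP) (div_ne1 hP hPQ) (div_ne_zero hR hQ)
    (div_ne1 hQ hQR) (by rw [e0]; exact div_ne1 hP hPR)
  refine ⟨C * (P ^ m * R ^ (-m')), fun w => ?_⟩
  have := hC w
  rw [e0] at this
  rw [Gp, Gp, this, Gp]
  congr 3
  have p1 : P ^ m ≠ 0 := zpow_ne_zero _ hP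
  have p2 : R ^ m' ≠ 0 := zpow_ne_zero _ hR
  rw [zpow_neg, zpow_neg]
  field_simp

theorem uniqC (K : Core h F v ξ m m') {P Q R : k} (hP : P ≠ 0) (hR : R ≠ 0) {c c' : k} (h1 : Cval h v ξ m m' P Q R c)
    (h2 : Cval h v ξ m m' P Q R c') : c = c' := by
  have : c * (P ^ (-m) * R ^ m') = c' * (P ^ (-m) * R ^ m') :=
    K.cancel fun w => ⟨_, (h1 w).symm.trans (h2 w)⟩
  exact mul_right_cancel₀ (mul_ne_zero (zpow_ne_zero _ hP) (zpow_ne_zero _ hR)) this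

theorem transC (K : Core h F v ξ m m') {P Q R P' Q' R' : k} (hP : P ≠ 0) (hQ : Q ≠ 0) (hR : R ≠ 0)
    (hP' : P' ≠ 0) (hQ' : Q' ≠ 0) (hR' : R' ≠ 0)
    (hPQ : P ≠ Q) (hQR : Q ≠ R) (hPR : P ≠ R) (e1 : P + Q' = P' + Q) (e2 : P + R' = P' + R) {c : k}
    (h1 : Cval h v ξ m m' P' Q' R' c) : Cval h v ξ m m' P Q R c := by
  by_cases hPP : P = P'
  · subst hPP
    rw [add_left_cancel e1, add_left_cancel e2] at h1
    exact h1
  obtain ⟨c', hc'⟩ := K.exC hP hQ hR hPQ hQR hPR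
  have hQQ : Q ≠ Q' := fun h => hPP (by rw [h] at e1; exact add_right_cancel e1)
  have hRR : R ≠ R' := fun h => hPP (by rw [h] at e2; exact add_right_cancel e2)
  have hPQ' : P' ≠ Q' := fun h => hPQ (by rw [h] at e1; linear_combination e1)
  have hQR' : Q' ≠ R' := fun h => hQR (by rw [h] at e1; linear_combination e2 - e1)
  have hPR' : P' ≠ R' := fun h => hPR (by rw [h] at e2; linear_combination e2)
  have key : c * (P ^ (-m) * R' ^ m') = c' * (P ^ (-m) * R' ^ m') := by
    refine K.cancel fun w => ⟨Gp h P P' (Gp h P' R' w), ?_⟩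
    have a1 : Gp h P P' (Gp h P' Q' (Gp h Q' R' w)) =
        Gp h P P' (Gp h P' R' w) + (c * (P ^ (-m) * R' ^ m') * ξ w) • v := by
      rw [h1 w, map_add, map_smul, K.gv hP hP' hPP, smul_smul]
      congr 2
      rw [zpow_neg P']
      have := zpow_ne_zero m hP'
      field_simp
    have a2 : Gp h P Q (Gp h Q R (Gp h R R' w)) =
        Gp h P P' (Gp h P' R' w) + (c' * (P ^ (-m) * R' ^ m') * ξ w) • v := by
      rw [hc', K.gξ hR hR' hRR,
        Gp_swap K.hr hP hR hP' hR' hPR hRR (by linear_combination -e2) w]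
      congr 2
      rw [zpow_neg R]
      have := zpow_ne_zero m' hR
      field_simp
    rw [← a1, ← a2, Gp_swap K.hr hP hP' hQ hQ' hPP hPQ' (by linear_combination -e1),
      Gp_swap K.hr hQ hQ' hR hR' hQQ hQR' (by linear_combination e1 - e2)]
  have := mul_right_cancel₀ (mul_ne_zero (zpow_ne_zero _ hP) (zpow_ne_zero _ hR')) key
  rw [this]; exact hc'

theorem _root_.FEM.ex_generic [Infinite k] (s : Finset k) : ∃ S : k, ∀ z ∈ s, S ≠ -z := by
  classical
  obtain ⟨S, hS⟩ := Infinite.exists_notMem_finset (s.image fun z => -z)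
  refine ⟨S, fun z hz h => hS ?_⟩
  exact Finset.mem_image.2 ⟨z, hz, h.symm⟩

theorem ccc (K : Core h F v ξ m m') [Infinite k] : ∃ c : k → k → k, ∀ P Q R : k, P ≠ 0 → Q ≠ 0 → R ≠ 0 →
    P ≠ Q → Q ≠ R → P ≠ R → Cval h v ξ m m' P Q R (c (Q - P) (R - Q)) := by
  classical
  have : ∀ a b : k, ∃ c : k, ∀ P Q R : k, P ≠ 0 → Q ≠ 0 → R ≠ 0 →
    P ≠ Q → Q ≠ R → P ≠ R → Q - P = a → R - Q = b → Cval h v ξ m m' P Q R c := by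
    intro a b
    by_cases hab : a ≠ 0 ∧ b ≠ 0 ∧ a + b ≠ 0
    · obtain ⟨S, hS⟩ := ex_generic ({0, a, a + b} : Finset k)
      have s0 := hS 0 (by simp)
      have s1 := hS a (by simp)
      have s2 := hS (a + b) (by simp)
      rw [neg_zero] at s0
      have s1' : S + a ≠ 0 := fun h => s1 (by linear_combination h)
      have s2' : S + (a + b) ≠ 0 := fun h => s2 (by linear_combination h)
      obtain ⟨c, hc⟩ := K.exC (Q := S + a) (R := S + (a + b)) s0 s1' s2'
        (fun h => hab.1 (by linear_combination -h)) (fun h => hab.2.1 (by linear_combination -h))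
        (fun h => hab.2.2 (by linear_combination -h))
      refine ⟨c, fun P Q R hP hQ hR hPQ hQR hPR ha hb => ?_⟩
      exact K.transC hP hQ hR s0 s1' s2' hPQ hQR hPR (by rw [← ha]; ring)
        (by rw [← ha, ← hb]; ring) hc
    · refine ⟨0, fun P Q R hP hQ hR hPQ hQR hPR ha hb => absurd ?_ hab⟩
      refine ⟨fun h => hPQ ?_, fun h => hQR ?_, fun h => hPR ?_⟩
      · linear_combination -ha - h
      · linear_combination -hb - h
      · linear_combination -ha - hb - h
  choose c hc using this
  exact ⟨c, fun P Q R hP hQ hR hPQ hQR hPR => hc _ _ P Q R hP hQ hR hPQ hQR hPR rfl rfl⟩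

end Core
end
end FEM

namespace FEM
open Filter

section
variable {k V : Type} [Field k] [AddCommGroup V] [Module k V]
variable {h : k → Module.End k V} {F : Module.End k V} {v : V} {ξ : V →ₗ[k] k} {m m' : ℤ}

/-- the cocycle -/
def CFun (h : k → Module.End k V) (v : V) (ξ : V →ₗ[k] k) (m m' : ℤ) (c : k → k → k) : Prop :=
  ∀ P Q R : k, P ≠ 0 → Q ≠ 0 → R ≠ 0 →
    P ≠ Q → Q ≠ R → P ≠ R → Cval h v ξ m m' P Q R (c (Q - P) (R - Q))

theorem CFun.pt {c : k → k → k} (hc : CFun h v ξ m m' c) {P a b Q R : k} (hP : P ≠ 0)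
    (hQ : Q ≠ 0) (hR : R ≠ 0) (ha : a ≠ 0) (hb : b ≠ 0) (hab : a + b ≠ 0) (e1 : Q = P + a)
    (e2 : R = P + a + b) : Cval h v ξ m m' P Q R (c a b) := by
  have := hc P Q R hP hQ hR (fun h => ha (by linear_combination -e1 - h))
    (fun h => hb (by linear_combination e1 - e2 - h))
    (fun h => hab (by linear_combination -e2 - h))
  rwa [show Q - P = a by rw [e1]; ring, show R - Q = b by rw [e1, e2]; ring] at this

theorem ne_add {P a : k} (ha : a ≠ 0) : P ≠ P + a := fun h => ha (by linear_combination -h)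

namespace Core

theorem Q1 [Infinite k] (K : Core h F v ξ m m') {c : k → k → k} (hc : CFun h v ξ m m' c)
    {a b : k} (ha : a ≠ 0) (hb : b ≠ 0) (hab : a + b ≠ 0) : c a b = c b a := by
  classical
  obtain ⟨S, hS⟩ := ex_generic ({0, a, b, a + b} : Finset k)
  have s0 : S ≠ 0 := by simpa using hS 0 (by simp)
  have s1 : S + a ≠ 0 := fun h => hS a (by simp) (by linear_combination h)
  have s2 : S + b ≠ 0 := fun h => hS b (by simp) (by linear_combination h)
  have s3 : S + (a + b) ≠ 0 := fun h => hS (a + b) (by simp) (by linear_combination h)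
  have h1 := hc.pt s0 s1 s3 ha hb hab rfl (by ring)
  have h2 := hc.pt s0 s2 s3 hb ha (by rwa [add_comm]) rfl (by ring)
  refine K.uniqC s0 s3 h1 fun w => ?_
  rw [← h2 w, Gp_swap K.hr s0 s1 s2 s3 (ne_add ha) (fun h => hb (by linear_combination -h))
    (by ring)]

theorem Q2 [Infinite k] (K : Core h F v ξ m m') {c : k → k → k} (hc : CFun h v ξ m m' c)
    {a b r : k} (ha : a ≠ 0) (hb : b ≠ 0) (hab : a + b ≠ 0) (hr : r ≠ 0) :
    c (r * a) (r * b) = r ^ (m - m') * c a b := by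
  classical
  obtain ⟨S, hS⟩ := ex_generic ({0, a, a + b} : Finset k)
  have s0 : S ≠ 0 := by simpa using hS 0 (by simp)
  have s1 : S + a ≠ 0 := fun h => hS a (by simp) (by linear_combination h)
  have s3 : S + (a + b) ≠ 0 := fun h => hS (a + b) (by simp) (by linear_combination h)
  have h1 := hc.pt s0 s1 s3 ha hb hab rfl (by ring)
  have h2 := hc.pt (mul_ne_zero hr s0) (mul_ne_zero hr s1) (mul_ne_zero hr s3)
    (mul_ne_zero hr ha) (mul_ne_zero hr hb) (by rw [← mul_add]; exact mul_ne_zero hr hab)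
    (by ring) (by ring)
  have hG : ∀ P Q, Gp h (r * P) (r * Q) = Gp h P Q := by
    intro P Q
    rw [Gp, Gp, mul_div_mul_left _ _ hr]
  have h3 : c a b = c (r * a) (r * b) * r ^ (m' - m) := by
    refine K.uniqC s0 s3 h1 fun w => ?_
    have := h2 w
    rw [hG, hG, hG] at this
    rw [this]
    congr 3
    rw [mul_zpow, mul_zpow, sub_eq_add_neg, zpow_add₀ hr]
    ring
  rw [h3, mul_left_comm, ← zpow_add₀ hr]
  simp

theorem Q3 [Infinite k] (K : Core h F v ξ m m') {c : k → k → k} (hc : CFun h v ξ m m' c)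
    {a b : k} (ha : a ≠ 0) (hb : b ≠ 0) (hab : a + b ≠ 0) : c a b = c b (- a - b) := by
  classical
  obtain ⟨S, hS⟩ := ex_generic ({0, a, a + b} : Finset k)
  have s0 : S ≠ 0 := by simpa using hS 0 (by simp)
  have s1 : S + a ≠ 0 := fun h => hS a (by simp) (by linear_combination h)
  have s3 : S + (a + b) ≠ 0 := fun h => hS (a + b) (by simp) (by linear_combination h)
  have h1 := hc.pt s0 s1 s3 ha hb hab rfl (by ring)
  have h2 := hc.pt s1 s3 s0 hb (b := -a-b) (fun h => hab (by linear_combination -h))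
    (fun h => ha (by linear_combination -h)) (by ring) (by ring)
  have key : c a b * (S ^ (-m) * S ^ m') = c b (-a-b) * (S ^ (-m) * S ^ m') := by
    refine K.cancel fun w => ⟨w, ?_⟩
    have e1 := h1 (Gp h (S + (a + b)) S w)
    rw [Gp_inv K.hr s0 s3 (ne_add hab), K.gξ s3 s0 (ne_add hab).symm] at e1
    have e2 := congrArg (Gp h S (S + a)) (h2 w)
    rw [map_add, map_smul, Gp_inv K.hr s0 s1 (ne_add ha), K.gv s0 s1 (ne_add ha), smul_smul] at e2
    have e3 := e1.symm.trans e2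
    convert e3 using 3
    · have := zpow_ne_zero m' s3
      rw [zpow_neg (S + (a + b))]
      field_simp
    · have := zpow_ne_zero m s1
      rw [zpow_neg (S + a)]
      field_simp
  exact mul_right_cancel₀ (mul_ne_zero (zpow_ne_zero _ s0) (zpow_ne_zero _ s0)) key

theorem Fcomm (K : Core h F v ξ m m') {c : k → k → k} (hc : CFun h v ξ m m' c)
    {P Q R : k} (hP : P ≠ 0) (hQ : Q ≠ 0) (hR : R ≠ 0) {a : k} (ha : a ≠ 0) (h2a : a + a ≠ 0)
    (e1 : Q = P + a) (e2 : R = P + a + a) (w : V) :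
    F (Gp h P R w) = Gp h P R (F w) + (c a a * (P ^ (-m) * R ^ m') * ξ w) • v := by
  have h1 := hc.pt hP hQ hR ha ha h2a e1 e2 (F w)
  have h3 := K.r3 (Q / P) (div_ne_zero hQ hP) (div_ne1 hP (by rw [e1]; exact ne_add ha))
  have f1 : 2 - (Q / P)⁻¹ = R / Q := by
    field_simp
    rw [e1, e2]; ring
  have f2 : 2 * (Q / P) - 1 = R / P := by
    field_simp
    rw [e1, e2]; ring
  rw [f1, f2] at h3
  rw [K.fξ] at h1
  rw [← h1]
  exact (h3 (div_ne_zero hR hP) w).symm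

theorem Q4 [CharZero k] (K : Core h F v ξ m m') {c : k → k → k} (hc : CFun h v ξ m m' c) :
    c 1 1 = 0 ∨ m - m' = 1 := by
  classical
  have : Infinite k := CharZero.infinite k
  obtain ⟨S, hS⟩ := ex_generic ({0, 1, 2, 3, 4} : Finset k)
  have s0 : S ≠ 0 := by simpa using hS 0 (by simp)
  have s1 : S + 1 ≠ 0 := fun h => hS 1 (by simp) (by linear_combination h)
  have s2 : S + 2 ≠ 0 := fun h => hS 2 (by simp) (by linear_combination h)
  have s3 : S + 3 ≠ 0 := fun h => hS 3 (by simp) (by linear_combination h)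
  have s4 : S + 4 ≠ 0 := fun h => hS 4 (by simp) (by linear_combination h)
  have n2 : (2 : k) ≠ 0 := two_ne_zero
  have f1 := K.Fcomm hc s0 s1 s2 one_ne_zero (by norm_num) rfl (by ring)
  have f2 := K.Fcomm hc s2 s3 s4 one_ne_zero (by norm_num) (by ring) (by ring)
  have f3 := K.Fcomm hc s0 s2 s4 n2 (by norm_num) (by ring) (by ring)
  have hh := hc.pt s0 s2 s4 n2 n2 (by norm_num) rfl (by ring)
  have ne24 : S + 2 ≠ S + 4 := fun h => n2 (by linear_combination -h)
  have key : (c 1 1 + c 1 1 + c 2 2) * (S ^ (-m) * (S + 4) ^ m')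
      = (c 2 2 + c 2 2) * (S ^ (-m) * (S + 4) ^ m') := by
    refine K.cancel fun w => ⟨Gp h S (S + 4) (F w), ?_⟩
    have t := congrArg F (hh w)
    rw [f1, f2, map_add, map_add, map_smul, map_smul, K.fv, f3, hh (F w), K.fξ,
      K.gv s0 s2 (ne_add n2), K.gξ s2 s4 ne24, smul_smul, add_assoc, add_assoc, ← add_smul,
      ← add_smul, add_assoc, ← add_smul] at t
    convert t using 3
    · have := zpow_ne_zero m' s2
      have := zpow_ne_zero m s2
      rw [zpow_neg (S + 2), zpow_neg (S + 2)]
      field_simp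
      ring
    · ring
  have key2 := mul_right_cancel₀ (mul_ne_zero (zpow_ne_zero _ s0) (zpow_ne_zero _ s4)) key
  have q2 := K.Q2 hc (a := 1) (b := 1) (r := 2) one_ne_zero one_ne_zero (by norm_num) n2
  rw [mul_one] at q2
  by_cases h0 : c 1 1 = 0
  · exact Or.inl h0
  · right
    apply two_zpow (k := k)
    apply mul_right_cancel₀ h0
    rw [← q2]
    linear_combination -key2

theorem Q5 [CharZero k] (K : Core h F v ξ m m') {c : k → k → k} (hc : CFun h v ξ m m' c)
    (h11 : c 1 1 = 0) {a b : k} (ha : a ≠ 0) (hb : b ≠ 0) (hab : a + b ≠ 0) :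
    c a b = 0 ∨ m - m' = 1 := by
  classical
  have : Infinite k := CharZero.infinite k
  have n2 : (2 : k) ≠ 0 := two_ne_zero
  have hcc : ∀ a : k, a ≠ 0 → c a a = 0 := by
    intro a ha
    have q2 := K.Q2 hc (a := 1) (b := 1) (r := a) one_ne_zero one_ne_zero (by norm_num) ha
    rwa [mul_one, h11, mul_zero] at q2
  have d : ∀ a : k, a ≠ 0 → a + a ≠ 0 := fun a ha h => mul_ne_zero n2 ha (by linear_combination h)
  obtain ⟨S, hS⟩ := ex_generic ({0, a, a + a, a + b, a + a + b, a + a + b + b} : Finset k)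
  have s0 : S ≠ 0 := by simpa using hS 0 (by simp)
  have s1 : S + a ≠ 0 := fun h => hS a (by simp) (by linear_combination h)
  have s2 : S + (a + a) ≠ 0 := fun h => hS (a + a) (by simp) (by linear_combination h)
  have s2' : S + (a + b) ≠ 0 := fun h => hS (a + b) (by simp) (by linear_combination h)
  have s3 : S + (a + a + b) ≠ 0 := fun h => hS (a + a + b) (by simp) (by linear_combination h)
  have s4 : S + (a + a + b + b) ≠ 0 :=
    fun h => hS (a + a + b + b) (by simp) (by linear_combination h)
  have g1 := hc.pt s0 s1 s2 ha ha (d a ha) rfl (by ring)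
  have g2 := hc.pt s2 s3 s4 hb hb (d b hb) (by ring) (by ring)
  have g3 := hc.pt s0 s1 s2' ha hb hab rfl (by ring)
  have g4 := hc.pt s2' s3 s4 ha hb hab (by ring) (by ring)
  have g5 := hc.pt s0 s2' s4 hab hab (d _ hab) (by ring) (by ring)
  have g6 := hc.pt s0 s2 s4 (d a ha) (d b hb) (by
    intro h; exact mul_ne_zero n2 hab (by linear_combination h)) (by ring) (by ring)
  have n24 : S + (a + b) ≠ S + (a + a + b + b) := fun h => hab (by linear_combination -h)
  have key : c (a + a) (b + b) * (S ^ (-m) * (S + (a + a + b + b)) ^ m')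
      = (c a b + c a b) * (S ^ (-m) * (S + (a + a + b + b)) ^ m') := by
    refine K.cancel fun w => ⟨Gp h S (S + (a + a + b + b)) w, ?_⟩
    have e1 := g2 w
    rw [hcc b hb, zero_mul, zero_mul, zero_smul, add_zero] at e1
    have e2 := g1 (Gp h (S + (a + a)) (S + (a + a + b + b)) w)
    rw [hcc a ha, zero_mul, zero_mul, zero_smul, add_zero] at e2
    have e3 := g5 w
    rw [hcc _ hab, zero_mul, zero_mul, zero_smul, add_zero] at e3
    rw [← g6 w, ← e2, ← e1, Gp_swap K.hr s1 s2 s2' s3 (fun h => ha (by linear_combination -h))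
      (fun h => hb (by linear_combination -h)) (by ring), g4, map_add, map_add, g3, map_smul,
      map_smul, K.gv s1 s2' (fun h => hb (by linear_combination -h)), map_smul,
      K.gv s0 s1 (ne_add ha), K.gξ s2' s4 n24, e3, smul_smul, smul_smul, add_assoc, ← add_smul]
    congr 2
    have := zpow_ne_zero m' s2'
    have := zpow_ne_zero m s2'
    have := zpow_ne_zero m s1
    rw [zpow_neg (S + (a + b)), zpow_neg (S + (a + b)), zpow_neg (S + a)]
    field_simp
  have key2 := mul_right_cancel₀ (mul_ne_zero (zpow_ne_zero _ s0) (zpow_ne_zero _ s4)) key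
  have q2 := K.Q2 hc (a := a) (b := b) (r := 2) ha hb hab n2
  rw [two_mul, two_mul, key2] at q2
  by_cases h0 : c a b = 0
  · exact Or.inl h0
  · right
    apply two_zpow (k := k)
    apply mul_right_cancel₀ h0
    linear_combination -q2

end Core
end
end FEM

namespace FEM
open Filter

section
variable {k V : Type} [Field k] [AddCommGroup V] [Module k V]
variable {h : k → Module.End k V} {F : Module.End k V} {v : V} {ξ : V →ₗ[k] k} {m m' : ℤ}

namespace Core

theorem Q6a [Infinite k] (K : Core h F v ξ m m') {c : k → k → k} (hc : CFun h v ξ m m' c)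
    (hn : m - m' = 1) {w0 : V} (hw0 : ξ w0 = 1) {φ : V →ₗ[k] k} (hφ : φ v = 1) {d : ℤ} {M : ℕ}
    (hM : m' - d = M) {a b : ℤ} {cc : ℤ → V} (hg : Good h w0 d a b cc) {Fl : ℤ → ℤ → V}
    (hF : ∀ l ∈ Finset.Icc a b, Good h (cc l) (d + l) a b (Fl l)) {s : k} (hs0 : s ≠ 0)
    (hs1 : s ≠ -1) :
    ∀ᶠ σ : k in cofinite, σ * c 1 s * (σ * (1 + s) + 1) ^ M =
      ∑ l ∈ Finset.Icc a b, ∑ e ∈ Finset.Icc a b, σ ^ (l + e) * (s ^ l * φ (Fl l e)) -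
      ∑ l ∈ Finset.Icc a b, σ ^ l * ((1 + s) ^ l * φ (cc l)) := by
  have hs1' : 1 + s ≠ 0 := fun h => hs1 (by linear_combination h)
  have inj1 : Function.Injective (fun σ : k => 1 + σ) := add_right_injective 1
  have inj2 : Function.Injective (fun σ : k => 1 + s * (1 - (1 + σ)⁻¹)) := by
    intro x y hxy
    have := mul_left_cancel₀ hs0 (add_left_cancel hxy)
    have := inv_injective (sub_right_injective this)
    exact add_left_cancel this
  have inj3 : Function.Injective (fun σ : k => σ * (1 + s) + 1) := by
    intro x y hxy
    exact mul_right_cancel₀ hs1' (add_right_cancel hxy)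
  have hF' : ∀ᶠ x in cofinite, ∀ l ∈ Finset.Icc a b, h x (cc l) = x ^ (d + l) •
      ∑ e ∈ Finset.Icc a b, (x - 1) ^ e • Fl l e := by
    rw [Filter.eventually_all_finset]
    exact hF
  filter_upwards [ev_comp hF' inj1, ev_comp hg inj2, ev_comp hg inj3, ev_ne 0, ev_ne (-1),
    ev_comp (ev_ne 0) inj3] with σ e1 e2 e3 h0 hm1 h3
  have hx : 1 + σ ≠ 0 := fun h => hm1 (by linear_combination h)
  have hP : σ⁻¹ ≠ 0 := inv_ne_zero h0
  have q1 : σ⁻¹ + 1 = (1 + σ) / σ := by field_simp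
  have q2 : σ⁻¹ + 1 + s = (σ * (1 + s) + 1) / σ := by field_simp; ring
  have hh := hc.pt hP (Q := σ⁻¹ + 1) (R := σ⁻¹ + 1 + s) (by rw [q1]; exact div_ne_zero hx h0)
    (by rw [q2]; exact div_ne_zero h3 h0) one_ne_zero hs0 hs1' rfl rfl w0
  unfold Gp at hh
  rw [show (σ⁻¹ + 1) / σ⁻¹ = 1 + σ by field_simp,
    show (σ⁻¹ + 1 + s) / (σ⁻¹ + 1) = 1 + s * (1 - (1 + σ)⁻¹) by
      rw [q2, q1]; field_simp; ring,
    show (σ⁻¹ + 1 + s) / σ⁻¹ = σ * (1 + s) + 1 by rw [q2]; field_simp, q2] at hh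
  set y := 1 + s * (1 - (1 + σ)⁻¹) with hy
  set z := σ * (1 + s) + 1 with hz
  have hyz : (1 + σ) * y = z := by rw [hy, hz]; field_simp; ring
  have hy0 : y ≠ 0 := by
    intro h; rw [h, mul_zero] at hyz; exact h3 hyz.symm
  have hy1 : y - 1 = s * σ / (1 + σ) := by rw [hy]; field_simp; ring
  have t := congrArg φ hh
  rw [e2, e3, map_smul, map_sum] at t
  have t1 : ∑ l ∈ Finset.Icc a b, h (1 + σ) ((y - 1) ^ l • cc l)
      = ∑ l ∈ Finset.Icc a b, ((1 + σ) ^ d * s ^ l) • ∑ e ∈ Finset.Icc a b,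
        σ ^ (l + e) • Fl l e := by
    refine Finset.sum_congr rfl fun l hl => ?_
    rw [map_smul, e1 l hl, smul_smul, Finset.smul_sum, Finset.smul_sum]
    refine Finset.sum_congr rfl fun e _ => ?_
    rw [smul_smul, smul_smul]
    congr 1
    rw [hy1, show 1 + σ - 1 = σ by ring, div_zpow, mul_zpow, zpow_add₀ hx, zpow_add₀ h0]
    have := zpow_ne_zero l hx
    field_simp
  rw [t1] at t
  simp only [map_add, map_smul, map_sum, smul_eq_mul, hφ, hw0, mul_one] at t
  have hzd : z ^ d ≠ 0 := zpow_ne_zero _ h3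
  have hyd : y ^ d * (1 + σ) ^ d = z ^ d := by rw [← hyz, mul_zpow]; ring
  have l1 : σ⁻¹ ^ (-m) * (z / σ) ^ m' = σ * (z ^ d * z ^ M) := by
    rw [← zpow_natCast z M, ← hM, ← zpow_add₀ h3, show d + (m' - d) = m' by ring, div_zpow,
      inv_zpow, zpow_neg, inv_inv, show m = m' + 1 by omega, zpow_add_one₀ h0]
    have := zpow_ne_zero m' h0
    field_simp
  rw [l1] at t
  apply mul_left_cancel₀ hzd
  have t2 : y ^ d * ∑ l ∈ Finset.Icc a b, (1 + σ) ^ d * s ^ l * ∑ e ∈ Finset.Icc a b,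
        σ ^ (l + e) * φ (Fl l e) = z ^ d * ∑ l ∈ Finset.Icc a b, ∑ e ∈ Finset.Icc a b,
        σ ^ (l + e) * (s ^ l * φ (Fl l e)) := by
    rw [← hyd, Finset.mul_sum, Finset.mul_sum]
    refine Finset.sum_congr rfl fun l hl => ?_
    rw [Finset.mul_sum, Finset.mul_sum, Finset.mul_sum]
    refine Finset.sum_congr rfl fun e _ => ?_
    ring
  have t3 : ∑ l ∈ Finset.Icc a b, (z - 1) ^ l * φ (cc l) =
      ∑ l ∈ Finset.Icc a b, σ ^ l * ((1 + s) ^ l * φ (cc l)) := by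
    refine Finset.sum_congr rfl fun l hl => ?_
    rw [hz, add_sub_cancel_right, mul_zpow, mul_assoc]
  rw [t2, t3] at t
  rw [mul_sub, t]
  ring

theorem Q6 [Infinite k] (K : Core h F v ξ m m') {c : k → k → k} (hc : CFun h v ξ m m' c)
    (hn : m - m' = 1) (hrat : ∃ d0 : ℤ, ∀ d ≤ d0, ∃ a b : ℤ, ∀ w, ∃ c, Good h w d a b c) :
    ∃ (a b : ℤ) (u : ℤ → k) (ψ : k), ∀ s : k, s ≠ 0 → s ≠ -1 →
      c 1 s = ∑ l ∈ Finset.Icc a b, s ^ l * u l - (1 + s) * ψ := by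
  classical
  obtain ⟨w0, hw0⟩ := K.ξ0
  obtain ⟨φ, hφ⟩ : ∃ φ : V →ₗ[k] k, φ v = 1 := by
    obtain ⟨φ, hφ⟩ : ∃ φ : V →ₗ[k] k, φ v ≠ 0 := by
      by_contra hcon
      push Not at hcon
      exact K.v0 ((Module.forall_dual_apply_eq_zero_iff k v).1 hcon)
    exact ⟨(φ v)⁻¹ • φ, by simp [hφ]⟩
  obtain ⟨d0, hd0⟩ := hrat
  obtain ⟨d, hd, M, hM⟩ : ∃ d, d ≤ d0 ∧ ∃ M : ℕ, m' - d = M :=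
    ⟨min d0 m', min_le_left _ _, (m' - min d0 m').toNat, by
      rw [Int.toNat_of_nonneg]; have := min_le_right d0 m'; omega⟩
  obtain ⟨a, b, hab⟩ := hd0 d hd
  obtain ⟨cc, hg⟩ := hab w0
  obtain ⟨Fl, hF⟩ := lemX K.hr hg
  refine ⟨a, b, fun l => ∑ e ∈ Finset.Icc a b, if l + e = 1 then φ (Fl l e) else 0,
    if 1 ∈ Finset.Icc a b then φ (cc 1) else 0, fun s hs0 hs1 => ?_⟩
  have hev := K.Q6a hc hn hw0 hφ hM hg hF hs0 hs1
  set N := a.natAbs + b.natAbs with hN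
  have hbd := bd a b
  rw [← hN] at hbd
  obtain ⟨S, ω, hS, hω⟩ := weights (k := k) (N + N + M + 1) _ (ev_inf (hev.and (ev_ne 0)))
    (by simp) 1 (by push_cast; rw [abs_one]; omega)
  have hsum := Finset.sum_congr (s₁ := S) rfl fun z hz => congrArg (fun y => ω z * y) (hS z hz).1
  have L1 : ∑ z ∈ S, ω z * (z * c 1 s * (z * (1 + s) + 1) ^ M) = c 1 s := by
    have : ∀ z ∈ S, ω z * (z * c 1 s * (z * (1 + s) + 1) ^ M) = ∑ i ∈ Finset.range (M + 1),
        (c 1 s * ((1 + s) ^ i * (M.choose i : k))) * (ω z * z ^ ((i + 1 : ℕ) : ℤ)) := by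
      intro z hz
      rw [add_pow, Finset.mul_sum, Finset.mul_sum]
      refine Finset.sum_congr rfl fun i _ => ?_
      rw [one_pow, mul_pow, zpow_natCast, pow_succ]
      ring
    rw [Finset.sum_congr rfl this, Finset.sum_comm]
    simp only [← Finset.mul_sum]
    rw [Finset.sum_eq_single 0]
    · rw [hω _ (by push_cast; rw [abs_le]; omega)]
      simp
    · intro i hi hi0
      rw [Finset.mem_range] at hi
      rw [hω _ (by push_cast; rw [abs_le]; omega), if_neg (by omega), mul_zero]
    · simp
  have L3 : ∑ z ∈ S, ω z * (∑ l ∈ Finset.Icc a b, z ^ l * ((1 + s) ^ l * φ (cc l))) =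
      (1 + s) * if 1 ∈ Finset.Icc a b then φ (cc 1) else 0 := by
    have := extract (N + N + M + 1) S ω 1 hω (Finset.Icc a b)
      (fun i hi => (hbd i hi).trans (by push_cast; omega)) (fun l => (1 + s) ^ l * φ (cc l))
    simp only [smul_eq_mul] at this
    rw [this]
    split_ifs <;> simp
  have L2 : ∑ z ∈ S, ω z * (∑ l ∈ Finset.Icc a b, ∑ e ∈ Finset.Icc a b,
      z ^ (l + e) * (s ^ l * φ (Fl l e))) =
      ∑ l ∈ Finset.Icc a b, s ^ l * ∑ e ∈ Finset.Icc a b, if l + e = 1 then φ (Fl l e) else 0 := by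
    simp only [Finset.mul_sum]
    rw [Finset.sum_comm]
    refine Finset.sum_congr rfl fun l hl => ?_
    rw [Finset.sum_comm]
    refine Finset.sum_congr rfl fun e he => ?_
    have h1 := abs_le.1 (hbd l hl)
    have h2 := abs_le.1 (hbd e he)
    have := hω (l + e) (by rw [abs_le]; push_cast; constructor <;> linarith)
    have e1 : ∀ z ∈ S, ω z * (z ^ (l + e) * (s ^ l * φ (Fl l e))) =
      (ω z * z ^ (l + e)) * (s ^ l * φ (Fl l e)) := fun z _ => by ring
    rw [Finset.sum_congr rfl e1, ← Finset.sum_mul, this]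
    split_ifs <;> simp
  simp only [mul_sub, Finset.sum_sub_distrib] at hsum
  rw [L1, L2, L3] at hsum
  exact hsum

theorem czero [CharZero k] (K : Core h F v ξ m m') {c : k → k → k} (hc : CFun h v ξ m m' c)
    (hrat : ∃ d0 : ℤ, ∀ d ≤ d0, ∃ a b : ℤ, ∀ w, ∃ c, Good h w d a b c)
    {a b : k} (ha : a ≠ 0) (hb : b ≠ 0) (hab : a + b ≠ 0) : c a b = 0 := by
  have : Infinite k := CharZero.infinite k
  by_cases hn : m - m' = 1
  · obtain ⟨A, B, u, ψ, hg⟩ := K.Q6 hc hn hrat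
    have key := laurent_zero' (fun s => c 1 s) A B u ψ hg ?_ ?_ (b / a) (div_ne_zero hb ha) ?_
    · have q2 := K.Q2 hc (a := 1) (b := b / a) (r := a) one_ne_zero (div_ne_zero hb ha) ?_ ha
      · rw [mul_one, mul_div_cancel₀ _ ha] at q2
        rw [q2, key, mul_zero]
      · intro h; apply hab; field_simp at h; rw [h, mul_zero]
    · intro s hs0 hs1
      have hs1' : 1 + s ≠ 0 := fun h => hs1 (by linear_combination h)
      have hs2' : 1 + s⁻¹ ≠ 0 := fun h => hs1' (by field_simp at h; linear_combination h)
      have q2 := K.Q2 hc (a := 1) (b := s⁻¹) (r := s) one_ne_zero (inv_ne_zero hs0) hs2' hs0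
      rw [hn, zpow_one, mul_one, mul_inv_cancel₀ hs0] at q2
      beta_reduce
      rw [K.Q1 hc one_ne_zero hs0 hs1', q2]
    · intro s hs0 hs1
      have hs1' : 1 + s ≠ 0 := fun h => hs1 (by linear_combination h)
      beta_reduce
      rw [K.Q1 hc one_ne_zero hs0 hs1', K.Q3 hc hs0 one_ne_zero (by rwa [add_comm])]
      congr 1; ring
    · intro h; apply hab; field_simp at h; rw [h]; ring
  · exact (K.Q5 hc ((K.Q4 hc).resolve_right hn) ha hb hab).resolve_right hn

theorem mult [CharZero k] (K : Core h F v ξ m m')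
    (hrat : ∃ d0 : ℤ, ∀ d ≤ d0, ∃ a b : ℤ, ∀ w, ∃ c, Good h w d a b c)
    {x y : k} (hx0 : x ≠ 0) (hx1 : x ≠ 1) (hy0 : y ≠ 0) (hy1 : y ≠ 1) (hxy : x * y ≠ 1) (w : V) :
    h x (h y w) = h (x * y) w := by
  have : Infinite k := CharZero.infinite k
  obtain ⟨c, hc⟩ := K.ccc
  have h1 : 1 ≠ x * y := hxy.symm
  have h2 : x ≠ x * y := fun h => hy1 (mul_left_cancel₀ hx0 (by rw [mul_one]; exact h.symm))
  have := hc 1 x (x * y) one_ne_zero hx0 (mul_ne_zero hx0 hy0) hx1.symm h2 h1 w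
  rw [K.czero hc hrat (sub_ne_zero.2 hx1) (sub_ne_zero.2 h2.symm)
    (by rw [sub_add_sub_cancel']; exact sub_ne_zero.2 hxy)] at this
  simp only [Gp, div_one, mul_div_cancel_left₀ _ hx0, zero_mul, zero_smul, add_zero] at this
  exact this

end Core
end

section
variable {k G : Type} [Field k] [Group G]

theorem abstract_main [CharZero k] {η : k → G} {f : G} (R : GRel η f) (n : ℕ) :
    ∀ (V : Type) [AddCommGroup V] [Module k V] [FiniteDimensional k V]
    (ρ : G →* Module.End k V) (_ : GRep η f ρ) (_ : Module.finrank k V = n)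
    (x y : k), x ≠ 0 → x ≠ 1 → y ≠ 0 → y ≠ 1 → x * y ≠ 1 → ∀ w,
    ρ (η x) (ρ (η y) w) = ρ (η (x * y)) w := by
  induction n using Nat.strong_induction_on with
  | _ n ih =>
    intro V _ _ _ ρ P hn
    rcases subsingleton_or_nontrivial V with hs | hs
    · intros; exact Subsingleton.elim _ _
    obtain ⟨v, m, hv, hE, hf⟩ := A1 R P
    have hW := line_stable R hv hE hf
    obtain ⟨ξ, m', hξ, hξE, hξf⟩ := A2 R n V ρ P hn
    have hW' := ker_stable R hξE hξf
    obtain ⟨w1, hw1⟩ : ∃ w, ξ w ≠ 0 := by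
      by_contra hcon
      push Not at hcon
      exact hξ (LinearMap.ext hcon)
    have hξ0 : ∃ w, ξ w = 1 := ⟨(ξ w1)⁻¹ • w1, by simp [hw1]⟩
    obtain ⟨w0, hw0⟩ := hξ0
    have hlt : Module.finrank k (V ⧸ Submodule.span k {v}) < n := by
      have h1 := Submodule.finrank_quotient_add_finrank (Submodule.span k {v})
      rw [finrank_span_singleton hv] at h1
      omega
    have hlt' : Module.finrank k (LinearMap.ker ξ) < n := by
      rw [← hn]
      refine Submodule.finrank_lt fun h => hw1 ?_
      rw [← LinearMap.mem_ker, h]; trivial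
    have I1 := ih _ hlt _ _ (P.quot _ hW) rfl
    have I2 := ih _ hlt' _ _ (P.sub _ hW') rfl
    have K : Core (fun x => ρ (η x)) (ρ f) v ξ m m' := by
      refine ⟨R.hrel ρ, ?_, hE, hf, hξE, hξf, ?_, hv, ⟨w0, hw0⟩⟩
      · intro x h0 h1 h2 w
        simp only [← Module.End.mul_apply, ← map_mul]
        rw [← mul_assoc, R.r3 x h0 h1 h2]
      · intro x y hx0 hx1 hy0 hy1 hxy
        have j1 := I1 x y hx0 hx1 hy0 hy1 hxy (Submodule.mkQ _ w0)
        simp only [quotRep_mk] at j1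
        rw [← sub_eq_zero, ← map_sub, Submodule.mkQ_apply, Submodule.Quotient.mk_eq_zero,
          Submodule.mem_span_singleton] at j1
        obtain ⟨C, hC⟩ := j1
        refine ⟨C, fun w => ?_⟩
        have hk : w - ξ w • w0 ∈ LinearMap.ker ξ := by
          rw [LinearMap.mem_ker]; simp [hw0]
        have j2 := congrArg Subtype.val (I2 x y hx0 hx1 hy0 hy1 hxy ⟨_, hk⟩)
        simp only [subRep_coe] at j2
        simp only [map_sub, map_smul] at j2
        rw [mul_comm C, mul_smul, hC, smul_sub, ← sub_eq_zero]
        rw [← sub_eq_zero] at j2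
        rw [← j2]
        abel
    intro x y hx0 hx1 hy0 hy1 hxy w
    refine K.mult ?_ hx0 hx1 hy0 hy1 hxy w
    obtain ⟨d0, hd⟩ := P.rat
    refine ⟨d0, fun d hdd => ?_⟩
    obtain ⟨a, b, hab⟩ := hd d hdd
    refine ⟨a, b, fun w => ?_⟩
    obtain ⟨c, hc⟩ := hab w
    refine ⟨c, ?_⟩
    filter_upwards [ev_ne 0, ev_ne 1] with x h0 h1 using hc x h0 h1
end
end FEM

set_option linter.unusedSectionVars false
namespace FEM
open Filter

section
variable {k R K : Type} [Field k] [CommRing R] [IsDomain R] [Field K] [Algebra R K]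
  [IsFractionRing R K]

/-- `r` has value `c` under `ev` -/
def Val (ev : R →+* k) (r : K) (c : k) : Prop :=
  ∃ p q : R, ev q ≠ 0 ∧ r * algebraMap R K q = algebraMap R K p ∧ c * ev q = ev p

variable {ev : R →+* k}

theorem Val.uniq {r : K} {c c' : k} (h : Val ev r c) (h' : Val ev r c') : c = c' := by
  obtain ⟨p, q, hq, e1, e2⟩ := h
  obtain ⟨p', q', hq', e1', e2'⟩ := h'
  have e : p * q' = p' * q := by
    apply IsFractionRing.injective R K
    rw [map_mul, map_mul, ← e1, ← e1']
    ring
  have e3 := congrArg ev e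
  rw [map_mul, map_mul, ← e2, ← e2'] at e3
  apply mul_right_cancel₀ (mul_ne_zero hq hq')
  linear_combination e3

theorem Val.add {r s : K} {c d : k} (h : Val ev r c) (h' : Val ev s d) : Val ev (r + s) (c + d) := by
  obtain ⟨p, q, hq, e1, e2⟩ := h
  obtain ⟨p', q', hq', e1', e2'⟩ := h'
  refine ⟨p * q' + p' * q, q * q', by rw [map_mul]; exact mul_ne_zero hq hq', ?_, ?_⟩
  · rw [map_add, map_mul, map_mul, map_mul, ← e1, ← e1']; ring
  · rw [map_add, map_mul, map_mul, map_mul, ← e2, ← e2']; ring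

theorem Val.mul {r s : K} {c d : k} (h : Val ev r c) (h' : Val ev s d) : Val ev (r * s) (c * d) := by
  obtain ⟨p, q, hq, e1, e2⟩ := h
  obtain ⟨p', q', hq', e1', e2'⟩ := h'
  refine ⟨p * p', q * q', by rw [map_mul]; exact mul_ne_zero hq hq', ?_, ?_⟩
  · rw [map_mul, map_mul, ← e1, ← e1']; ring
  · rw [map_mul, map_mul, ← e2, ← e2']; ring

theorem Val.of (p : R) : Val ev (algebraMap R K p) (ev p) :=
  ⟨p, 1, by simp, by simp, by simp⟩

theorem Val.zero : Val ev (0 : K) 0 := by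
  simpa using Val.of (ev := ev) (K := K) 0

theorem Val.one : Val ev (1 : K) 1 := by
  simpa using Val.of (ev := ev) (K := K) 1

theorem Val.neg {r : K} {c : k} (h : Val ev r c) : Val ev (-r) (-c) := by
  have := (Val.of (ev := ev) (K := K) (-1)).mul h
  simpa using this

theorem Val.sub {r s : K} {c d : k} (h : Val ev r c) (h' : Val ev s d) :
    Val ev (r - s) (c - d) := by
  rw [sub_eq_add_neg, sub_eq_add_neg]
  exact h.add h'.neg

theorem Val.sum {ι : Type} (s : Finset ι) {r : ι → K} {c : ι → k} (h : ∀ i, Val ev (r i) (c i)) :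
    Val ev (∑ i ∈ s, r i) (∑ i ∈ s, c i) := by
  classical
  induction s using Finset.induction_on with
  | empty => simpa using Val.zero
  | insert a s ha ih => rw [Finset.sum_insert ha, Finset.sum_insert ha]; exact (h a).add ih

theorem Val.inv {r : K} {c : k} (h : Val ev r c) (hc : c ≠ 0) : Val ev r⁻¹ c⁻¹ := by
  obtain ⟨p, q, hq, e1, e2⟩ := h
  have hp : ev p ≠ 0 := by rw [← e2]; exact mul_ne_zero hc hq
  have hr : r ≠ 0 := by
    rintro rfl
    rw [zero_mul] at e1
    have : p = 0 := by
      apply IsFractionRing.injective R K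
      rw [← e1, map_zero]
    apply hp; rw [this, map_zero]
  refine ⟨q, p, hp, ?_, ?_⟩
  · rw [← e1]; field_simp
  · rw [← e2]; field_simp

def MVal {N : ℕ} (ev : R →+* k) (A : Matrix (Fin N) (Fin N) K) (B : Matrix (Fin N) (Fin N) k) :
    Prop := ∀ i j, Val ev (A i j) (B i j)

theorem MVal.mul {N : ℕ} {A A' : Matrix (Fin N) (Fin N) K} {B B' : Matrix (Fin N) (Fin N) k}
    (h : MVal ev A B) (h' : MVal ev A' B') : MVal ev (A * A') (B * B') := by
  intro i j
  rw [Matrix.mul_apply, Matrix.mul_apply]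
  exact Val.sum _ fun l => (h i l).mul (h' l j)

theorem MVal.uniq {N : ℕ} {A : Matrix (Fin N) (Fin N) K} {B B' : Matrix (Fin N) (Fin N) k}
    (h : MVal ev A B) (h' : MVal ev A B') : B = B' := by
  ext i j
  exact (h i j).uniq (h' i j)

theorem MVal.one {N : ℕ} : MVal ev (1 : Matrix (Fin N) (Fin N) K) (1 : Matrix (Fin N) (Fin N) k) := by
  intro i j
  rw [Matrix.one_apply, Matrix.one_apply]
  split_ifs
  · exact Val.one
  · exact Val.zero

theorem Val.poly {φ : RatFunc k →+* K} (hC : ∀ c : k, Val ev (φ (RatFunc.C c)) c) {t : k}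
    (hX : Val ev (φ RatFunc.X) t) (p : Polynomial k) :
    Val ev (φ (algebraMap (Polynomial k) (RatFunc k) p)) (p.eval t) := by
  induction p using Polynomial.induction_on' with
  | add p q hp hq => rw [map_add, map_add, Polynomial.eval_add]; exact hp.add hq
  | monomial n a =>
    rw [← Polynomial.C_mul_X_pow_eq_monomial, map_mul, map_pow, map_mul, map_pow,
      RatFunc.algebraMap_C, RatFunc.algebraMap_X, Polynomial.eval_mul, Polynomial.eval_C,
      Polynomial.eval_pow, Polynomial.eval_X]
    refine (hC a).mul ?_
    induction n with
    | zero => simpa using Val.one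
    | succ n ih => rw [pow_succ, pow_succ]; exact ih.mul hX

theorem Val.comp {φ : RatFunc k →+* K} (hC : ∀ c : k, Val ev (φ (RatFunc.C c)) c) {t : k}
    (hX : Val ev (φ RatFunc.X) t) (r : RatFunc k) (hd : r.denom.eval t ≠ 0) :
    Val ev (φ r) (RatFunc.eval (RingHom.id k) t r) := by
  have h1 := Val.poly hC hX r.num
  have h2 := Val.poly hC hX r.denom
  have h3 := h1.mul (h2.inv hd)
  have h4 : φ r = φ (algebraMap (Polynomial k) (RatFunc k) r.num) *
      (φ (algebraMap (Polynomial k) (RatFunc k) r.denom))⁻¹ := by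
    rw [← div_eq_mul_inv, ← map_div₀, RatFunc.num_div_denom]
  rw [h4, RatFunc.eval, div_eq_mul_inv]
  exact h3

end

section
open Polynomial
variable {k : Type} [Field k]

theorem dvd_of_roots [IsAlgClosed k] (q : k[X]) (hq : q ≠ 0)
    (h : ∀ a, q.eval a = 0 → a = 0 ∨ a = 1) : ∃ n : ℕ, q ∣ (X * (X - 1)) ^ n := by
  have hs := IsAlgClosed.splits q
  have hm : ∀ s : Multiset k, (∀ a ∈ s, a = 0 ∨ a = 1) →
      (s.map fun a => X - C a).prod ∣ (X * (X - 1)) ^ Multiset.card s := by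
    intro s
    induction s using Multiset.induction_on with
    | empty => intro; simp
    | cons a s ih =>
      intro hs
      rw [Multiset.map_cons, Multiset.prod_cons, Multiset.card_cons, pow_succ']
      refine mul_dvd_mul ?_ (ih fun b hb => hs b (Multiset.mem_cons_of_mem hb))
      rcases hs a (Multiset.mem_cons_self a s) with rfl | rfl
      · simp
      · simp
  refine ⟨Multiset.card q.roots, ?_⟩
  have := hs.eq_prod_roots
  conv_lhs => rw [this]
  rw [IsUnit.mul_left_dvd (isUnit_C.2 (isUnit_iff_ne_zero.2 (leadingCoeff_ne_zero.2 hq)))]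
  exact hm _ fun a ha => h a ((mem_roots hq).1 ha)

theorem taylor_sum (p : k[X]) (B n : ℕ) (hB : p.natDegree ≤ B) (x : k) (hx : x ≠ 1) :
    p.eval x * (x - 1) ^ (-(n : ℤ)) = ∑ l ∈ Finset.Icc (-(n : ℤ)) (B - n),
      (x - 1) ^ l * (p.comp (X + 1)).coeff (l + n).toNat := by
  have hx' : x - 1 ≠ 0 := sub_ne_zero.2 hx
  have h1 : p.eval x = (p.comp (X + 1)).eval (x - 1) := by simp [eval_comp]
  have h2 : (p.comp (X + 1)).natDegree < B + 1 := by
    have := natDegree_comp_le (p := p) (q := (X + 1 : k[X]))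
    have h3 : (X + 1 : k[X]).natDegree = 1 := natDegree_X_add_C 1
    rw [h3] at this
    omega
  rw [h1, eval_eq_sum_range' h2, Finset.sum_mul]
  refine Finset.sum_bij' (fun i _ => (i : ℤ) - n) (fun l _ => (l + n).toNat) ?_ ?_ ?_ ?_ ?_
  · intro i hi; rw [Finset.mem_range] at hi; rw [Finset.mem_Icc]; omega
  · intro i hi; rw [Finset.mem_Icc] at hi; rw [Finset.mem_range]; omega
  · intro i hi; simp
  · intro i hi; rw [Finset.mem_Icc] at hi; omega
  · intro i hi
    rw [sub_add_cancel, Int.toNat_natCast, sub_eq_add_neg (i : ℤ), zpow_add₀ hx', zpow_natCast]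
    ring
end
end FEM

namespace FEM
open Filter

section
variable {k : Type} [Field k] {N : ℕ}

/-- values -/
noncomputable def hv (h : Matrix (Fin N) (Fin N) (RatFunc k)) (t : k) : Matrix (Fin N) (Fin N) k :=
  fun i j => RatFunc.eval (RingHom.id k) t (h i j)

def Reg (h : Matrix (Fin N) (Fin N) (RatFunc k)) (t : k) : Prop :=
  ∀ i j, (h i j).denom.eval t ≠ 0

theorem Reg.ev (h : Matrix (Fin N) (Fin N) (RatFunc k)) : ∀ᶠ t in cofinite, Reg h t := by
  classical
  unfold Reg
  rw [Filter.eventually_all]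
  intro i
  rw [Filter.eventually_all]
  intro j
  rw [Filter.eventually_cofinite]
  refine ((h i j).denom.roots.toFinset.finite_toSet).subset fun t ht => ?_
  simp only [ne_eq, not_not, Set.mem_ofPred_eq] at ht
  simp only [SetLike.mem_coe, Multiset.mem_toFinset]
  exact (Polynomial.mem_roots (RatFunc.denom_ne_zero _)).2 ht

theorem MVal.comp {R K : Type} [CommRing R] [IsDomain R] [Field K] [Algebra R K]
    [IsFractionRing R K] {ev : R →+* k} {φ : RatFunc k →+* K}
    (hC : ∀ c : k, Val ev (φ (RatFunc.C c)) c) {t : k}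
    (hX : Val ev (φ RatFunc.X) t) {h : Matrix (Fin N) (Fin N) (RatFunc k)} (hr : Reg h t) :
    MVal ev (h.map φ) (hv h t) := fun i j => Val.comp hC hX (h i j) (hr i j)

theorem val_C1 (a : k) (c : k) :
    Val (Polynomial.evalRingHom a) ((RatFunc.C c : RatFunc k)) c := by
  have := Val.of (K := RatFunc k) (ev := Polynomial.evalRingHom a) (Polynomial.C c)
  simpa using this

theorem val_X1 (a : k) : Val (Polynomial.evalRingHom a) (RatFunc.X : RatFunc k) a := by
  have := Val.of (K := RatFunc k) (ev := Polynomial.evalRingHom a) (Polynomial.X)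
  simpa using this

theorem MVal.id {h : Matrix (Fin N) (Fin N) (RatFunc k)} {t : k} (hr : Reg h t) :
    MVal (Polynomial.evalRingHom t) h (hv h t) := by
  have := MVal.comp (φ := RingHom.id (RatFunc k)) (val_C1 t) (val_X1 t) hr
  simpa using this

theorem hv_unit {h hinv : Matrix (Fin N) (Fin N) (RatFunc k)} (hu : h * hinv = 1) {t : k}
    (h1 : Reg h t) (h2 : Reg hinv t) : hv h t * hv hinv t = 1 := by
  have := (MVal.id h1).mul (MVal.id h2)
  rw [hu] at this
  exact this.uniq MVal.one

theorem val_C2 (a b : k) (c : k) :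
    Val (MvPolynomial.eval ![a, b]) (algebraMap k (FractionRing (MvPolynomial (Fin 2) k)) c) c := by
  have := Val.of (K := FractionRing (MvPolynomial (Fin 2) k)) (ev := MvPolynomial.eval ![a, b])
    (MvPolynomial.C c)
  rw [MvPolynomial.eval_C] at this
  exact this

theorem val_X2 (a b : k) (i : Fin 2) :
    Val (MvPolynomial.eval ![a, b]) (algebraMap (MvPolynomial (Fin 2) k)
      (FractionRing (MvPolynomial (Fin 2) k)) (MvPolynomial.X i)) (![a, b] i) := by
  have := Val.of (K := FractionRing (MvPolynomial (Fin 2) k)) (ev := MvPolynomial.eval ![a, b])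
    (MvPolynomial.X i)
  rwa [MvPolynomial.eval_X] at this

open Polynomial in
theorem no_poles [CharZero k] [IsAlgClosed k] {h hinv : Matrix (Fin N) (Fin N) (RatFunc k)}
    (hu : h * hinv = 1)
    (α β γ δ : RatFunc k →+* FractionRing (MvPolynomial (Fin 2) k))
    (hαC : ∀ c : k, α (RatFunc.C c) = algebraMap k (FractionRing (MvPolynomial (Fin 2) k)) c)
    (hβC : ∀ c : k, β (RatFunc.C c) = algebraMap k (FractionRing (MvPolynomial (Fin 2) k)) c)
    (hγC : ∀ c : k, γ (RatFunc.C c) = algebraMap k (FractionRing (MvPolynomial (Fin 2) k)) c)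
    (hδC : ∀ c : k, δ (RatFunc.C c) = algebraMap k (FractionRing (MvPolynomial (Fin 2) k)) c)
    (hα : ∀ a b : k, Val (MvPolynomial.eval ![a, b]) (α RatFunc.X) a)
    (hβ : ∀ a b : k, Val (MvPolynomial.eval ![a, b]) (β RatFunc.X) b)
    (hγ : ∀ a b : k, Val (MvPolynomial.eval ![a, b]) (γ RatFunc.X) (a * b - a + 1))
    (hδ : ∀ a b : k, a * b - a + 1 ≠ 0 →
      Val (MvPolynomial.eval ![a, b]) (δ RatFunc.X) (a * b / (a * b - a + 1)))
    (heq2 : h.map ⇑α * h.map ⇑β = h.map ⇑γ * h.map ⇑δ) :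
    ∃ (n : ℕ) (P : Fin N → Fin N → k[X]), ∀ i j,
      algebraMap k[X] (RatFunc k) (P i j) =
        algebraMap k[X] (RatFunc k) ((X * (X - 1)) ^ n) * h i j := by
  classical
  have hinf : Infinite k := CharZero.infinite k
  let I : k[X] → Prop := fun q => q ≠ 0 ∧ ∀ i j, ∃ p : k[X], algebraMap k[X] (RatFunc k) p =
        algebraMap k[X] (RatFunc k) q * h i j
  have hex : ∃ d : ℕ, ∃ q, I q ∧ q.natDegree = d := by
    obtain ⟨b, hb⟩ := IsLocalization.exist_integer_multiples_of_finite (nonZeroDivisors k[X])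
      (fun ij : Fin N × Fin N => h ij.1 ij.2)
    refine ⟨_, b, ⟨nonZeroDivisors.coe_ne_zero b, fun i j => ?_⟩, rfl⟩
    obtain ⟨p, hp⟩ := hb (i, j)
    refine ⟨p, ?_⟩
    rw [hp, Algebra.smul_def]
  obtain ⟨q, ⟨hq0, hq⟩, hqd⟩ := Nat.find_spec hex
  have hmin : ∀ q', I q' → q.natDegree ≤ q'.natDegree := by
    intro q' hq'
    rw [hqd]
    exact Nat.find_min' hex ⟨q', hq', rfl⟩
  choose P hP using hq
  have hroots : ∀ a, q.eval a = 0 → a = 0 ∨ a = 1 := by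
    intro p0 hp0
    by_contra hcon
    push Not at hcon
    obtain ⟨n0, n1⟩ := hcon
    have n1' : p0 - 1 ≠ 0 := sub_ne_zero.2 n1
    have inj1 : Function.Injective (fun b : k => p0 * b - p0 + 1) := by
      intro x y hxy
      exact mul_left_cancel₀ n0 (sub_left_injective (add_right_cancel hxy))
    have inj2 : Function.Injective (fun b : k => 1 + (p0 - 1) * (p0 * b - p0 + 1)⁻¹) := by
      intro x y hxy
      exact inj1 (inv_injective (mul_left_cancel₀ n1' (add_left_cancel hxy)))
    obtain ⟨b, ⟨b1, b2, b3, b4, b5⟩⟩ := ((Reg.ev h).and ((Reg.ev hinv).and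
      ((ev_comp (Reg.ev h) inj1).and ((ev_comp (Reg.ev h) inj2).and
      (ev_comp (ev_ne 0) inj1))))).exists
    have e4 : p0 * b / (p0 * b - p0 + 1) = 1 + (p0 - 1) * (p0 * b - p0 + 1)⁻¹ := by
      have b5' : p0 * b - p0 + 1 ≠ 0 := b5
      rw [div_eq_iff b5', add_mul, mul_assoc, inv_mul_cancel₀ b5']; ring
    rw [← e4] at b4
    set ev := MvPolynomial.eval ![p0, b] with hev
    let Pm : Matrix (Fin N) (Fin N) (RatFunc k) := fun i j => algebraMap k[X] (RatFunc k) (P i j)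
    let P0 : Matrix (Fin N) (Fin N) k := fun i j => (P i j).eval p0
    have v1 : MVal ev (Pm.map α) P0 := fun i j =>
      Val.poly (fun c => by rw [hαC]; exact val_C2 p0 b c) (hα p0 b) (P i j)
    have v2 : MVal ev (h.map β) (hv h b) :=
      MVal.comp (fun c => by rw [hβC]; exact val_C2 p0 b c) (hβ p0 b) b1
    have v3 : MVal ev (h.map γ) (hv h (p0 * b - p0 + 1)) :=
      MVal.comp (fun c => by rw [hγC]; exact val_C2 p0 b c) (hγ p0 b) b3
    have v4 : MVal ev (h.map δ) (hv h (p0 * b / (p0 * b - p0 + 1))) :=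
      MVal.comp (fun c => by rw [hδC]; exact val_C2 p0 b c) (hδ p0 b b5) b4
    have v5 : Val ev (α (algebraMap k[X] (RatFunc k) q)) 0 := by
      rw [← hp0]
      exact Val.poly (fun c => by rw [hαC]; exact val_C2 p0 b c) (hα p0 b) q
    have e5 : Pm.map α * h.map β = α (algebraMap k[X] (RatFunc k) q) • (h.map γ * h.map δ) := by
      rw [← heq2, ← Matrix.smul_mul]
      congr 1
      ext i j
      change α (algebraMap k[X] (RatFunc k) (P i j)) = α (algebraMap k[X] (RatFunc k) q) * α (h i j)
      rw [hP, map_mul]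
    have z : P0 * hv h b = 0 := by
      have w1 := v1.mul v2
      rw [e5] at w1
      refine w1.uniq fun i j => ?_
      have := v5.mul ((v3.mul v4) i j)
      rw [zero_mul] at this
      exact this
    have z0 : P0 = 0 := by
      have := congrArg (fun M => M * hv hinv b) z
      simpa [mul_assoc, hv_unit hu b1 b2] using this
    obtain ⟨q1, hq1⟩ := dvd_iff_isRoot.2 hp0
    have hP1 : ∀ i j, X - C p0 ∣ P i j := fun i j => dvd_iff_isRoot.2 (congrFun (congrFun z0 i) j)
    have hq10 : q1 ≠ 0 := by rintro rfl; exact hq0 (by rw [hq1, mul_zero])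
    have hI1 : I q1 := by
      refine ⟨hq10, fun i j => ?_⟩
      obtain ⟨p1, hp1⟩ := hP1 i j
      refine ⟨p1, ?_⟩
      have := hP i j
      rw [hp1, hq1, map_mul, map_mul, mul_assoc] at this
      refine mul_left_cancel₀ ?_ this
      exact RatFunc.algebraMap_ne_zero (X_sub_C_ne_zero p0)
    have := hmin q1 hI1
    rw [hq1, natDegree_mul (X_sub_C_ne_zero p0) hq10, natDegree_X_sub_C] at this
    omega
  obtain ⟨n, g, hg⟩ := dvd_of_roots q hq0 hroots
  refine ⟨n, fun i j => g * P i j, fun i j => ?_⟩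
  rw [hg, map_mul, map_mul, hP]
  ring

open Polynomial in
theorem reg_of {h : Matrix (Fin N) (Fin N) (RatFunc k)} {n : ℕ} {P : Fin N → Fin N → k[X]}
    (hP : ∀ i j, algebraMap k[X] (RatFunc k) (P i j) =
        algebraMap k[X] (RatFunc k) ((X * (X - 1)) ^ n) * h i j) {a : k} (h0 : a ≠ 0) (h1 : a ≠ 1) :
    Reg h a ∧ ∀ i j, hv h a i j = (P i j).eval a * (a ^ (-(n : ℤ)) * (a - 1) ^ (-(n : ℤ))) := by
  have h1' : a - 1 ≠ 0 := sub_ne_zero.2 h1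
  have hne : ((X * (X - 1)) ^ n : k[X]) ≠ 0 :=
    pow_ne_zero _ (mul_ne_zero X_ne_zero (X_sub_C_ne_zero 1))
  have hr : Reg h a := by
    intro i j hd
    have e : h i j = algebraMap k[X] (RatFunc k) (P i j) /
        algebraMap k[X] (RatFunc k) ((X * (X - 1)) ^ n) := by
      rw [hP, mul_div_cancel_left₀]
      exact RatFunc.algebraMap_ne_zero hne
    have hdv : (h i j).denom ∣ (X * (X - 1)) ^ n := by
      rw [e]
      exact RatFunc.denom_div_dvd _ _
    have := eval_dvd (x := a) hdv
    rw [hd, zero_dvd_iff] at this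
    simp [h0, h1'] at this
  refine ⟨hr, fun i j => ?_⟩
  have v1 := Val.poly (φ := RingHom.id (RatFunc k)) (val_C1 a) (val_X1 a) (P i j)
  have v2 := Val.poly (φ := RingHom.id (RatFunc k)) (val_C1 a) (val_X1 a) ((X * (X - 1)) ^ n)
  have v3 := v2.mul (MVal.id hr i j)
  rw [RingHom.id_apply] at v1 v3
  rw [← hP] at v3
  have := v1.uniq v3
  rw [this]
  simp only [eval_pow, eval_mul, eval_X, eval_sub, eval_one, zpow_neg, zpow_natCast, mul_pow]
  field_simp
end
end FEM

namespace FEM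
open Filter

section
open Polynomial
variable {k : Type} [Field k] {N : ℕ}

theorem group_main [CharZero k] {n : ℕ} {P : Fin N → Fin N → k[X]}
    (η : k → (Matrix (Fin N) (Fin N) k)ˣ) (f : (Matrix (Fin N) (Fin N) k)ˣ)
    (hP : ∀ a, a ≠ 0 → a ≠ 1 → ∀ i j, (η a : Matrix (Fin N) (Fin N) k) i j =
      (P i j).eval a * (a ^ (-(n : ℤ)) * (a - 1) ^ (-(n : ℤ))))
    (r1 : ∀ x : k, x ≠ 0 → x ≠ 1 → η x * η x⁻¹ = 1)
    (r2 : ∀ x y : k, x ≠ 0 → x ≠ 1 → y ≠ 0 → y ≠ 1 → x * y - x + 1 ≠ 0 →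
      η x * η y = η (x * y - x + 1) * η (x * y / (x * y - x + 1)))
    (r3 : ∀ x : k, x ≠ 0 → x ≠ 1 → 2 * x - 1 ≠ 0 → η x * η (2 - x⁻¹) * f = f * η (2 * x - 1))
    (r4 : ∀ u ∈ Subgroup.closure {g | ∃ x : k, x ≠ 0 ∧ x ≠ 1 ∧ g = η x},
      f⁻¹ * u * f ∈ Subgroup.closure {g | ∃ x : k, x ≠ 0 ∧ x ≠ 1 ∧ g = η x})
    (e1 : ∀ x, x = 0 ∨ x = 1 → η x = 1)
    (hfuni : ((f : Matrix (Fin N) (Fin N) k) - 1) ^ N = 0)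
    (x y : k) (x0 : x ≠ 0) (x1 : x ≠ 1) (y0 : y ≠ 0) (y1 : y ≠ 1) (xy : x * y ≠ 1) :
    η x * η y = η (x * y) := by
  classical
  set S : Set (Matrix (Fin N) (Fin N) k)ˣ := {g | ∃ x : k, x ≠ 0 ∧ x ≠ 1 ∧ g = η x} with hS
  set T := Subgroup.closure (S ∪ {f}) with hT
  have hη : ∀ x, η x ∈ T := by
    intro x
    by_cases hx : x = 0 ∨ x = 1
    · rw [e1 x hx]; exact T.one_mem
    · push Not at hx
      exact Subgroup.subset_closure (Or.inl ⟨x, hx.1, hx.2, rfl⟩)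
  have hf : f ∈ T := Subgroup.subset_closure (Or.inr rfl)
  let η' : k → T := fun x => ⟨η x, hη x⟩
  let f' : T := ⟨f, hf⟩
  have himg : T.subtype '' {g : T | ∃ x : k, x ≠ 0 ∧ x ≠ 1 ∧ g = η' x} = S := by
    ext g
    constructor
    · rintro ⟨_, ⟨x, a, b, rfl⟩, rfl⟩
      exact ⟨x, a, b, rfl⟩
    · rintro ⟨x, a, b, rfl⟩
      exact ⟨η' x, ⟨x, a, b, rfl⟩, rfl⟩
  have hmem : ∀ u : T, u ∈ Subgroup.closure {g : T | ∃ x : k, x ≠ 0 ∧ x ≠ 1 ∧ g = η' x} ↔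
      (u : (Matrix (Fin N) (Fin N) k)ˣ) ∈ Subgroup.closure S := by
    intro u
    rw [← himg, ← MonoidHom.map_closure]
    exact (Subgroup.mem_map_iff_mem T.subtype_injective).symm
  have R : GRel η' f' := by
    refine ⟨fun x a b => Subtype.ext (r1 x a b),
      fun x y a b c d e => Subtype.ext (r2 x y a b c d e),
      fun x a b c => Subtype.ext (r3 x a b c), fun u hu => ?_, ?_⟩
    · rw [hmem] at hu ⊢
      exact r4 _ hu
    · have := Subgroup.closure_closure_coe_preimage (k := S ∪ {f})
      rw [← this]
      congr 1
      ext u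
      constructor
      · rintro (⟨x, a, b, rfl⟩ | rfl)
        · exact Or.inl ⟨x, a, b, rfl⟩
        · exact Or.inr rfl
      · rintro (⟨x, a, b, c⟩ | c)
        · exact Or.inl ⟨x, a, b, Subtype.ext c⟩
        · exact Or.inr (Subtype.ext c)
  let ρ : T →* Module.End k (Fin N → k) :=
    ((Matrix.toLinAlgEquiv' : Matrix (Fin N) (Fin N) k ≃ₐ[k] _) :
      Matrix (Fin N) (Fin N) k →* Module.End k (Fin N → k)).comp
      ((Units.coeHom _).comp T.subtype)
  have hρ : ∀ (u : T) w, ρ u w = ((u : (Matrix (Fin N) (Fin N) k)ˣ) :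
      Matrix (Fin N) (Fin N) k).mulVec w := fun u w => rfl
  have Q : GRep η' f' ρ := by
    constructor
    · refine ⟨N, ?_⟩
      have : ρ f' - 1 = Matrix.toLinAlgEquiv' ((f : Matrix (Fin N) (Fin N) k) - 1) := by
        rw [map_sub, map_one]; rfl
      rw [this, ← map_pow, hfuni, map_zero]
    · refine ⟨-(n : ℤ), fun d hd => ?_⟩
      obtain ⟨e, he⟩ : ∃ e : ℕ, -(n : ℤ) = d + e := ⟨(-n - d).toNat, by omega⟩
      let p : Fin N → Fin N → k[X] := fun i j => X ^ e * P i j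
      let B : ℕ := ∑ i, ∑ j, (p i j).natDegree
      have hB : ∀ i j, (p i j).natDegree ≤ B := fun i j =>
        (Finset.single_le_sum (f := fun j => (p i j).natDegree) (fun _ _ => Nat.zero_le _)
          (Finset.mem_univ j)).trans
        (Finset.single_le_sum (f := fun i => ∑ j, (p i j).natDegree) (fun _ _ => Nat.zero_le _)
          (Finset.mem_univ i))
      refine ⟨-(n : ℤ), B - n, fun w => ⟨fun l i => ∑ j,
        ((p i j).comp (X + 1)).coeff (l + n).toNat * w j, fun x x0 x1 => ?_⟩⟩
      rw [hρ]
      ext i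
      rw [Pi.smul_apply, Finset.sum_apply]
      simp only [Pi.smul_apply, smul_eq_mul, Matrix.mulVec, dotProduct]
      have : ∀ j, (η x : Matrix (Fin N) (Fin N) k) i j =
          x ^ d * ∑ l ∈ Finset.Icc (-(n : ℤ)) (B - n),
      (x - 1) ^ l * ((p i j).comp (X + 1)).coeff (l + n).toNat := by
        intro j
        rw [← taylor_sum (p i j) B n (hB i j) x x1, hP x x0 x1, he, zpow_add₀ x0, ← he]
        simp only [p, eval_mul, eval_pow, eval_X, zpow_natCast]
        ring
      calc ∑ j, (η x : Matrix (Fin N) (Fin N) k) i j * w j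
          = ∑ j, x ^ d * ∑ l ∈ Finset.Icc (-(n : ℤ)) (B - n),
            (x - 1) ^ l * (((p i j).comp (X + 1)).coeff (l + n).toNat * w j) := by
            refine Finset.sum_congr rfl fun j _ => ?_
            rw [this, mul_assoc, Finset.sum_mul]
            simp only [mul_assoc]
        _ = _ := by
            rw [← Finset.mul_sum, Finset.sum_comm]
            simp only [Finset.mul_sum]
  have main := abstract_main R _ (Fin N → k) ρ Q rfl x y x0 x1 y0 y1 xy
  apply Units.ext
  rw [Units.val_mul]
  apply Matrix.mulVec_injective
  funext w
  rw [← Matrix.mulVec_mulVec]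
  exact main w

theorem matrix_main [CharZero k] {n : ℕ} {P : Fin N → Fin N → k[X]}
    (hval : k → Matrix (Fin N) (Fin N) k) (f : (Matrix (Fin N) (Fin N) k)ˣ)
    (hP : ∀ a, a ≠ 0 → a ≠ 1 → ∀ i j, hval a i j =
      (P i j).eval a * (a ^ (-(n : ℤ)) * (a - 1) ^ (-(n : ℤ))))
    (r1 : ∀ x : k, x ≠ 0 → x ≠ 1 → hval x * hval x⁻¹ = 1)
    (r2 : ∀ x y : k, x ≠ 0 → x ≠ 1 → y ≠ 0 → y ≠ 1 → x * y - x + 1 ≠ 0 →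
      hval x * hval y = hval (x * y - x + 1) * hval (x * y / (x * y - x + 1)))
    (r3 : ∀ x : k, x ≠ 0 → x ≠ 1 → 2 * x - 1 ≠ 0 →
      hval x * hval (2 - x⁻¹) * (f : Matrix (Fin N) (Fin N) k) = f * hval (2 * x - 1))
    (Hgrp : Subgroup (Matrix (Fin N) (Fin N) k)ˣ)
    (hHdef : Hgrp = Subgroup.closure
      {u : (Matrix (Fin N) (Fin N) k)ˣ | ∃ a : k, a ≠ 0 ∧ a ≠ 1 ∧
        (u : Matrix (Fin N) (Fin N) k) = hval a})
    (r4 : ∀ u ∈ Hgrp, f⁻¹ * u * f ∈ Hgrp)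
    (hfuni : ((f : Matrix (Fin N) (Fin N) k) - 1) ^ N = 0)
    (x y : k) (x0 : x ≠ 0) (x1 : x ≠ 1) (y0 : y ≠ 0) (y1 : y ≠ 1) (xy : x * y ≠ 1) :
    hval x * hval y = hval (x * y) := by
  classical
  have r1' : ∀ x : k, x ≠ 0 → x ≠ 1 → hval x⁻¹ * hval x = 1 := by
    intro x a b
    have := r1 x⁻¹ (inv_ne_zero a) (by rwa [Ne, inv_eq_one])
    rwa [inv_inv] at this
  let η : k → (Matrix (Fin N) (Fin N) k)ˣ := fun x =>
    if hx : x ≠ 0 ∧ x ≠ 1 then ⟨hval x, hval x⁻¹, r1 x hx.1 hx.2, r1' x hx.1 hx.2⟩ else 1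
  have hη : ∀ x, x ≠ 0 → x ≠ 1 → (η x : Matrix (Fin N) (Fin N) k) = hval x := by
    intro x a b
    simp only [η, dif_pos (And.intro a b)]
  have hs : {u : (Matrix (Fin N) (Fin N) k)ˣ | ∃ a : k, a ≠ 0 ∧ a ≠ 1 ∧
        (u : Matrix (Fin N) (Fin N) k) = hval a} = {g | ∃ x : k, x ≠ 0 ∧ x ≠ 1 ∧ g = η x} := by
    ext u
    constructor
    · rintro ⟨a, a0, a1, h⟩
      exact ⟨a, a0, a1, Units.ext (by rw [h, hη a a0 a1])⟩
    · rintro ⟨a, a0, a1, rfl⟩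
      exact ⟨a, a0, a1, hη a a0 a1⟩
  rw [hs] at hHdef
  have m := group_main (n := n) (P := P) η f (fun a a0 a1 i j => by rw [hη a a0 a1]; exact hP a a0 a1 i j)
    (fun x a b => Units.ext (by
      rw [Units.val_mul, hη _ a b, hη _ (inv_ne_zero a) (by rwa [Ne, inv_eq_one])]
      exact r1 x a b))
    (fun x y x0 x1 y0 y1 d => Units.ext (by
      have n1 : x * y - x + 1 ≠ 1 := by
        intro h
        apply mul_ne_zero x0 (sub_ne_zero.2 y1)
        linear_combination h
      have n2 : x * y / (x * y - x + 1) ≠ 1 := by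
        intro h
        rw [div_eq_one_iff_eq d] at h
        apply x1
        linear_combination h
      rw [Units.val_mul, Units.val_mul, hη _ x0 x1, hη _ y0 y1, hη _ d n1,
        hη _ (div_ne_zero (mul_ne_zero x0 y0) d) n2]
      exact r2 x y x0 x1 y0 y1 d))
    (fun x x0 x1 d => Units.ext (by
      have n1 : 2 * x - 1 ≠ 1 := by
        intro h
        apply x1
        have h2 : (2 : k) ≠ 0 := two_ne_zero
        apply mul_left_cancel₀ h2
        linear_combination h
      have n2 : 2 - x⁻¹ ≠ 0 := by
        intro h
        apply d
        have : x * x⁻¹ = 1 := mul_inv_cancel₀ x0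
        linear_combination x * h + this
      have n3 : 2 - x⁻¹ ≠ 1 := by
        intro h
        apply x1
        have : x * x⁻¹ = 1 := mul_inv_cancel₀ x0
        linear_combination x * h + this
      rw [Units.val_mul, Units.val_mul, Units.val_mul, hη _ x0 x1, hη _ n2 n3, hη _ d n1]
      exact r3 x x0 x1 d))
    (by rw [← hHdef]; exact r4)
    (fun x hx => dif_neg (by tauto)) hfuni x y x0 x1 y0 y1 xy
  have := congrArg Units.val m
  rwa [Units.val_mul, hη _ x0 x1, hη _ y0 y1, hη _ (mul_ne_zero x0 y0) xy] at this
end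

theorem generic_zero {k : Type} [Field k] [CharZero k] (r : FractionRing (MvPolynomial (Fin 2) k))
    (h : ∀ x y : k, x ≠ 0 → x ≠ 1 → y ≠ 0 → y ≠ 1 → x * y ≠ 1 →
      Val (MvPolynomial.eval ![x, y]) r 0) : r = 0 := by
  have hinf : Infinite k := CharZero.infinite k
  obtain ⟨p, q, hq, e⟩ := IsFractionRing.div_surjective (A := MvPolynomial (Fin 2) k) r
  have hq0 : q ≠ 0 := nonZeroDivisors.ne_zero hq
  let s : MvPolynomial (Fin 2) k := MvPolynomial.X 0 * (MvPolynomial.X 0 - 1) *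
    (MvPolynomial.X 1 * (MvPolynomial.X 1 - 1)) * (MvPolynomial.X 0 * MvPolynomial.X 1 - 1)
  have hs : s ≠ 0 := by
    intro hs
    have := congrArg (MvPolynomial.eval ![(2 : k), 2]) hs
    simp [s] at this
    norm_num at this
  have hz : p * (q * s) = 0 := by
    apply MvPolynomial.funext
    intro v
    obtain ⟨x, y, rfl⟩ : ∃ x y, v = ![x, y] := ⟨v 0, v 1, by ext i; fin_cases i <;> rfl⟩
    rw [map_mul, map_mul, map_zero]
    by_cases hqv : MvPolynomial.eval ![x, y] q = 0
    · rw [hqv]; ring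
    by_cases hsv : MvPolynomial.eval ![x, y] s = 0
    · rw [hsv]; ring
    have hsv' : x * (x - 1) * (y * (y - 1)) * (x * y - 1) ≠ 0 := by
      simpa only [s, map_mul, map_sub, map_one, MvPolynomial.eval_X, Matrix.cons_val_zero,
        Matrix.cons_val_one] using hsv
    have c1 := left_ne_zero_of_mul hsv'
    have c2 := right_ne_zero_of_mul hsv'
    have c3 := left_ne_zero_of_mul c1
    have c4 := right_ne_zero_of_mul c1
    have v1 := h x y (left_ne_zero_of_mul c3) (sub_ne_zero.1 (right_ne_zero_of_mul c3))
      (left_ne_zero_of_mul c4) (sub_ne_zero.1 (right_ne_zero_of_mul c4)) (sub_ne_zero.1 c2)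
    have v2 := v1.mul (Val.of (K := FractionRing (MvPolynomial (Fin 2) k)) q)
    have v3 : r * algebraMap _ (FractionRing (MvPolynomial (Fin 2) k)) q = algebraMap _ _ p := by
      rw [← e, div_mul_cancel₀]
      intro h0
      apply hq0
      apply IsFractionRing.injective _ (FractionRing (MvPolynomial (Fin 2) k))
      rw [h0, map_zero]
    rw [v3, zero_mul] at v2
    rw [← v2.uniq (Val.of p), zero_mul]
  have hp : p = 0 := by
    rcases mul_eq_zero.1 hz with h | h
    · exact h
    · exact absurd h (mul_ne_zero hq0 hs)
  rw [← e, hp, map_zero, zero_div]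
end FEM


open FEM
/-- **Multiplicativity criterion.**
Let `k` be an algebraically closed field of characteristic zero and `h ∈ GL_N(k(t))` with
`h(x⁻¹) = h(x)⁻¹` and `h(x)·h(y) = h(xy−x+1)·h(xy·(xy−x+1)⁻¹)`.  Suppose `f ∈ GL_N(k)` is
unipotent, normalizes the subgroup generated by the values of `h`, and
`h(x)·h(2−x⁻¹) = f·h(2x−1)·f⁻¹`.  Then `h(x)·h(y) = h(xy)` in `GL_N(k(x,y))`
(here `k(x,y)` is the fraction field of `MvPolynomial (Fin 2) k`, `x = X 0`, `y = X 1`,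
and `α, β, γ, δ, μ : k(t) → k(x,y)` are the embeddings sending `t` to `x`, `y`, `xy−x+1`,
`xy(xy−x+1)⁻¹`, `xy` respectively, while `inv, η₁, η₂` are the endomorphisms of `k(t)`
with `t ↦ t⁻¹`, `t ↦ 2−t⁻¹`, `t ↦ 2t−1`). -/
theorem functional_equation_multiplicative
    (k : Type) [Field k] [CharZero k] [IsAlgClosed k] (N : ℕ) (hN : 1 ≤ N)
    (h hinv : Matrix (Fin N) (Fin N) (RatFunc k))
    (hunit : h * hinv = 1 ∧ hinv * h = 1)
    (inv η₁ η₂ : RatFunc k →+* RatFunc k)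
    (hinvC : ∀ c : k, inv (RatFunc.C c) = RatFunc.C c)
    (hinvX : inv RatFunc.X = RatFunc.X⁻¹)
    (hη₁C : ∀ c : k, η₁ (RatFunc.C c) = RatFunc.C c)
    (hη₁X : η₁ RatFunc.X = 2 - RatFunc.X⁻¹)
    (hη₂C : ∀ c : k, η₂ (RatFunc.C c) = RatFunc.C c)
    (hη₂X : η₂ RatFunc.X = 2 * RatFunc.X - 1)
    (α β γ δ μ : RatFunc k →+* FractionRing (MvPolynomial (Fin 2) k))
    (hαC : ∀ c : k, α (RatFunc.C c) = algebraMap k (FractionRing (MvPolynomial (Fin 2) k)) c)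
    (hβC : ∀ c : k, β (RatFunc.C c) = algebraMap k (FractionRing (MvPolynomial (Fin 2) k)) c)
    (hγC : ∀ c : k, γ (RatFunc.C c) = algebraMap k (FractionRing (MvPolynomial (Fin 2) k)) c)
    (hδC : ∀ c : k, δ (RatFunc.C c) = algebraMap k (FractionRing (MvPolynomial (Fin 2) k)) c)
    (hμC : ∀ c : k, μ (RatFunc.C c) = algebraMap k (FractionRing (MvPolynomial (Fin 2) k)) c)
    (hαX : α RatFunc.X
      = algebraMap (MvPolynomial (Fin 2) k) (FractionRing (MvPolynomial (Fin 2) k))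
          (MvPolynomial.X 0))
    (hβX : β RatFunc.X
      = algebraMap (MvPolynomial (Fin 2) k) (FractionRing (MvPolynomial (Fin 2) k))
          (MvPolynomial.X 1))
    (hγX : γ RatFunc.X = α RatFunc.X * β RatFunc.X - α RatFunc.X + 1)
    (hδX : δ RatFunc.X = α RatFunc.X * β RatFunc.X * (γ RatFunc.X)⁻¹)
    (hμX : μ RatFunc.X = α RatFunc.X * β RatFunc.X)
    (heq1 : h.map ⇑inv = hinv)
    (heq2 : h.map ⇑α * h.map ⇑β = h.map ⇑γ * h.map ⇑δ)
    -- the values of `h` and the subgroup they generate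
    (hval : k → Matrix (Fin N) (Fin N) k)
    (hhval : ∀ (a : k) (i j : Fin N), hval a i j = RatFunc.eval (RingHom.id k) a (h i j))
    (Hgrp : Subgroup (Matrix (Fin N) (Fin N) k)ˣ)
    (hHdef : Hgrp = Subgroup.closure
      {u : (Matrix (Fin N) (Fin N) k)ˣ | ∃ a : k, a ≠ 0 ∧ a ≠ 1 ∧ (u : Matrix (Fin N) (Fin N) k) = hval a})
    -- the unipotent matrix `f` normalizing `H`
    (f : (Matrix (Fin N) (Fin N) k)ˣ)
    (hfuni : ((f : Matrix (Fin N) (Fin N) k) - 1) ^ N = 0)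
    (hfnorm : ∀ u ∈ Hgrp, f * u * f⁻¹ ∈ Hgrp ∧ f⁻¹ * u * f ∈ Hgrp)
    (heq3 : h * h.map ⇑η₁ * (f : Matrix (Fin N) (Fin N) k).map (algebraMap k (RatFunc k))
      = (f : Matrix (Fin N) (Fin N) k).map (algebraMap k (RatFunc k)) * h.map ⇑η₂) :
    h.map ⇑α * h.map ⇑β = h.map ⇑μ := by
  have wα : ∀ a b : k, Val (MvPolynomial.eval ![a, b]) (α RatFunc.X) a := by
    intro a b
    rw [hαX]
    exact val_X2 a b 0
  have wβ : ∀ a b : k, Val (MvPolynomial.eval ![a, b]) (β RatFunc.X) b := by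
    intro a b
    rw [hβX]
    exact val_X2 a b 1
  have wγ : ∀ a b : k, Val (MvPolynomial.eval ![a, b]) (γ RatFunc.X) (a * b - a + 1) := by
    intro a b
    rw [hγX]
    exact (((wα a b).mul (wβ a b)).sub (wα a b)).add Val.one
  have wδ : ∀ a b : k, a * b - a + 1 ≠ 0 →
      Val (MvPolynomial.eval ![a, b]) (δ RatFunc.X) (a * b / (a * b - a + 1)) := by
    intro a b hab
    rw [hδX, div_eq_mul_inv]
    exact ((wα a b).mul (wβ a b)).mul ((wγ a b).inv hab)
  have wμ : ∀ a b : k, Val (MvPolynomial.eval ![a, b]) (μ RatFunc.X) (a * b) := by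
    intro a b
    rw [hμX]
    exact (wα a b).mul (wβ a b)
  obtain ⟨n, P, hP⟩ := no_poles hunit.1 α β γ δ hαC hβC hγC hδC wα wβ wγ wδ heq2
  have hvv : hval = hv h := by
    funext a
    ext i j
    exact hhval a i j
  subst hvv
  have reg : ∀ a : k, a ≠ 0 → a ≠ 1 → Reg h a := fun a a0 a1 => (reg_of hP a0 a1).1
  have m2 : ∀ (φ : RatFunc k →+* FractionRing (MvPolynomial (Fin 2) k))
      (_ : ∀ c : k, φ (RatFunc.C c) = algebraMap k (FractionRing (MvPolynomial (Fin 2) k)) c)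
      (a b t : k), Val (MvPolynomial.eval ![a, b]) (φ RatFunc.X) t → t ≠ 0 → t ≠ 1 →
      MVal (MvPolynomial.eval ![a, b]) (h.map φ) (hv h t) := by
    intro φ hC a b t hX t0 t1
    exact MVal.comp (fun c => by rw [hC]; exact val_C2 a b c) hX (reg t t0 t1)
  have m1 : ∀ (φ : RatFunc k →+* RatFunc k) (_ : ∀ c : k, φ (RatFunc.C c) = RatFunc.C c)
      (a t : k), Val (Polynomial.evalRingHom a) (φ RatFunc.X) t → t ≠ 0 → t ≠ 1 →
      MVal (Polynomial.evalRingHom a) (h.map φ) (hv h t) := by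
    intro φ hC a t hX t0 t1
    exact MVal.comp (fun c => by rw [hC]; exact val_C1 a c) hX (reg t t0 t1)
  have v2 : ∀ a : k, Val (Polynomial.evalRingHom a) (2 : RatFunc k) 2 := by
    intro a
    rw [← one_add_one_eq_two, ← one_add_one_eq_two]
    exact Val.one.add Val.one
  have key := matrix_main (n := n) (P := P) (hv h) f (fun a a0 a1 => (reg_of hP a0 a1).2)
    (by
      intro x x0 x1
      have u1 := MVal.id (reg x x0 x1)
      have u2 := m1 inv hinvC x x⁻¹ (by rw [hinvX]; exact (val_X1 x).inv x0)
        (inv_ne_zero x0) (by rwa [Ne, inv_eq_one])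
      rw [heq1] at u2
      have u3 := u1.mul u2
      rw [hunit.1] at u3
      exact u3.uniq MVal.one)
    (by
      intro x y x0 x1 y0 y1 d
      have n1 : x * y - x + 1 ≠ 1 := by
        intro h
        apply mul_ne_zero x0 (sub_ne_zero.2 y1)
        linear_combination h
      have n2 : x * y / (x * y - x + 1) ≠ 1 := by
        intro h
        rw [div_eq_one_iff_eq d] at h
        apply x1
        linear_combination h
      have u1 := (m2 α hαC x y x (wα x y) x0 x1).mul (m2 β hβC x y y (wβ x y) y0 y1)
      have u2 := (m2 γ hγC x y _ (wγ x y) d n1).mul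
        (m2 δ hδC x y _ (wδ x y d) (div_ne_zero (mul_ne_zero x0 y0) d) n2)
      rw [heq2] at u1
      exact u1.uniq u2)
    (by
      intro x x0 x1 d
      have n1 : 2 * x - 1 ≠ 1 := by
        intro h
        apply x1
        have h2 : (2 : k) ≠ 0 := two_ne_zero
        apply mul_left_cancel₀ h2
        linear_combination h
      have n2 : 2 - x⁻¹ ≠ 0 := by
        intro h
        apply d
        have : x * x⁻¹ = 1 := mul_inv_cancel₀ x0
        linear_combination x * h + this
      have n3 : 2 - x⁻¹ ≠ 1 := by
        intro h
        apply x1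
        have : x * x⁻¹ = 1 := mul_inv_cancel₀ x0
        linear_combination x * h + this
      have uf : MVal (Polynomial.evalRingHom x)
          ((f : Matrix (Fin N) (Fin N) k).map (algebraMap k (RatFunc k)))
          (f : Matrix (Fin N) (Fin N) k) := fun i j => val_C1 x _
      have u1 := ((MVal.id (reg x x0 x1)).mul (m1 η₁ hη₁C x _
        (by rw [hη₁X]; exact (v2 x).sub ((val_X1 x).inv x0)) n2 n3)).mul uf
      have u2 := uf.mul (m1 η₂ hη₂C x _
        (by rw [hη₂X]; exact ((v2 x).mul (val_X1 x)).sub Val.one) d n1)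
      rw [heq3] at u1
      exact u1.uniq u2)
    Hgrp hHdef (fun u hu => (hfnorm u hu).2) hfuni
  ext i j
  rw [← sub_eq_zero]
  apply generic_zero
  intro x y x0 x1 y0 y1 xy
  have u1 := (m2 α hαC x y x (wα x y) x0 x1).mul (m2 β hβC x y y (wβ x y) y0 y1)
  have u2 := m2 μ hμC x y _ (wμ x y) (mul_ne_zero x0 y0) xy
  rw [key x y x0 x1 y0 y1 xy] at u1
  have u3 := (u1 i j).sub (u2 i j)
  rwa [sub_self] at u3
end

section
/- Let k be a field of characteristic zero, n ≥ 1, L = k(x_1,…,x_n), and G = PGL_{n+1}(k) acting on L by projective transformations. For A ∈ GL_{n+1}(k) let d_A ∈ L^×/k^× be the class of the denominator A_{1,n+1}x_1 + ⋯ + A_{n,n+1}x_n + A_{n+1,n+1} (this class is well-defined on PGL_{n+1}(k), and A ↦ d_A^{-1} is a 1-cocycle with values in L^×/k^×). Then the map ℤ → H^1(G, L^×/k^×) sending m to the class of the 1-cocycle A ↦ d_A^{-m} is a bijection: every 1-cocycle c : G → L^×/k^× is cohomologous to A ↦ d_A^{-m} for a unique integer m. -/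
namespace PglAux

section Abs
variable {V X : Type*} [AddCommGroup V] [Module ℚ V] [AddAction V X]

lemma nsmul_ne (hst : ∀ (q : ℚ) (v : V) (P : X), q ≠ 0 → q • v +ᵥ P = P → v +ᵥ P = P)
    {u : V} {P : X} (hP : u +ᵥ P ≠ P) (q q' : ℚ) (h : q • u +ᵥ P = q' • u +ᵥ P) : q = q' := by
  by_contra hne
  apply hP
  apply hst (q - q') u P (sub_ne_zero.2 hne)
  rw [sub_smul, sub_eq_add_neg, add_comm, add_vadd, h, neg_vadd_vadd]

lemma ev_zero (hst : ∀ (q : ℚ) (v : V) (P : X), q ≠ 0 → q • v +ᵥ P = P → v +ᵥ P = P)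
    (h : X → ℤ) (hf : h.support.Finite) {u : V} {P : X} (hP : u +ᵥ P ≠ P) :
    ∃ N₀ : ℕ, ∀ N ≥ N₀, h (-(N • u) +ᵥ P) = 0 := by
  have inj : Function.Injective (fun N : ℕ => -(N • u) +ᵥ P) := by
    intro a b hab
    have : (-(a:ℚ)) • u +ᵥ P = (-(b:ℚ)) • u +ᵥ P := by
      simpa [neg_smul, Nat.cast_smul_eq_nsmul] using hab
    have := nsmul_ne hst hP _ _ this
    exact_mod_cast neg_injective this
  have fin := hf.preimage (f := fun N : ℕ => -(N • u) +ᵥ P) (inj.injOn)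
  obtain ⟨M, hM⟩ := fin.bddAbove
  refine ⟨M + 1, fun N hN => ?_⟩
  by_contra hne
  have := hM (show N ∈ _ from hne)
  omega

lemma half (hst : ∀ (q : ℚ) (v : V) (P : X), q ≠ 0 → q • v +ᵥ P = P → v +ᵥ P = P)
    (c : V → X → ℤ) (hfin : ∀ v, (c v).support.Finite)
    (hc : ∀ v w P, c (v + w) P = c v P + c w (-v +ᵥ P)) (u : V) :
    ∃ F : X → ℤ, (∀ P, F P ≠ 0 → u +ᵥ P ≠ P) ∧
      (∀ w P, u +ᵥ P ≠ P → c w P = F P - F (-w +ᵥ P)) ∧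
      (∀ P, F P ≠ 0 → ∃ i : ℕ, c u (-(i • u) +ᵥ P) ≠ 0) := by
  have hlim : ∀ P, u +ᵥ P ≠ P → ∃ y, ∃ N₀ : ℕ, ∀ N ≥ N₀, c (N • u) P = y := by
    intro P hP
    obtain ⟨N₀, h0⟩ := ev_zero hst (c u) (hfin u) hP
    refine ⟨c (N₀ • u) P, N₀, fun N hN => ?_⟩
    induction N, hN using Nat.le_induction with
    | base => rfl
    | succ N hN ih => rw [succ_nsmul, hc, h0 N hN, ih, add_zero]
  classical
  choose! y hy using hlim
  refine ⟨fun P => if u +ᵥ P = P then 0 else y P, ?_, ?_, ?_⟩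
  · intro P h h'
    simp [h'] at h
  · intro w P hP
    have hP' : u +ᵥ (-w +ᵥ P) ≠ -w +ᵥ P := by
      intro h
      apply hP
      rw [vadd_comm] at h
      exact (AddAction.injective (-w)) h
    simp only [hP, hP', if_false]
    obtain ⟨N1, h1⟩ := hy P hP
    obtain ⟨N2, h2⟩ := hy _ hP'
    obtain ⟨N3, h3⟩ := ev_zero hst (c w) (hfin w) hP
    set N := max N1 (max N2 N3)
    have e1 := h1 N (by omega)
    have e2 := h2 N (by omega)
    have e3 := h3 N (by omega)
    have a := hc w (N • u) P
    have b := hc (N • u) w P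
    rw [add_comm] at b
    rw [e2] at a
    rw [e1, e3] at b
    linarith
  · intro P hne
    have hP : u +ᵥ P ≠ P := by
      intro h'; simp [h'] at hne
    simp only [hP, if_false] at hne
    obtain ⟨N1, h1⟩ := hy P hP
    rw [← h1 N1 le_rfl] at hne
    clear h1
    induction N1 with
    | zero =>
      have := hc 0 0 P
      simp at this
      simp [this] at hne
    | succ N ih =>
      rw [succ_nsmul, hc] at hne
      by_cases h0 : c (N • u) P = 0
      · refine ⟨N, ?_⟩
        simpa [h0] using hne
      · exact ih h0

lemma one_vec (hst : ∀ (q : ℚ) (v : V) (P : X), q ≠ 0 → q • v +ᵥ P = P → v +ᵥ P = P)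
    (c : V → X → ℤ) (hfin : ∀ v, (c v).support.Finite)
    (hc : ∀ v w P, c (v + w) P = c v P + c w (-v +ᵥ P)) (v : V) :
    ∃ F : X → ℤ, F.support.Finite ∧
      (∀ w P, v +ᵥ P ≠ P → c w P = F P - F (-w +ᵥ P)) := by
  obtain ⟨F, hF1, hF2, hF3⟩ := half hst c hfin hc v
  obtain ⟨G, hG1, hG2, hG3⟩ := half hst c hfin hc (-v)
  have hneg : ∀ P : X, -v +ᵥ P ≠ P ↔ v +ᵥ P ≠ P := by
    intro P
    rw [not_iff_not]
    constructor <;> intro h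
    · nth_rw 1 [← h]; simp
    · nth_rw 1 [← h]; simp
  refine ⟨F, ?_, hF2⟩
  set S := (c v).support ∪ (c (-v)).support with hS
  have hSf : S.Finite := (hfin v).union (hfin (-v))
  have heq : ∀ P, v +ᵥ P ≠ P → F P = G P := by
    intro P hP
    by_contra hne
    have hw : ∀ w : V, F (-w +ᵥ P) - G (-w +ᵥ P) = F P - G P := by
      intro w
      have := hF2 w P hP
      have := hG2 w P ((hneg P).2 hP)
      linarith
    have key : ∀ N : ℕ, ∃ j : ℤ, ((-(j:ℚ) - 1 / ((N:ℚ) + 1)) • v +ᵥ P) ∈ S := by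
      intro N
      have h1 := hw ((1 / ((N:ℚ) + 1)) • v)
      by_cases h0 : F (-((1 / ((N:ℚ) + 1)) • v) +ᵥ P) = 0
      · have : G (-((1 / ((N:ℚ) + 1)) • v) +ᵥ P) ≠ 0 := by
          intro h; rw [h, h0] at h1; apply hne; linarith
        obtain ⟨i, hi⟩ := hG3 _ this
        refine ⟨-i, Or.inr ?_⟩
        rw [Function.mem_support]
        convert hi using 2
        rw [vadd_vadd]
        congr 1
        push_cast
        rw [← Nat.cast_smul_eq_nsmul ℚ i]
        module
      · obtain ⟨i, hi⟩ := hF3 _ h0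
        refine ⟨i, Or.inl ?_⟩
        rw [Function.mem_support]
        convert hi using 2
        rw [vadd_vadd]
        congr 1
        push_cast
        rw [← Nat.cast_smul_eq_nsmul ℚ i]
        module
    choose j hj using key
    have : Finite S := hSf
    obtain ⟨a, b, hab, h⟩ := Finite.exists_ne_map_eq_of_infinite
      (fun N : ℕ => (⟨_, hj N⟩ : S))
    have h' := nsmul_ne hst hP _ _ (congrArg Subtype.val h)
    have ha : (0:ℚ) < 1 / ((a:ℚ) + 1) := by positivity
    have hb : (0:ℚ) < 1 / ((b:ℚ) + 1) := by positivity
    have ha1 : 1 / ((a:ℚ) + 1) ≤ 1 := by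
      rw [div_le_one (by positivity)]; linarith [Nat.cast_nonneg (α := ℚ) a]
    have hb1 : 1 / ((b:ℚ) + 1) ≤ 1 := by
      rw [div_le_one (by positivity)]; linarith [Nat.cast_nonneg (α := ℚ) b]
    have l1 : ((j a - j b : ℤ):ℚ) < (1 : ℤ) := by push_cast; linarith
    have l2 : ((-1 : ℤ):ℚ) < (j a - j b : ℤ) := by push_cast; linarith
    have l1' := Int.cast_lt.1 l1
    have l2' := Int.cast_lt.1 l2
    have : j a = j b := by omega
    rw [this] at h'
    have h3 : 1 / ((a:ℚ) + 1) = 1 / ((b:ℚ) + 1) := by linarith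
    have h4 : ((a:ℚ) + 1) = (b:ℚ) + 1 := by
      simpa using h3
    apply hab
    have : (a:ℚ) = b := by linarith
    exact_mod_cast this
  have hsub : F.support ⊆ ⋃ e ∈ S ×ˢ S, {P : X | v +ᵥ P ≠ P ∧
      ∃ i j : ℕ, P = i • v +ᵥ e.1 ∧ e.2 = j • v +ᵥ P} := by
    intro P hP
    have hP1 := hF1 P hP
    obtain ⟨i, hi⟩ := hF3 P hP
    have hG : G P ≠ 0 := by rw [← heq P hP1]; exact hP
    obtain ⟨j, hj⟩ := hG3 P hG
    simp only [Set.mem_iUnion]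
    refine ⟨(-(i • v) +ᵥ P, -(j • -v) +ᵥ P), ⟨Or.inl hi, Or.inr hj⟩, hP1, i, j, ?_, ?_⟩
    · simp
    · simp
  refine Set.Finite.subset (Set.Finite.biUnion (hSf.prod hSf) ?_) hsub
  rintro ⟨E, E'⟩ -
  by_cases hemp : ∃ P : X, v +ᵥ P ≠ P ∧ ∃ i j : ℕ, P = i • v +ᵥ E ∧ E' = j • v +ᵥ P
  · obtain ⟨P0, hP0, i0, j0, h1, h2⟩ := hemp
    refine Set.Finite.subset ((Finset.range (i0 + j0 + 1)).finite_toSet.image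
      (fun i => i • v +ᵥ E)) ?_
    rintro P ⟨hP, i, j, h3, h4⟩
    refine ⟨i, ?_, h3.symm⟩
    have hE : v +ᵥ E ≠ E := by
      intro h
      apply hP
      rw [h3, vadd_comm, h]
    have : ((i + j : ℕ) : ℚ) • v +ᵥ E = ((i0 + j0 : ℕ) : ℚ) • v +ᵥ E := by
      rw [Nat.cast_smul_eq_nsmul, Nat.cast_smul_eq_nsmul, add_comm i, add_comm i0, add_nsmul,
        add_nsmul, add_vadd, add_vadd, ← h3, ← h1]
      simp only at h4 h2
      rw [← h4, ← h2]
    have := nsmul_ne hst hE _ _ this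
    have : i + j = i0 + j0 := by exact_mod_cast this
    simp
    omega
  · convert Set.finite_empty
    ext P
    simp only [Set.mem_ofPred_eq, Set.mem_empty_iff_false, iff_false]
    exact fun h => hemp ⟨P, h⟩

lemma many_vec (hst : ∀ (q : ℚ) (v : V) (P : X), q ≠ 0 → q • v +ᵥ P = P → v +ᵥ P = P)
    (c : V → X → ℤ) (hfin : ∀ v, (c v).support.Finite)
    (hc : ∀ v w P, c (v + w) P = c v P + c w (-v +ᵥ P)) (l : List V) :
    ∃ F : X → ℤ, F.support.Finite ∧
      (∀ w P, (∃ v ∈ l, v +ᵥ P ≠ P) → c w P = F P - F (-w +ᵥ P)) := by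
  classical
  have htr : ∀ (w v : V) (P : X), v +ᵥ (-w +ᵥ P) ≠ -w +ᵥ P ↔ v +ᵥ P ≠ P := by
    intro w v P
    rw [vadd_comm, (AddAction.injective (-w)).ne_iff]
  induction l with
  | nil => exact ⟨0, by simp, by simp⟩
  | cons v l ih =>
    obtain ⟨F, hF, hF2⟩ := ih
    have hFt : ∀ w : V, (fun P => F (-w +ᵥ P)).support.Finite := by
      intro w
      exact hF.preimage ((AddAction.injective (-w)).injOn)
    obtain ⟨G, hG, hG2⟩ := one_vec hst (fun w P => c w P - (F P - F (-w +ᵥ P)))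
      (by
        intro w
        refine Set.Finite.subset ((hfin w).union (hF.union (hFt w))) ?_
        intro P hP
        by_contra hcon
        simp only [Set.mem_union, Function.mem_support, not_or, not_not] at hcon
        apply hP
        simp [hcon.1, hcon.2.1, hcon.2.2])
      (by
        intro v w P
        rw [hc, vadd_vadd, neg_add_rev]
        ring) v
    refine ⟨fun P => F P + if (∃ v ∈ l, v +ᵥ P ≠ P) then 0 else G P, ?_, ?_⟩
    · refine Set.Finite.subset (hF.union hG) ?_
      intro P hP
      by_contra hcon
      simp only [Set.mem_union, Function.mem_support, not_or, not_not] at hcon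
      apply hP
      simp [hcon.1, hcon.2]
    · intro w P hP
      simp only [htr]
      by_cases h : ∃ v ∈ l, v +ᵥ P ≠ P
      · simp only [h, if_true, hF2 w P h, add_zero]
      · have hv : v +ᵥ P ≠ P := by
          obtain ⟨u, hu, hu'⟩ := hP
          rcases List.mem_cons.1 hu with rfl | hu
          · exact hu'
          · exact (h ⟨u, hu, hu'⟩).elim
        have := hG2 w P hv
        simp only [h, if_false]
        linarith

/-- A finitely supported invariant function is supported on fixed points. -/
lemma inv_fixed (hst : ∀ (q : ℚ) (v : V) (P : X), q ≠ 0 → q • v +ᵥ P = P → v +ᵥ P = P)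
    (h : X → ℤ) (hf : h.support.Finite) (v : V) (hinv : ∀ P, h (v +ᵥ P) = h P)
    (P : X) (hP : h P ≠ 0) : v +ᵥ P = P := by
  by_contra hne
  obtain ⟨N, hN⟩ := ev_zero hst h hf hne
  have : ∀ (N : ℕ) (Q : X), h (N • v +ᵥ Q) = h Q := by
    intro N
    induction N with
    | zero => simp
    | succ N ih => intro Q; rw [succ_nsmul, add_vadd, ih, hinv]
  apply hP
  rw [← hN N le_rfl, ← this N (-(N • v) +ᵥ P)]
  simp
end Abs

end PglAux

namespace PglAux
set_option linter.unusedSectionVars false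
section Div

/-- Prime divisors of a factorial ring. -/
def PD (R : Type*) [CommRing R] : Type _ := {P : Associates R // Irreducible P}

variable {R : Type*} [CommRing R] [IsDomain R] [UniqueFactorizationMonoid R]
variable {L : Type*} [Field L] [Algebra R L] [IsFractionRing R L]

/-- the class of an irreducible element -/
def PD.mk (p : R) (hp : Irreducible p) : PD R := ⟨Associates.mk p, Associates.irreducible_mk.2 hp⟩

/-- a representative -/
noncomputable def PD.rep (P : PD R) : R := Quotient.out P.1

lemma PD.mk_rep' (P : PD R) : Associates.mk P.rep = P.1 := Associates.quot_out P.1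

lemma PD.rep_irred (P : PD R) : Irreducible P.rep := by
  rw [← Associates.irreducible_mk, P.mk_rep']; exact P.2

lemma PD.rep_prime (P : PD R) : Prime P.rep := P.rep_irred.prime

lemma PD.mk_rep (P : PD R) : PD.mk P.rep P.rep_irred = P := Subtype.ext P.mk_rep'

lemma PD.mk_eq {p q : R} (hp : Irreducible p) (hq : Irreducible q) :
    PD.mk p hp = PD.mk q hq ↔ Associated p q := by
  rw [← Associates.mk_eq_mk_iff_associated]
  exact Subtype.ext_iff

lemma PD.rep_mk (p : R) (hp : Irreducible p) : Associated (PD.mk p hp).rep p := by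
  rw [← PD.mk_eq (PD.rep_irred _) hp, PD.mk_rep]

/-- order along a prime divisor -/
noncomputable def ord (P : PD R) (g : L) : ℤ :=
  (multiplicity P.rep (IsFractionRing.num R g) : ℤ)
    - multiplicity P.rep (IsFractionRing.den R g : R)

lemma mult_mul (P : PD R) {a b : R} (ha : a ≠ 0) (hb : b ≠ 0) :
    multiplicity P.rep (a * b) = multiplicity P.rep a + multiplicity P.rep b :=
  multiplicity_mul P.rep_prime (FiniteMultiplicity.of_prime_left P.rep_prime (mul_ne_zero ha hb))

lemma ord_div (P : PD R) {a b : R} (ha : a ≠ 0) (hb : b ≠ 0) :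
    ord P (algebraMap R L a / algebraMap R L b) = multiplicity P.rep a - multiplicity P.rep b := by
  set g : L := algebraMap R L a / algebraMap R L b with hg
  have inj := IsFractionRing.injective R L
  have ha' : algebraMap R L a ≠ 0 := by rwa [Ne, map_eq_zero_iff _ inj]
  have hb' : algebraMap R L b ≠ 0 := by rwa [Ne, map_eq_zero_iff _ inj]
  have hd : (IsFractionRing.den R g : R) ≠ 0 := nonZeroDivisors.ne_zero (IsFractionRing.den R g).2
  have hd' : algebraMap R L (IsFractionRing.den R g : R) ≠ 0 := by rwa [Ne, map_eq_zero_iff _ inj]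
  have h1 : algebraMap R L (IsFractionRing.num R g) / algebraMap R L (IsFractionRing.den R g) = g := by
    rw [← IsFractionRing.mk'_eq_div, IsFractionRing.mk'_num_den]
  have hn : IsFractionRing.num R g ≠ 0 := by
    intro h
    rw [h, map_zero, zero_div] at h1
    exact div_ne_zero ha' hb' h1.symm
  have h2 : IsFractionRing.num R g * b = a * (IsFractionRing.den R g : R) := by
    apply inj
    rw [map_mul, map_mul]
    rw [hg, div_eq_div_iff hd' hb'] at h1
    exact h1
  have h3 := congrArg (multiplicity P.rep) h2
  rw [mult_mul P hn hb, mult_mul P ha hd] at h3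
  unfold ord
  omega

lemma exists_rep (g : L) (hg : g ≠ 0) : ∃ a b : R, a ≠ 0 ∧ b ≠ 0 ∧
    g = algebraMap R L a / algebraMap R L b := by
  obtain ⟨a, b, hb, h⟩ := IsFractionRing.div_surjective (A := R) g
  refine ⟨a, b, ?_, nonZeroDivisors.ne_zero hb, h.symm⟩
  rintro rfl
  simp at h
  exact hg h.symm

lemma ord_mul (P : PD R) {g h : L} (hg : g ≠ 0) (hh : h ≠ 0) :
    ord P (g * h) = ord P g + ord P h := by
  obtain ⟨a, b, ha, hb, rfl⟩ := exists_rep (R := R) g hg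
  obtain ⟨a', b', ha', hb', rfl⟩ := exists_rep (R := R) h hh
  rw [div_mul_div_comm, ← map_mul, ← map_mul, ord_div P (mul_ne_zero ha ha') (mul_ne_zero hb hb'),
    ord_div P ha hb, ord_div P ha' hb', mult_mul P ha ha', mult_mul P hb hb']
  push_cast
  ring

lemma ord_one (P : PD R) : ord P (1 : L) = 0 := by
  have := ord_mul P (one_ne_zero (α := L)) (one_ne_zero (α := L))
  rw [mul_one] at this
  omega

lemma ord_inv (P : PD R) {g : L} (hg : g ≠ 0) : ord P g⁻¹ = - ord P g := by
  have := ord_mul P hg (inv_ne_zero hg)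
  rw [mul_inv_cancel₀ hg, ord_one] at this
  omega

lemma ord_div' (P : PD R) {g h : L} (hg : g ≠ 0) (hh : h ≠ 0) :
    ord P (g / h) = ord P g - ord P h := by
  rw [div_eq_mul_inv, ord_mul P hg (inv_ne_zero hh), ord_inv P hh, sub_eq_add_neg]

lemma ord_zpow (P : PD R) {g : L} (hg : g ≠ 0) (m : ℤ) : ord P (g ^ m) = m * ord P g := by
  have hnat : ∀ n : ℕ, ord P (g ^ n) = n * ord P g := by
    intro n
    induction n with
    | zero => simp [ord_one]
    | succ n ih => rw [pow_succ, ord_mul P (pow_ne_zero _ hg) hg, ih]; push_cast; ring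
  obtain ⟨n, rfl | rfl⟩ := m.eq_nat_or_neg
  · rw [zpow_natCast, hnat]
  · rw [zpow_neg, zpow_natCast, ord_inv P (pow_ne_zero _ hg), hnat]; ring

lemma ord_algebraMap (P : PD R) {a : R} (ha : a ≠ 0) :
    ord P (algebraMap R L a) = multiplicity P.rep a := by
  have h : IsUnit (1 : R) := isUnit_one
  have := ord_div (L := L) P ha one_ne_zero
  rw [map_one, div_one, multiplicity_eq_zero (b := (1 : R)).2] at this
  · simpa using this
  · exact fun h => P.rep_irred.not_isUnit (isUnit_of_dvd_one h)

lemma ord_irred (P : PD R) {p : R} (hp : Irreducible p) [Decidable (P = PD.mk p hp)] :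
    ord P (algebraMap R L p) = if P = PD.mk p hp then 1 else 0 := by
  rw [ord_algebraMap P hp.ne_zero]
  have hP : P = PD.mk p hp ↔ Associated P.rep p := by
    rw [← PD.mk_eq P.rep_irred hp, PD.mk_rep]
  split_ifs with h
  · rw [hP] at h
    rw [← multiplicity_eq_of_associated_right h, multiplicity_self]
    rfl
  · rw [multiplicity_eq_zero.2]
    · rfl
    · intro hd
      exact h (hP.2 (P.rep_irred.associated_of_dvd hp hd))

lemma ord_unit (P : PD R) {a : R} (ha : IsUnit a) : ord P (algebraMap R L a) = 0 := by
  rw [ord_algebraMap P ha.ne_zero, multiplicity_eq_zero.2]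
  · rfl
  · exact fun h => P.rep_irred.not_isUnit (isUnit_of_dvd_unit h ha)

lemma ord_finite (g : L) (hg : g ≠ 0) : (Function.support (fun P : PD R => ord P g)).Finite := by
  have key : ∀ a : R, a ≠ 0 → {P : PD R | P.rep ∣ a}.Finite := by
    intro a ha
    induction a using UniqueFactorizationMonoid.induction_on_prime with
    | h₁ => exact (ha rfl).elim
    | h₂ a h =>
      convert Set.finite_empty
      ext P
      simp only [Set.mem_ofPred_eq, Set.mem_empty_iff_false, iff_false]
      exact fun h' => P.rep_irred.not_isUnit (isUnit_of_dvd_unit h' h)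
    | h₃ a p ha' hp ih =>
      refine Set.Finite.subset ((ih ha').insert (PD.mk p hp.irreducible)) ?_
      intro P hP
      rcases P.rep_prime.dvd_or_dvd hP with h | h
      · left
        rw [← PD.mk_rep P, PD.mk_eq]
        exact P.rep_irred.associated_of_dvd hp.irreducible h
      · right; exact h
  obtain ⟨a, b, ha, hb, rfl⟩ := exists_rep (R := R) g hg
  refine Set.Finite.subset ((key a ha).union (key b hb)) ?_
  intro P hP
  by_contra hcon
  simp only [Set.mem_union, Set.mem_ofPred_eq, not_or] at hcon
  apply hP
  simp only
  rw [ord_div P ha hb, multiplicity_eq_zero.2 hcon.1, multiplicity_eq_zero.2 hcon.2]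
  rfl

lemma ord_eq_zero (g : L) (hg : g ≠ 0) (h : ∀ P : PD R, ord P g = 0) :
    ∃ u : Rˣ, g = algebraMap R L u := by
  set a := IsFractionRing.num R g with hadef
  set b : R := (IsFractionRing.den R g : R) with hbdef
  have inj := IsFractionRing.injective R L
  have hb0 : b ≠ 0 := nonZeroDivisors.ne_zero (IsFractionRing.den R g).2
  have hgab : g = algebraMap R L a / algebraMap R L b := by
    rw [← IsFractionRing.mk'_eq_div, IsFractionRing.mk'_num_den]
  have ha0 : a ≠ 0 := by
    intro h'
    rw [h', map_zero, zero_div] at hgab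
    exact hg hgab
  have hrel : IsRelPrime a b := IsFractionRing.num_den_reduced R g
  have key : ∀ p : R, Irreducible p → (p ∣ a ↔ p ∣ b) := by
    intro p hp
    have h1 := h (PD.mk p hp)
    unfold ord at h1
    rw [← hadef, ← hbdef] at h1
    have h2 : multiplicity (PD.mk p hp).rep a = multiplicity (PD.mk p hp).rep b := by
      omega
    rw [← (PD.rep_mk p hp).dvd_iff_dvd_left, ← (PD.rep_mk p hp).dvd_iff_dvd_left]
    rw [← not_iff_not, ← multiplicity_eq_zero, ← multiplicity_eq_zero, h2]
  have hunit : ∀ p : R, Irreducible p → ¬ (p ∣ a ∧ p ∣ b) := by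
    intro p hp hh
    exact hp.not_isUnit (hrel hh.1 hh.2)
  have hua : IsUnit a := by
    by_contra hu
    obtain ⟨p, hp, hd⟩ := WfDvdMonoid.exists_irreducible_factor hu ha0
    exact hunit p hp ⟨hd, (key p hp).1 hd⟩
  have hub : IsUnit b := by
    by_contra hu
    obtain ⟨p, hp, hd⟩ := WfDvdMonoid.exists_irreducible_factor hu hb0
    exact hunit p hp ⟨(key p hp).2 hd, hd⟩
  obtain ⟨u, hu⟩ := hua
  obtain ⟨v, hv⟩ := hub
  refine ⟨u * v⁻¹, ?_⟩
  rw [hgab, ← hu, ← hv]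
  have : algebraMap R L v ≠ 0 := by
    rw [hv, Ne, map_eq_zero_iff _ inj]; exact hb0
  rw [div_eq_iff this, ← map_mul]
  simp

lemma exists_div (f : PD R → ℤ) (hf : f.support.Finite) :
    ∃ g : L, g ≠ 0 ∧ ∀ P : PD R, ord P g = f P := by
  classical
  have inj := IsFractionRing.injective R L
  have hr0 : ∀ Q : PD R, algebraMap R L Q.rep ≠ 0 := by
    intro Q
    rw [Ne, map_eq_zero_iff _ inj]; exact Q.rep_irred.ne_zero
  have key : ∀ s : Finset (PD R), ∃ g : L, g ≠ 0 ∧ ∀ P : PD R, ord P g = if P ∈ s then f P else 0 := by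
    intro s
    induction s using Finset.induction_on with
    | empty => exact ⟨1, one_ne_zero, fun P => by simp [ord_one]⟩
    | insert Q s hQ ih =>
      obtain ⟨g, hg, h⟩ := ih
      refine ⟨algebraMap R L Q.rep ^ f Q * g, mul_ne_zero (zpow_ne_zero _ (hr0 Q)) hg, ?_⟩
      intro P
      rw [ord_mul P (zpow_ne_zero _ (hr0 Q)) hg, ord_zpow P (hr0 Q), h P,
        ord_irred P Q.rep_irred, PD.mk_rep]
      by_cases hPQ : P = Q
      · subst hPQ; simp [hQ]
      · simp [hPQ]
  obtain ⟨g, hg, h⟩ := key hf.toFinset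
  refine ⟨g, hg, fun P => ?_⟩
  rw [h P]
  simp only [Set.Finite.mem_toFinset, Function.mem_support]
  split_ifs with h
  · rfl
  · push Not at h; exact h.symm

/-- automorphisms act on prime divisors -/
noncomputable def PD.map (σ : R ≃+* R) (P : PD R) : PD R :=
  PD.mk (σ P.rep) ((MulEquiv.irreducible_iff σ).2 P.rep_irred)

lemma PD.map_mk (σ : R ≃+* R) (p : R) (hp : Irreducible p) :
    PD.map σ (PD.mk p hp) = PD.mk (σ p) ((MulEquiv.irreducible_iff σ).2 hp) := by
  rw [PD.map, PD.mk_eq]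
  exact (PD.rep_mk p hp).map σ

lemma ord_map (σ : R ≃+* R) (ρ : L ≃+* L)
    (h : ∀ a, ρ (algebraMap R L a) = algebraMap R L (σ a)) (P : PD R) {g : L} (hg : g ≠ 0) :
    ord (PD.map σ P) (ρ g) = ord P g := by
  obtain ⟨a, b, ha, hb, rfl⟩ := exists_rep (R := R) g hg
  rw [map_div₀, h, h, ord_div _ ((map_ne_zero_iff σ σ.injective).2 ha)
    ((map_ne_zero_iff σ σ.injective).2 hb), ord_div _ ha hb]
  have key : ∀ a, multiplicity (PD.map σ P).rep (σ a) = multiplicity P.rep a := by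
    intro a
    rw [PD.map, ← multiplicity_eq_of_associated_left (PD.rep_mk (σ P.rep) _)]
    exact multiplicity_map_eq σ
  rw [key, key]

end Div
end PglAux
namespace PglAux
section Poly
open MvPolynomial
set_option linter.unusedSectionVars false
variable {k : Type*} [Field k] [CharZero k] {n : ℕ}

lemma poly_line (Q : Polynomial k) (μ : k) (h : ∀ s, Q.eval (s + 1) = μ * Q.eval s) (s : k) :
    Q.eval s = Q.eval 0 := by
  by_cases hQ : Q = 0
  · simp [hQ]
  have h1 : Q.comp (Polynomial.X + Polynomial.C 1) = Polynomial.C μ * Q := by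
    apply Polynomial.funext
    intro r
    simp only [Polynomial.eval_comp, Polynomial.eval_add, Polynomial.eval_X, Polynomial.eval_C,
      Polynomial.eval_mul]
    exact h r
  have h2 := congrArg Polynomial.leadingCoeff h1
  rw [Polynomial.leadingCoeff_comp (by rw [Polynomial.natDegree_X_add_C]; exact one_ne_zero),
    Polynomial.leadingCoeff_X_add_C, one_pow, mul_one, Polynomial.leadingCoeff_mul,
    Polynomial.leadingCoeff_C] at h2
  have hl : Q.leadingCoeff ≠ 0 := Polynomial.leadingCoeff_ne_zero.2 hQ
  have hμ : μ = 1 := by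
    apply mul_right_cancel₀ hl
    rw [← h2, one_mul]
  subst hμ
  have h3 : ∀ N : ℕ, Q.eval (N : k) = Q.eval 0 := by
    intro N
    induction N with
    | zero => simp
    | succ N ih => push_cast; rw [h, one_mul, ih]
  have : Q = Polynomial.C (Q.eval 0) := by
    apply Polynomial.eq_of_infinite_eval_eq
    refine Set.Infinite.mono ?_ (Set.infinite_range_of_injective (Nat.cast_injective (R := k)))
    rintro _ ⟨N, rfl⟩
    simp [h3 N]
  rw [this]; simp

lemma line_const (p : MvPolynomial (Fin n) k) (v : Fin n → k) (μ : k)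
    (h : ∀ a, eval (a + v) p = μ * eval a p) (a : Fin n → k) (s : k) :
    eval (a + s • v) p = eval a p := by
  set Q : Polynomial k := aeval (fun i => Polynomial.C (a i) + Polynomial.C (v i) * Polynomial.X) p
  have hQ : ∀ s, Q.eval s = eval (a + s • v) p := by
    intro s
    have : ((Polynomial.evalRingHom s).comp (aeval (fun i => Polynomial.C (a i) +
        Polynomial.C (v i) * Polynomial.X)).toRingHom : MvPolynomial (Fin n) k →+* k)
        = eval (a + s • v) := by
      apply MvPolynomial.ringHom_ext
      · intro r; simp
      · intro i; simp; ring
    exact congrArg (fun f => f p) this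
  have := poly_line Q μ (by
    intro s
    rw [hQ, hQ, ← h, add_smul, one_smul, add_assoc]) s
  rw [hQ, hQ] at this
  simpa using this

/-- `X_i ↦ t X_i + v_i` -/
noncomputable def affHom (t : k) (v : Fin n → k) :
    MvPolynomial (Fin n) k →ₐ[k] MvPolynomial (Fin n) k :=
  aeval (fun i => C t * X i + C (v i))

/-- the same as an automorphism -/
noncomputable def aff (t : kˣ) (v : Fin n → k) :
    MvPolynomial (Fin n) k ≃ₐ[k] MvPolynomial (Fin n) k :=
  AlgEquiv.ofAlgHom (affHom (t : k) v) (affHom ((t⁻¹ : kˣ) : k) (-(((t⁻¹ : kˣ) : k) • v)))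
    (by
      apply MvPolynomial.algHom_ext
      intro i
      simp only [affHom, AlgHom.comp_apply, aeval_X, map_add, map_mul, algHom_C, algebraMap_eq,
        AlgHom.id_apply]
      rw [mul_add, ← mul_assoc, ← C_mul, add_assoc, ← C_mul, ← C_add]
      simp)
    (by
      apply MvPolynomial.algHom_ext
      intro i
      simp only [affHom, AlgHom.comp_apply, aeval_X, map_add, map_mul, algHom_C, algebraMap_eq,
        AlgHom.id_apply]
      rw [mul_add, ← mul_assoc, ← C_mul, add_assoc, ← C_mul, ← C_add]
      simp)

lemma aff_X (t : kˣ) (v : Fin n → k) (i : Fin n) : aff t v (X i) = C (t : k) * X i + C (v i) := by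
  change affHom (t : k) v (X i) = _
  simp [affHom]

lemma eval_aff (t : kˣ) (v a : Fin n → k) (p : MvPolynomial (Fin n) k) :
    eval a (aff t v p) = eval ((t : k) • a + v) p := by
  have : ((eval a).comp (affHom (t : k) v).toRingHom : MvPolynomial (Fin n) k →+* k)
        = eval ((t : k) • a + v) := by
      apply MvPolynomial.ringHom_ext
      · intro r; simp
      · intro i; simp [affHom]
  exact congrArg (fun f => f p) this

lemma eval_of_assoc {p q : MvPolynomial (Fin n) k} (h : Associated p q) :
    ∃ μ : k, μ ≠ 0 ∧ ∀ a, eval a q = μ * eval a p := by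
  obtain ⟨u, rfl⟩ := h
  obtain ⟨r, hr, hu⟩ := isUnit_iff_eq_C_of_isReduced.1 u.isUnit
  refine ⟨r, hr.ne_zero, fun a => ?_⟩
  rw [hu]; simp [mul_comm]

lemma map_fixed_iff (t : kˣ) (v : Fin n → k) (P : PD (MvPolynomial (Fin n) k))
    (h : PD.map (aff t v).toRingEquiv P = P) :
    ∃ μ : k, μ ≠ 0 ∧ ∀ a, eval ((t : k) • a + v) P.rep = μ * eval a P.rep := by
  have : Associated P.rep (aff t v P.rep) := by
    refine (PD.mk_eq P.rep_irred ((MulEquiv.irreducible_iff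
      (aff t v).toRingEquiv).2 P.rep_irred)).1 ?_
    rw [PD.mk_rep]
    exact h.symm
  obtain ⟨μ, hμ, h⟩ := eval_of_assoc this
  refine ⟨μ, hμ, fun a => ?_⟩
  rw [← eval_aff, h]

lemma map_comp (t s : kˣ) (v w : Fin n → k) (P : PD (MvPolynomial (Fin n) k)) :
    PD.map (aff t v).toRingEquiv (PD.map (aff s w).toRingEquiv P)
      = PD.map (aff (t * s) ((s : k) • v + w)).toRingEquiv P := by
  rw [← PD.mk_rep P, PD.map_mk, PD.map_mk, PD.map_mk, PD.mk_eq]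
  apply Associated.of_eq
  apply MvPolynomial.funext
  intro a
  change eval a (aff t v (aff s w P.rep)) = eval a (aff _ _ P.rep)
  rw [eval_aff, eval_aff, eval_aff]
  congr 2
  simp [smul_smul, mul_comm, add_assoc]

lemma map_id (P : PD (MvPolynomial (Fin n) k)) :
    PD.map (aff 1 0).toRingEquiv P = P := by
  rw [← PD.mk_rep P, PD.map_mk, PD.mk_eq]
  apply Associated.of_eq
  apply MvPolynomial.funext
  intro a
  change eval a (aff _ _ P.rep) = eval a P.rep
  rw [eval_aff]
  simp

/-- translations acting on prime divisors -/
noncomputable instance actInst : AddAction (Fin n → k) (PD (MvPolynomial (Fin n) k)) where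
  vadd v P := PD.map (aff 1 v).toRingEquiv P
  zero_vadd P := map_id P
  add_vadd v w P := by
    change PD.map (aff 1 (v + w)).toRingEquiv P = PD.map (aff 1 v).toRingEquiv
      (PD.map (aff 1 w).toRingEquiv P)
    rw [map_comp]; simp

lemma vadd_def' (v : Fin n → k) (P : PD (MvPolynomial (Fin n) k)) :
    v +ᵥ P = PD.map (aff 1 v).toRingEquiv P := rfl

lemma fixed_eval {v : Fin n → k} {P : PD (MvPolynomial (Fin n) k)} (h : v +ᵥ P = P)
    (a : Fin n → k) (s : k) : eval (a + s • v) P.rep = eval a P.rep := by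
  obtain ⟨μ, -, hμ⟩ := map_fixed_iff 1 v P h
  exact line_const P.rep v μ (by simpa using hμ) a s

lemma fixed_of_eval {v : Fin n → k} {P : PD (MvPolynomial (Fin n) k)}
    (h : ∀ a, eval (a + v) P.rep = eval a P.rep) : v +ᵥ P = P := by
  rw [vadd_def']
  conv_lhs => rw [← PD.mk_rep P]
  conv_rhs => rw [← PD.mk_rep P]
  rw [PD.map_mk, PD.mk_eq]
  apply Associated.of_eq
  apply MvPolynomial.funext
  intro a
  change eval a (aff _ _ P.rep) = eval a P.rep
  rw [eval_aff]
  simpa using h a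

lemma hst (q : ℚ) (v : Fin n → k) (P : PD (MvPolynomial (Fin n) k)) (hq : q ≠ 0)
    (h : q • v +ᵥ P = P) : v +ᵥ P = P := by
  apply fixed_of_eval
  intro a
  have := fixed_eval h a (((q⁻¹ : ℚ)) : k)
  have e : (((q⁻¹ : ℚ)) : k) • (q • v) = v := by
    ext i
    simp [Rat.smul_def, hq]
  rwa [e] at this

/-- moving all coordinates satisfying a predicate to zero -/
lemma eval_kill (p : MvPolynomial (Fin n) k) (s : Finset (Fin n))
    (h : ∀ i ∈ s, ∀ a : Fin n → k, ∀ t : k, eval (a + t • (Pi.single i (1 : k))) p = eval a p)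
    (a : Fin n → k) : eval (fun i => if i ∈ s then 0 else a i) p = eval a p := by
  induction s using Finset.induction_on with
  | empty => simp
  | insert i s hi ih =>
    rw [← ih (fun j hj => h j (Finset.mem_insert_of_mem hj))]
    rw [← h i (Finset.mem_insert_self i s) _ (-(a i))]
    rw [← h i (Finset.mem_insert_self i s) (fun i => if i ∈ s then 0 else a i) (-(a i))]
    rw [← h i (Finset.mem_insert_self i s) (_ + _) (a i)]
    congr 2
    ext j
    by_cases hj : j = i
    · subst hj; simp [hi]
    · simp [hj]

lemma no_fixed (P : PD (MvPolynomial (Fin n) k))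
    (h : ∀ i, (Pi.single i (1 : k) : Fin n → k) +ᵥ P = P) : False := by
  have h1 := eval_kill P.rep Finset.univ (fun i _ a t => fixed_eval (h i) a t)
  have h2 : P.rep = C (eval 0 P.rep) := by
    apply MvPolynomial.funext
    intro a
    rw [← h1 a]
    simp
  apply P.rep_irred.not_isUnit
  rw [h2]
  have : eval 0 P.rep ≠ 0 := by
    intro h0
    rw [h0, C_0] at h2
    exact P.rep_irred.ne_zero h2
  exact (IsUnit.mk0 _ this).map C

lemma scale_fixed (i₀ : Fin n) (P : PD (MvPolynomial (Fin n) k))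
    (h : ∀ i, i ≠ i₀ → (Pi.single i (1 : k) : Fin n → k) +ᵥ P = P)
    (t : kˣ) (ht : ∀ N : ℕ, 0 < N → (t : k) ^ N ≠ 1)
    (hs : PD.map (aff t (0 : Fin n → k)).toRingEquiv P = P) :
    P = PD.mk (X i₀) (X_prime (R := k)).irreducible := by
  have h1 := eval_kill P.rep (Finset.univ.erase i₀)
    (fun i hi a t => fixed_eval (h i (Finset.ne_of_mem_erase hi)) a t)
  set Q : Polynomial k := aeval (fun i => if i = i₀ then Polynomial.X else 0) P.rep with hQdef
  have hQ : ∀ s : k, Q.eval s = eval (fun i => if i = i₀ then s else 0) P.rep := by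
    intro s
    have : ((Polynomial.evalRingHom s).comp (aeval (fun i => if i = i₀ then
        (Polynomial.X : Polynomial k) else 0)).toRingHom : MvPolynomial (Fin n) k →+* k)
        = eval (fun i => if i = i₀ then s else 0) := by
      apply MvPolynomial.ringHom_ext
      · intro r; simp
      · intro i
        by_cases hi : i = i₀ <;> simp [hi]
    exact congrArg (fun f => f P.rep) this
  have hQP : P.rep = Polynomial.aeval (X i₀ : MvPolynomial (Fin n) k) Q := by
    apply MvPolynomial.funext
    intro a
    rw [← h1 a]
    have : ∀ q : Polynomial k, eval a (Polynomial.aeval (X i₀ : MvPolynomial (Fin n) k) q)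
        = q.eval (a i₀) := by
      intro q
      rw [Polynomial.aeval_def, Polynomial.hom_eval₂]
      simp only [eval_X, Polynomial.eval, Polynomial.eval₂_eq_sum_range]
      simp
    rw [this, hQ]
    congr 2
    ext i
    by_cases hi : i = i₀ <;> simp [hi]
  obtain ⟨μ, hμ0, hμ⟩ := map_fixed_iff t 0 P hs
  have hQμ : ∀ s : k, Q.eval (t * s) = μ * Q.eval s := by
    intro s
    rw [hQ, hQ, ← hμ]
    congr 2
    ext i
    by_cases hi : i = i₀ <;> simp [hi]
  by_cases h0 : Q.eval 0 = 0
  · have hd : Polynomial.X ∣ Q := by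
      rw [Polynomial.X_dvd_iff, Polynomial.coeff_zero_eq_eval_zero, h0]
    have hd' : (X i₀ : MvPolynomial (Fin n) k) ∣ P.rep := by
      rw [hQP]
      have := map_dvd (Polynomial.aeval (X i₀ : MvPolynomial (Fin n) k)) hd
      rwa [Polynomial.aeval_X] at this
    rw [← PD.mk_rep P, PD.mk_eq]
    exact ((X_prime (R := k)).irreducible.associated_of_dvd P.rep_irred hd').symm
  · exfalso
    have hμ1 : μ = 1 := by
      have := hQμ 0
      rw [mul_zero] at this
      apply mul_right_cancel₀ h0
      rw [← this, one_mul]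
    subst hμ1
    have hpow : ∀ N : ℕ, Q.eval ((t : k) ^ N) = Q.eval 1 := by
      intro N
      induction N with
      | zero => simp
      | succ N ih => rw [pow_succ', hQμ, ih, one_mul]
    have hinj : Function.Injective (fun N : ℕ => (t : k) ^ N) := by
      intro a b hab
      by_contra hne
      wlog hlt : a < b generalizing a b
      · exact this hab.symm (Ne.symm hne) (by omega)
      apply ht (b - a) (by omega)
      have : (t : k) ^ a * t ^ (b - a) = t ^ a * 1 := by
        rw [← pow_add, mul_one, show a + (b - a) = b by omega]; exact hab.symm
      exact mul_left_cancel₀ (pow_ne_zero _ t.ne_zero) this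
    have hC : Q = Polynomial.C (Q.eval 1) := by
      apply Polynomial.eq_of_infinite_eval_eq
      refine Set.Infinite.mono ?_ (Set.infinite_range_of_injective hinj)
      rintro _ ⟨N, rfl⟩
      simp [hpow N]
    rw [hC, Polynomial.aeval_C] at hQP
    have hne : Q.eval 1 ≠ 0 := by
      intro h
      rw [h, map_zero] at hQP
      exact P.rep_irred.ne_zero hQP
    apply P.rep_irred.not_isUnit
    rw [hQP]
    exact (IsUnit.mk0 _ hne).map _
end Poly
end PglAux
namespace PglAux
section Main
open MvPolynomial
set_option linter.unusedSectionVars false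
variable {k : Type} [Field k] [CharZero k] {n : ℕ}

/-- the function field -/
abbrev FF (k : Type) [Field k] (n : ℕ) : Type := FractionRing (MvPolynomial (Fin n) k)

/-- invertible matrices -/
abbrev GG (k : Type) [Field k] (n : ℕ) : Type := (Matrix (Fin (n + 1)) (Fin (n + 1)) k)ˣ

lemma ffinj : Function.Injective (algebraMap (MvPolynomial (Fin n) k) (FF k n)) :=
  IsFractionRing.injective _ _

lemma algMap_C (r : k) : algebraMap k (FF k n) r
    = algebraMap (MvPolynomial (Fin n) k) (FF k n) (C r) := by
  rw [IsScalarTower.algebraMap_apply k (MvPolynomial (Fin n) k) (FF k n)]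
  rfl

lemma ord_const (P : PD (MvPolynomial (Fin n) k)) (r : k) (hr : r ≠ 0) :
    ord P (algebraMap k (FF k n) r) = 0 := by
  rw [algMap_C]
  exact ord_unit P ((IsUnit.mk0 r hr).map C)

lemma ord_zero_const (g : FF k n) (hg : g ≠ 0)
    (h : ∀ P : PD (MvPolynomial (Fin n) k), ord P g = 0) :
    ∃ μ : kˣ, g = algebraMap k (FF k n) μ := by
  obtain ⟨u, hu⟩ := ord_eq_zero g hg h
  obtain ⟨r, hr, hu'⟩ := isUnit_iff_eq_C_of_isReduced.1 u.isUnit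
  refine ⟨hr.unit, ?_⟩
  rw [hu, hu', algMap_C]
  rfl

lemma sim_iff {a b : FF k n} (ha : a ≠ 0) (hb : b ≠ 0) :
    (∃ μ : kˣ, a = algebraMap k (FF k n) μ * b) ↔
      ∀ P : PD (MvPolynomial (Fin n) k), ord P a = ord P b := by
  constructor
  · rintro ⟨μ, rfl⟩ P
    rw [ord_mul P _ hb, ord_const P _ μ.ne_zero, zero_add]
    simp
  · intro h
    obtain ⟨μ, hμ⟩ := ord_zero_const (a / b) (div_ne_zero ha hb) (fun P => by
      rw [ord_div' P ha hb, h P, sub_self])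
    exact ⟨μ, by rw [← hμ, div_mul_cancel₀ _ hb]⟩

lemma triv_rho (ρ : FF k n ≃ₐ[k] FF k n) {g : FF k n} (hg : g ≠ 0)
    (h : ∀ P : PD (MvPolynomial (Fin n) k), ord P g = 0) (P : PD (MvPolynomial (Fin n) k)) :
    ord P (ρ g) = 0 := by
  obtain ⟨μ, rfl⟩ := ord_zero_const g hg h
  rw [AlgEquiv.commutes]
  exact ord_const P _ μ.ne_zero

/-- matrix of `x ↦ t x + v` -/
def amat (t : k) (v : Fin n → k) : Matrix (Fin (n + 1)) (Fin (n + 1)) k := fun i j =>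
  Fin.lastCases (motive := fun _ => k) (Fin.lastCases (motive := fun _ => k) 1 v j)
    (fun i' => Fin.lastCases (motive := fun _ => k) 0 (fun j' => if i' = j' then t else 0) j) i

@[simp] lemma amat_ll (t : k) (v : Fin n → k) : amat t v (Fin.last n) (Fin.last n) = 1 := by
  simp [amat]
@[simp] lemma amat_lc (t : k) (v : Fin n → k) (j : Fin n) :
    amat t v (Fin.last n) j.castSucc = v j := by
  simp [amat]
@[simp] lemma amat_cl (t : k) (v : Fin n → k) (j : Fin n) :
    amat t v j.castSucc (Fin.last n) = 0 := by
  simp [amat]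
@[simp] lemma amat_cc (t : k) (v : Fin n → k) (i j : Fin n) :
    amat t v i.castSucc j.castSucc = if i = j then t else 0 := by
  simp [amat]

lemma amat_mul (t s : k) (v w : Fin n → k) : amat t v * amat s w = amat (t * s) (s • v + w) := by
  ext i j
  rw [Matrix.mul_apply, Fin.sum_univ_castSucc]
  refine Fin.lastCases ?_ (fun i => ?_) i <;> refine Fin.lastCases ?_ (fun j => ?_) j <;>
    simp [mul_comm]

lemma amat_one : amat (1 : k) (0 : Fin n → k) = 1 := by
  ext i j
  refine Fin.lastCases ?_ (fun i => ?_) i <;> refine Fin.lastCases ?_ (fun j => ?_) j <;>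
    simp [Matrix.one_apply, Fin.castSucc_ne_last, (Fin.castSucc_ne_last _).symm]

/-- as a unit -/
def amatU (t : kˣ) (v : Fin n → k) : GG k n where
  val := amat t v
  inv := amat ((t⁻¹ : kˣ) : k) (-(((t⁻¹ : kˣ) : k) • v))
  val_inv := by rw [amat_mul]; simp [amat_one]
  inv_val := by rw [amat_mul]; simp [amat_one]

lemma amatU_mul (v w : Fin n → k) : amatU 1 v * amatU 1 w = amatU 1 (v + w) := by
  apply Units.ext
  change amat _ _ * amat _ _ = amat _ _
  rw [amat_mul]; simp

/-- data of the action -/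
structure Act (k : Type) [Field k] (n : ℕ) where
  den : GG k n → FF k n
  ρ : GG k n → (FF k n ≃ₐ[k] FF k n)
  hden : ∀ A, den A = (∑ i : Fin n, algebraMap k (FF k n) (A.val i.castSucc (Fin.last n)) *
    algebraMap (MvPolynomial (Fin n) k) (FF k n) (X i))
      + algebraMap k (FF k n) (A.val (Fin.last n) (Fin.last n))
  hmul : ∀ A B y, ρ (A * B) y = ρ A (ρ B y)
  hval : ∀ A j, ρ A (algebraMap (MvPolynomial (Fin n) k) (FF k n) (X j)) * den A =
    (∑ i : Fin n, algebraMap k (FF k n) (A.val i.castSucc j.castSucc) *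
    algebraMap (MvPolynomial (Fin n) k) (FF k n) (X i))
      + algebraMap k (FF k n) (A.val (Fin.last n) j.castSucc)

namespace Act
variable (S : Act k n)

lemma den_mul (A B : GG k n) : S.den (A * B) = S.den A * S.ρ A (S.den B) := by
  rw [S.hden B, map_add, map_sum, mul_add, Finset.mul_sum]
  simp only [map_mul, AlgEquiv.commutes]
  have h : ∀ i : Fin n, S.den A * (algebraMap k (FF k n) (B.val i.castSucc (Fin.last n)) *
      S.ρ A (algebraMap (MvPolynomial (Fin n) k) (FF k n) (X i)))
      = algebraMap k (FF k n) (B.val i.castSucc (Fin.last n)) *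
      ((∑ i' : Fin n, algebraMap k (FF k n) (A.val i'.castSucc i.castSucc) *
    algebraMap (MvPolynomial (Fin n) k) (FF k n) (X i'))
      + algebraMap k (FF k n) (A.val (Fin.last n) i.castSucc)) := by
    intro i
    rw [← S.hval]; ring
  simp only [h]
  rw [S.hden A, S.hden (A * B)]
  simp only [Units.val_mul, Matrix.mul_apply, Fin.sum_univ_castSucc, map_add, map_sum, map_mul,
    mul_add, add_mul, Finset.sum_add_distrib, Finset.sum_mul, Finset.mul_sum]
  rw [Finset.sum_comm]
  have e1 : ∀ a b c d a' b' c' d' : FF k n, a = a' → b = b' → c = c' → d = d' →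
      a + b + (c + d) = a' + c' + (b' + d') := by
    intros; subst_vars; ring
  apply e1
  · refine Finset.sum_congr rfl fun i _ => Finset.sum_congr rfl fun j _ => by ring
  · refine Finset.sum_congr rfl fun i _ => by ring
  · refine Finset.sum_congr rfl fun i _ => by ring
  · ring

lemma den_one : S.den 1 = 1 := by
  rw [S.hden]
  simp [Matrix.one_apply, Fin.castSucc_ne_last]

lemma den_ne (A : GG k n) : S.den A ≠ 0 := by
  intro h
  have := S.den_mul A A⁻¹
  rw [mul_inv_cancel, S.den_one, h, zero_mul] at this
  exact one_ne_zero this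

lemma rho_aff (t : kˣ) (v : Fin n → k) (p : MvPolynomial (Fin n) k) :
    S.ρ (amatU t v) (algebraMap _ (FF k n) p) = algebraMap _ (FF k n) (aff t v p) := by
  have h1 : S.den (amatU t v) = 1 := by
    rw [S.hden]; simp [amatU]
  have : ((S.ρ (amatU t v)).toAlgHom.comp (IsScalarTower.toAlgHom k (MvPolynomial (Fin n) k) (FF k n)))
      = (IsScalarTower.toAlgHom k (MvPolynomial (Fin n) k) (FF k n)).comp (aff t v).toAlgHom := by
    apply MvPolynomial.algHom_ext
    intro j
    have := S.hval (amatU t v) j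
    rw [h1, mul_one] at this
    change S.ρ (amatU t v) (algebraMap _ (FF k n) (X j)) = algebraMap _ (FF k n) (aff t v (X j))
    rw [this, aff_X, map_add, map_mul, ← algMap_C, ← algMap_C]
    simp only [amatU, amat_cc, amat_lc]
    rw [Finset.sum_eq_single j]
    · simp
    · intro b _ hb; simp [hb]
    · simp
  exact congrArg (fun f => f p) this

lemma ord_aff (t : kˣ) (v : Fin n → k) (P : PD (MvPolynomial (Fin n) k)) {g : FF k n}
    (hg : g ≠ 0) :
    ord (PD.map (aff t v).toRingEquiv P) (S.ρ (amatU t v) g) = ord P g :=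
  ord_map (aff t v).toRingEquiv (S.ρ (amatU t v)).toRingEquiv (fun a => S.rho_aff t v a) P hg

lemma ord_tr (v : Fin n → k) (P : PD (MvPolynomial (Fin n) k)) {g : FF k n}
    (hg : g ≠ 0) : ord P (S.ρ (amatU 1 v) g) = ord (-v +ᵥ P) g := by
  rw [← S.ord_aff 1 v (-v +ᵥ P) hg, ← vadd_def']
  simp

lemma inv_triv {g : FF k n} (hg : g ≠ 0)
    (h : ∀ (v : Fin n → k) (P : PD (MvPolynomial (Fin n) k)),
      ord P (S.ρ (amatU 1 v) g) = ord P g) (P : PD (MvPolynomial (Fin n) k)) : ord P g = 0 := by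
  by_contra hne
  refine no_fixed P fun i => ?_
  refine inv_fixed hst (fun P => ord P g) (ord_finite g hg) _ (fun P => ?_) P hne
  have := h (-Pi.single i 1) P
  rw [S.ord_tr _ _ hg, neg_neg] at this
  exact this

/-- cocycles modulo constants -/
structure Coc (e : GG k n → FF k n) : Prop where
  ne : ∀ A, e A ≠ 0
  coc : ∀ A B (P : PD (MvPolynomial (Fin n) k)),
    ord P (e (A * B)) = ord P (e A) + ord P (S.ρ A (e B))

/-- trivial value -/
def Triv (e : GG k n → FF k n) (A : GG k n) : Prop :=
  ∀ P : PD (MvPolynomial (Fin n) k), ord P (e A) = 0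

variable {S} {e : GG k n → FF k n}

lemma Coc.right (h : S.Coc e) (A : GG k n) {B : GG k n} (hB : Triv e B)
    (P : PD (MvPolynomial (Fin n) k)) : ord P (e (A * B)) = ord P (e A) := by
  rw [h.coc, triv_rho _ (h.ne B) hB, add_zero]

lemma Coc.left (h : S.Coc e) {A : GG k n} (hA : Triv e A) (B : GG k n)
    (P : PD (MvPolynomial (Fin n) k)) : ord P (e (A * B)) = ord P (S.ρ A (e B)) := by
  rw [h.coc, hA, zero_add]

lemma Coc.mul (h : S.Coc e) {A B : GG k n} (hA : Triv e A) (hB : Triv e B) : Triv e (A * B) :=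
  fun P => by rw [h.right A hB, hA]

lemma Coc.affine (h : S.Coc e) (hT : ∀ v, Triv e (amatU 1 v)) (A : GG k n)
    (hA : ∀ i : Fin n, A.val i.castSucc (Fin.last n) = 0) : Triv e A := by
  have hs : A.val (Fin.last n) (Fin.last n) ≠ 0 := by
    intro h0
    have := congrFun (congrFun A.inv_val (Fin.last n)) (Fin.last n)
    rw [Matrix.mul_apply, Fin.sum_univ_castSucc] at this
    simp [hA, h0] at this
  refine S.inv_triv (h.ne A) fun v P => ?_
  set vv : Fin n → k := fun j => (A.val (Fin.last n) (Fin.last n))⁻¹ *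
    ∑ i : Fin n, v i * A.val i.castSucc j.castSucc with hvv
  have hcomm : amatU 1 v * A = A * amatU 1 vv := by
    apply Units.ext
    change amat _ _ * A.val = A.val * amat _ _
    ext i j
    rw [Matrix.mul_apply, Matrix.mul_apply, Fin.sum_univ_castSucc, Fin.sum_univ_castSucc]
    refine Fin.lastCases ?_ (fun i => ?_) i <;> refine Fin.lastCases ?_ (fun j => ?_) j
    · simp [hA]
    · simp [hvv, hs, add_comm]
    · simp [hA]
    · simp [hA]
  rw [← h.left (hT v) A, hcomm, h.right A (hT vv)]

/-- the swap -/
def wU (i₀ : Fin n) : GG k n := Matrix.GeneralLinearGroup.swap k i₀.castSucc (Fin.last n)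

lemma wU_mul_self (i₀ : Fin n) : (wU i₀ * wU i₀ : GG k n) = 1 := by
  apply Units.ext
  exact Matrix.swap_mul_self _ _

lemma wU_conj (i₀ : Fin n) (A : GG k n)
    (h : ∀ j, j ≠ i₀.castSucc → A.val j i₀.castSucc = 0) (i : Fin n) :
    (wU i₀ * A * wU i₀).val i.castSucc (Fin.last n) = 0 := by
  change (Matrix.swap k i₀.castSucc (Fin.last n) * A.val *
    Matrix.swap k i₀.castSucc (Fin.last n)) i.castSucc (Fin.last n) = 0
  rw [Matrix.mul_swap_apply_right]
  by_cases hi : i = i₀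
  · subst hi
    rw [Matrix.swap_mul_apply_left]
    exact h _ (Fin.castSucc_ne_last _).symm
  · have hne : i.castSucc ≠ i₀.castSucc := by simpa using hi
    rw [Matrix.swap_mul_of_ne hne (Fin.castSucc_ne_last _)]
    exact h _ hne

lemma den_wU (i₀ : Fin n) : S.den (wU i₀) = algebraMap (MvPolynomial (Fin n) k) (FF k n) (X i₀) := by
  rw [S.hden]
  have h1 : ∀ j, (wU i₀ : GG k n).val j (Fin.last n) = (1 : Matrix _ _ k) j i₀.castSucc := by
    intro j
    have := Matrix.mul_swap_apply_right (R := k) i₀.castSucc (Fin.last n) j 1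
    rw [one_mul] at this
    exact this
  simp only [h1]
  simp [Matrix.one_apply, (Fin.castSucc_ne_last _).symm]

lemma Coc.w_inv (h : S.Coc e) (hT : ∀ v, Triv e (amatU 1 v)) (i₀ : Fin n) (A : GG k n)
    (hA : ∀ i : Fin n, A.val i.castSucc (Fin.last n) = 0)
    (hA' : ∀ j, j ≠ i₀.castSucc → A.val j i₀.castSucc = 0) (P : PD (MvPolynomial (Fin n) k)) :
    ord P (S.ρ A (e (wU i₀))) = ord P (e (wU i₀)) := by
  have h1 := h.affine hT A hA
  have h2 := h.affine hT (wU i₀ * A * wU i₀) (wU_conj i₀ A hA')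
  rw [← h.left h1, ← h.right (wU i₀) h2, ← mul_assoc, ← mul_assoc, wU_mul_self, one_mul]

lemma Coc.w_supp (h : S.Coc e) (hT : ∀ v, Triv e (amatU 1 v)) (i₀ : Fin n)
    (P : PD (MvPolynomial (Fin n) k)) (hP : ord P (e (wU i₀)) ≠ 0) :
    P = PD.mk (X i₀) (X_prime (R := k)).irreducible := by
  have hne := h.ne (wU i₀)
  have hfin := ord_finite (R := MvPolynomial (Fin n) k) _ hne
  have htr : ∀ i, i ≠ i₀ → (Pi.single i (1 : k) : Fin n → k) +ᵥ P = P := by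
    intro i hi
    refine inv_fixed hst (fun P => ord P (e (wU i₀))) hfin _ (fun P => ?_) P hP
    have := h.w_inv hT i₀ (amatU 1 (-Pi.single i 1)) (by simp [amatU]) (by
      intro j
      refine Fin.lastCases ?_ (fun j => ?_) j
      · intro _
        simp [amatU, hi.symm]
      · intro hj
        have : j ≠ i₀ := by simpa using hj
        simp [amatU, this]) P
    rw [S.ord_tr _ _ hne, neg_neg] at this
    exact this
  set t : kˣ := Units.mk0 2 two_ne_zero with ht
  have hsc : ∀ P, ord (PD.map (aff t (0 : Fin n → k)).toRingEquiv P) (e (wU i₀))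
      = ord P (e (wU i₀)) := by
    intro P
    rw [← S.ord_aff t 0 P hne]
    refine (h.w_inv hT i₀ (amatU t 0) (by simp [amatU]) (by
      intro j
      refine Fin.lastCases ?_ (fun j => ?_) j
      · intro _
        simp [amatU]
      · intro hj
        have : j ≠ i₀ := by simpa using hj
        simp [amatU, this]) _).symm
  have hscN : ∀ N : ℕ, ord (PD.map (aff (t ^ N) (0 : Fin n → k)).toRingEquiv P) (e (wU i₀))
      = ord P (e (wU i₀)) := by
    intro N
    induction N with
    | zero => rw [pow_zero, map_id]
    | succ N ih =>
      rw [← ih, ← hsc (PD.map (aff (t ^ N) 0).toRingEquiv P), map_comp, pow_succ']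
      simp
  have : Finite (Function.support fun P : PD (MvPolynomial (Fin n) k) => ord P (e (wU i₀))) := hfin
  obtain ⟨a, b, hab, heq⟩ := Finite.exists_ne_map_eq_of_infinite
    (fun N : ℕ => (⟨PD.map (aff (t ^ N) (0 : Fin n → k)).toRingEquiv P, by
      rw [Function.mem_support, hscN]; exact hP⟩ :
      Function.support fun P : PD (MvPolynomial (Fin n) k) => ord P (e (wU i₀))))
  replace heq := congrArg Subtype.val heq
  simp only at heq
  wlog hlt : a < b generalizing a b
  · exact this b a hab.symm heq.symm (by omega)
  have hfix : PD.map (aff (t ^ (b - a)) (0 : Fin n → k)).toRingEquiv P = P := by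
    have h1 := congrArg (PD.map (aff ((t ^ a)⁻¹) (0 : Fin n → k)).toRingEquiv) heq
    rw [map_comp, map_comp] at h1
    simp only [inv_mul_cancel, smul_zero, add_zero] at h1
    rw [map_id] at h1
    conv_rhs => rw [h1]
    rw [show t ^ b = t ^ a * t ^ (b - a) by rw [← pow_add]; congr 1; omega, inv_mul_cancel_left]
  refine scale_fixed i₀ P htr _ ?_ hfix
  intro N hN h1
  rw [ht] at h1
  simp only [Units.val_pow_eq_pow_val, Units.val_mk0, ← pow_mul] at h1
  have h2 : (2 : ℕ) ^ ((b - a) * N) = 1 := by exact_mod_cast h1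
  have h3 : (b - a) * N ≠ 0 := Nat.mul_ne_zero (by omega) (by omega)
  exact absurd h2 (Nat.one_lt_two_pow h3).ne'

lemma Coc.all (h : S.Coc e) (hT : ∀ v, Triv e (amatU 1 v)) (i₀ : Fin n)
    (hw : Triv e (wU i₀)) (A : GG k n) : Triv e A := by
  refine Matrix.diagonal_transvection_induction_of_det_ne_zero
    (fun M => ∀ A : GG k n, A.val = M → Triv e A) A.val ?_ ?_ ?_ ?_ A rfl
  · exact ((Matrix.isUnit_iff_isUnit_det _).1 A.isUnit).ne_zero
  · intro D _ B hB
    refine h.affine hT B fun i => ?_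
    rw [hB, Matrix.diagonal_apply_ne _ (Fin.castSucc_ne_last i)]
  · rintro ⟨i, j, hij, r⟩ B hB
    simp only [Matrix.TransvectionStruct.toMatrix, Matrix.transvection] at hB
    by_cases hj : j = Fin.last n
    · subst hj
      have h2 := h.affine hT (wU i₀ * B * wU i₀) (wU_conj i₀ B (by
        intro l hl
        rw [hB]
        simp [Matrix.one_apply, hl, Matrix.single_apply, (Fin.castSucc_ne_last _).symm]))
      have h3 := h.mul (h.mul hw h2) hw
      rwa [← mul_assoc, ← mul_assoc, wU_mul_self, one_mul, mul_assoc, wU_mul_self, mul_one] at h3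
    · refine h.affine hT B fun l => ?_
      rw [hB]
      simp [Matrix.one_apply, Matrix.single_apply, hj, Fin.castSucc_ne_last]
  · intro M N hM hN ihM ihN B hB
    obtain ⟨UM, hUM⟩ := (Matrix.isUnit_iff_isUnit_det M).2 (IsUnit.mk0 _ hM)
    obtain ⟨UN, hUN⟩ := (Matrix.isUnit_iff_isUnit_det N).2 (IsUnit.mk0 _ hN)
    have : B = UM * UN := by
      apply Units.ext
      rw [hB, Units.val_mul, hUM, hUN]
    rw [this]
    exact h.mul (ihM UM hUM) (ihN UN hUN)

lemma exists_main (hc : S.Coc e) (hn : 1 ≤ n) : ∃ (m : ℤ) (g : FF k n), g ≠ 0 ∧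
    ∀ A (P : PD (MvPolynomial (Fin n) k)),
      ord P (e A * S.den A ^ m * S.ρ A g) = ord P g := by
  set i₀ : Fin n := ⟨0, hn⟩
  obtain ⟨f, hf, hf2⟩ := many_vec hst (fun (v : Fin n → k) P => ord P (e (amatU 1 v)))
    (fun v => ord_finite _ (hc.ne _))
    (fun v w P => by
      rw [← amatU_mul, hc.coc, S.ord_tr _ _ (hc.ne _)])
    (List.ofFn fun i : Fin n => (Pi.single i (1 : k) : Fin n → k))
  have hf3 : ∀ w P, ord P (e (amatU 1 w)) = f P - f (-w +ᵥ P) := by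
    intro w P
    refine hf2 w P ?_
    by_contra hcon
    push Not at hcon
    exact no_fixed P fun i => hcon _ (by simp [List.mem_ofFn])
  obtain ⟨g, hg, hgf⟩ := exists_div (L := FF k n) f hf
  have hρ0 : ∀ A {y : FF k n}, y ≠ 0 → S.ρ A y ≠ 0 := fun A y hy => by simpa using hy
  set c' : GG k n → FF k n := fun A => e A * S.ρ A g / g with hc'
  have hc1 : S.Coc c' := by
    refine ⟨fun A => div_ne_zero (mul_ne_zero (hc.ne A) (hρ0 A hg)) hg, fun A B P => ?_⟩
    simp only [hc', map_div₀, map_mul]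
    have n1 := hc.ne (A * B)
    have n2 := hc.ne A
    have n3 := hρ0 A (hc.ne B)
    have n4 := hρ0 (A * B) hg
    have n5 := hρ0 A hg
    have n6 := hρ0 A (hρ0 B hg)
    rw [ord_div' P (mul_ne_zero n1 n4) hg, ord_div' P (mul_ne_zero n2 n5) hg,
      ord_div' P (mul_ne_zero n3 n6) n5, ord_mul P n1 n4, ord_mul P n2 n5, ord_mul P n3 n6,
      hc.coc, S.hmul]
    ring
  have hT : ∀ v, Triv c' (amatU 1 v) := by
    intro v P
    simp only [hc']
    rw [ord_div' P (mul_ne_zero (hc.ne _) (hρ0 _ hg)) hg, ord_mul P (hc.ne _) (hρ0 _ hg), hf3,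
      S.ord_tr _ _ hg, hgf, hgf]
    ring
  set P₁ : PD (MvPolynomial (Fin n) k) := PD.mk (X i₀) (X_prime (R := k)).irreducible
  set m : ℤ := - ord P₁ (c' (wU i₀)) with hm
  set e' : GG k n → FF k n := fun A => c' A * S.den A ^ m with he'
  have hd : ∀ A, S.den A ^ m ≠ 0 := fun A => zpow_ne_zero _ (S.den_ne A)
  have hc2 : S.Coc e' := by
    refine ⟨fun A => mul_ne_zero (hc1.ne A) (hd A), fun A B P => ?_⟩
    simp only [he', map_mul, map_zpow₀]
    have n1 := hρ0 A (S.den_ne B)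
    rw [ord_mul P (hc1.ne _) (hd _), ord_mul P (hc1.ne _) (hd _),
      ord_mul P (hρ0 A (hc1.ne _)) (zpow_ne_zero _ n1), ord_zpow P (S.den_ne _),
      ord_zpow P (S.den_ne _), ord_zpow P n1, hc1.coc, S.den_mul, ord_mul P (S.den_ne A) n1]
    ring
  have hT2 : ∀ v, Triv e' (amatU 1 v) := by
    intro v P
    have h1 : S.den (amatU 1 v) = 1 := by
      rw [S.hden]; simp [amatU]
    simp only [he']
    rw [h1, one_zpow, mul_one, hT v P]
  have hw : Triv e' (wU i₀) := by
    classical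
    intro P
    simp only [he']
    rw [ord_mul P (hc1.ne _) (hd _), ord_zpow P (S.den_ne _), den_wU,
      ord_irred P (X_prime (R := k)).irreducible]
    by_cases hP : P = P₁
    · rw [if_pos hP, hP, hm]; ring
    · rw [if_neg hP, mul_zero, add_zero]
      by_contra hne
      exact hP (hc1.w_supp hT i₀ P hne)
  refine ⟨m, g, hg, fun A P => ?_⟩
  have := hc2.all hT2 i₀ hw A P
  simp only [he', hc'] at this
  rw [ord_mul P (div_ne_zero (mul_ne_zero (hc.ne A) (hρ0 A hg)) hg) (hd A),
    ord_div' P (mul_ne_zero (hc.ne A) (hρ0 A hg)) hg, ord_mul P (hc.ne A) (hρ0 A hg)] at this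
  rw [ord_mul P (mul_ne_zero (hc.ne A) (hd A)) (hρ0 A hg), ord_mul P (hc.ne A) (hd A)]
  linarith

variable (S) in
lemma unique_main (hn : 1 ≤ n) (m m' : ℤ) (g : FF k n) (hg : g ≠ 0)
    (h : ∀ A (P : PD (MvPolynomial (Fin n) k)),
      ord P (S.den A ^ (-m) * S.ρ A g) = ord P (S.den A ^ (-m') * g)) : m = m' := by
  classical
  have hρ0 : ∀ A {y : FF k n}, y ≠ 0 → S.ρ A y ≠ 0 := fun A y hy => by simpa using hy
  have hg0 := S.inv_triv hg (fun v P => by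
    have h1 : S.den (amatU 1 v) = 1 := by
      rw [S.hden]; simp [amatU]
    have := h (amatU 1 v) P
    simpa [h1] using this)
  set i₀ : Fin n := ⟨0, hn⟩
  set P₁ : PD (MvPolynomial (Fin n) k) := PD.mk (X i₀) (X_prime (R := k)).irreducible with hP₁
  have := h (wU i₀) P₁
  rw [ord_mul _ (zpow_ne_zero _ (S.den_ne _)) (hρ0 _ hg), ord_mul _ (zpow_ne_zero _ (S.den_ne _)) hg,
    triv_rho _ hg hg0, hg0, ord_zpow _ (S.den_ne _), ord_zpow _ (S.den_ne _), den_wU,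
    ord_irred _ (X_prime (R := k)).irreducible, if_pos hP₁] at this
  linarith

end Act
end Main
end PglAux
/-- **`H¹(PGL_{n+1}(k), L^×/k^×) ≅ ℤ`.**
Let `L = k(x₁,…,xₙ)` (the fraction field of `MvPolynomial (Fin n) k`) with the action of
`PGL_{n+1}(k)` by projective transformations, encoded by a map `ρ` from `GL_{n+1}(k)`
to automorphisms of `L` with `ρ(AB) = ρ(A)∘ρ(B)` and
`ρ(A)(xⱼ)·d_A = A_{1j}x₁ + ⋯ + A_{nj}xₙ + A_{n+1,j}`, where
`d_A = A_{1,n+1}x₁ + ⋯ + A_{n,n+1}xₙ + A_{n+1,n+1}` (so `ρ` factors through `PGL`).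
Every `1`-cocycle `c` of `PGL_{n+1}(k)` with values in `L^×/k^×` (encoded as a map on
`GL_{n+1}(k)`, invariant under scalars and a cocycle up to `k^×`) is cohomologous to
`A ↦ d_A^{-m}` for a unique integer `m`. -/
theorem pgl_cocycles_mod_constants_integer
    (k : Type) [Field k] [CharZero k] (n : ℕ) (hn : 1 ≤ n)
    (x : Fin n → FractionRing (MvPolynomial (Fin n) k))
    (hx : ∀ j, x j = algebraMap (MvPolynomial (Fin n) k) (FractionRing (MvPolynomial (Fin n) k))
      (MvPolynomial.X j))
    (den : (Matrix (Fin (n + 1)) (Fin (n + 1)) k)ˣ → FractionRing (MvPolynomial (Fin n) k))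
    (hden : ∀ A, den A = (∑ i : Fin n,
        algebraMap k (FractionRing (MvPolynomial (Fin n) k)) (A.val i.castSucc (Fin.last n)) * x i)
      + algebraMap k (FractionRing (MvPolynomial (Fin n) k)) (A.val (Fin.last n) (Fin.last n)))
    (num : (Matrix (Fin (n + 1)) (Fin (n + 1)) k)ˣ → Fin n → FractionRing (MvPolynomial (Fin n) k))
    (hnum : ∀ A j, num A j = (∑ i : Fin n,
        algebraMap k (FractionRing (MvPolynomial (Fin n) k)) (A.val i.castSucc j.castSucc) * x i)
      + algebraMap k (FractionRing (MvPolynomial (Fin n) k)) (A.val (Fin.last n) j.castSucc))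
    (ρ : (Matrix (Fin (n + 1)) (Fin (n + 1)) k)ˣ →
      (FractionRing (MvPolynomial (Fin n) k) ≃ₐ[k] FractionRing (MvPolynomial (Fin n) k)))
    (hρmul : ∀ A B y, ρ (A * B) y = ρ A (ρ B y))
    (hρval : ∀ A j, ρ A (x j) * den A = num A j)
    (c : (Matrix (Fin (n + 1)) (Fin (n + 1)) k)ˣ → FractionRing (MvPolynomial (Fin n) k))
    (hc0 : ∀ A, c A ≠ 0)
    (hccoc : ∀ A B, ∃ μ : kˣ, c (A * B)
      = algebraMap k (FractionRing (MvPolynomial (Fin n) k)) μ * (c A * ρ A (c B)))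
    (hcscal : ∀ A B : (Matrix (Fin (n + 1)) (Fin (n + 1)) k)ˣ,
      (∃ lam : k, A.val = lam • B.val) → ∃ μ : kˣ,
        c A = algebraMap k (FractionRing (MvPolynomial (Fin n) k)) μ * c B) :
    (∃ (m : ℤ) (g : FractionRing (MvPolynomial (Fin n) k)), g ≠ 0 ∧
      ∀ A, ∃ μ : kˣ, c A * den A ^ m * ρ A g
        = algebraMap k (FractionRing (MvPolynomial (Fin n) k)) μ * g) ∧
    (∀ (m m' : ℤ) (g : FractionRing (MvPolynomial (Fin n) k)), g ≠ 0 →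
      (∀ A, ∃ μ : kˣ, den A ^ (-m) * ρ A g
        = algebraMap k (FractionRing (MvPolynomial (Fin n) k)) μ * (den A ^ (-m') * g)) →
      m = m') := by
  have hρ0 : ∀ A {y : FractionRing (MvPolynomial (Fin n) k)}, y ≠ 0 → ρ A y ≠ 0 :=
    fun A y hy => by simpa using hy
  let S : PglAux.Act k n :=
    { den := den
      ρ := ρ
      hden := by simpa only [hx] using hden
      hmul := hρmul
      hval := by
        intro A j
        have := hρval A j
        rw [hnum] at this
        simpa only [hx] using this }
  have hd0 : ∀ A, den A ≠ 0 := S.den_ne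
  constructor
  · have hcoc : S.Coc c := by
      refine ⟨hc0, fun A B P => ?_⟩
      rw [(PglAux.sim_iff (hc0 _) (mul_ne_zero (hc0 A) (hρ0 A (hc0 B)))).1 (hccoc A B) P,
        PglAux.ord_mul P (hc0 A) (hρ0 A (hc0 B))]
    obtain ⟨m, g, hg, h⟩ := PglAux.Act.exists_main hcoc hn
    refine ⟨m, g, hg, fun A => ?_⟩
    exact (PglAux.sim_iff (mul_ne_zero (mul_ne_zero (hc0 A) (zpow_ne_zero _ (hd0 A)))
      (hρ0 A hg)) hg).2 (h A)
  · intro m m' g hg h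
    refine PglAux.Act.unique_main S hn m m' g hg fun A => ?_
    exact (PglAux.sim_iff (mul_ne_zero (zpow_ne_zero _ (hd0 A)) (hρ0 A hg))
      (mul_ne_zero (zpow_ne_zero _ (hd0 A)) hg)).1 (h A)
end
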